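/- Let K be a number field, let E be a finite étale commutative K-algebra of K-dimension n, and let σ be a K-linear algebra involution of E with dim_K E^σ = ⌊(n+1)/2⌋. Let f be a nondegenerate symmetric K-bilinear form on V = K^n. Assume: (a) for every place v of K (finite or archimedean), with completion K_v, there exists an injective K_v-algebra homomorphism ι_v : E ⊗_K K_v → End_{K_v}(K_v^n) such that f_v(ι_v(a)x, y) = f_v(x, ι_v((σ ⊗ id)(a))y) for all a and all x, y ∈ K_v^n, where f_v is the base change of f; and (b) there exists a real archimedean place v of K such that, identifying K_v with ℝ, the ℝ-algebra with involution (E ⊗_K K_v, σ ⊗ id) is isomorphic to (ℂ, complex conjugation)^m if n = 2m, or to (ℂ, complex conjugation)^m × (ℝ, identity) if n = 2m + 1, via an ℝ-algebra isomorphism intertwining the involutions. Then there exists an injective K-algebra homomorphism ι : E → End_K(V) such that f(ι(a)x, y) = f(x, ι(σ(a))y) for all a ∈ E and x, y ∈ V. -/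

import Mathlib

/-- Given a field `K`, a commutative `K`-algebra `E` with a `K`-algebra involution `σ`, and a
symmetric matrix `M` (the Gram matrix of a symmetric bilinear form `f` on `K^n`), the predicate
stating that over a field extension `Kv` of `K` there exists an injective `Kv`-algebra
homomorphism `ι : E ⊗[K] Kv → End_{Kv} (Kv^n)` compatible with `σ ⊗ id` and the base change
`f_v` of `f`, i.e. `f_v (ι a x, y) = f_v (x, ι ((σ ⊗ id) a) y)` for all `a, x, y`. -/
def CompatibleLocalEmbedding (K : Type*) [Field K] (E : Type*) [CommRing E] [Algebra K E]
    (σ : E →ₐ[K] E) (n : ℕ) (M : Matrix (Fin n) (Fin n) K)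
    (Kv : Type*) [Field Kv] [Algebra K Kv] : Prop :=
  ∃ ι : TensorProduct K Kv E →ₐ[Kv] Module.End Kv (Fin n → Kv),
    Function.Injective ι ∧
      ∀ (a : TensorProduct K Kv E) (x y : Fin n → Kv),
        dotProduct (ι a x) ((M.map (algebraMap K Kv)).mulVec y) =
          dotProduct x ((M.map (algebraMap K Kv)).mulVec
            (ι (Algebra.TensorProduct.map (AlgHom.id K Kv) σ a) y))

/-- Given a real embedding `φ : K → ℝ` (identifying the completion of `K` at the corresponding
real place with `ℝ`), the predicate stating that the `ℝ`-algebra with involution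
`(E ⊗_K ℝ, σ ⊗ id)` is isomorphic to `(ℂ, conj)^m` when `n = 2m`, resp. to
`(ℂ, conj)^m × (ℝ, id)` when `n = 2m + 1` — both cases are captured uniformly by the target
`(ℂ)^(n / 2) × (ℝ)^(n % 2)` with the involution acting by complex conjugation on each `ℂ`
factor and by the identity on the `ℝ` factor. -/
def IsAnisotropicRealFiber (K : Type*) [Field K] (E : Type*) [CommRing E] [Algebra K E]
    (σ : E →ₐ[K] E) (n : ℕ) (φ : K →+* ℝ) : Prop :=
  letI := φ.toAlgebra
  ∃ e : TensorProduct K ℝ E ≃ₐ[ℝ] ((Fin (n / 2) → ℂ) × (Fin (n % 2) → ℝ)),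
    ∀ a : TensorProduct K ℝ E,
      e (Algebra.TensorProduct.map (AlgHom.id K ℝ) σ a) =
        (fun i => (starRingEnd ℂ) ((e a).1 i), (e a).2)

universe u
set_option linter.all false

namespace HM
open NumberField IsDedekindDomain

/-- places -/
inductive Pl (K : Type*) [Field K] [NumberField K]
  | fin (v : HeightOneSpectrum (𝓞 K))
  | inf (v : InfinitePlace K)

variable {K : Type*} [Field K] [NumberField K]

/-- absolute value -/
noncomputable def Pl.abs : Pl K → AbsoluteValue K ℝ
  | .fin v => HeightOneSpectrum.adicAbv K v
  | .inf v => v.1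

/-- completion -/
abbrev Pl.C (v : Pl K) := v.abs.Completion

lemma norm_alg (v : Pl K) (x : K) : ‖algebraMap K v.C x‖ = v.abs x := by
  have : algebraMap K v.C x = ((WithAbs.toAbs v.abs x : WithAbs v.abs) : v.C) := rfl
  rw [this, UniformSpace.Completion.norm_coe]; rfl

lemma dense_alg (v : Pl K) : DenseRange (algebraMap K v.C) := by
  have h := UniformSpace.Completion.denseRange_coe (α := WithAbs v.abs)
  intro x
  refine closure_mono ?_ (h x)
  rintro _ ⟨y, rfl⟩
  exact ⟨WithAbs.ofAbs y, rfl⟩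
lemma fin_abs (p : HeightOneSpectrum (𝓞 K)) (x : K) : (Pl.fin p).abs x =
    WithZeroMulInt.toNNReal (HeightOneSpectrum.absNorm_ne_zero p) (p.valuation K x) := rfl

lemma fin_lt (p : HeightOneSpectrum (𝓞 K)) {x y : K} :
    (Pl.fin p).abs x < (Pl.fin p).abs y ↔ p.valuation K x < p.valuation K y := by
  rw [fin_abs, fin_abs, NNReal.coe_lt_coe]
  exact (WithZeroMulInt.toNNReal_strictMono (HeightOneSpectrum.one_lt_absNorm_nnreal p)).lt_iff_lt

lemma fin_le (p : HeightOneSpectrum (𝓞 K)) {x y : K} :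
    (Pl.fin p).abs x ≤ (Pl.fin p).abs y ↔ p.valuation K x ≤ p.valuation K y := by
  rw [← not_lt, fin_lt, not_lt]

lemma fin_add (p : HeightOneSpectrum (𝓞 K)) (x y : K) :
    (Pl.fin p).abs (x + y) ≤ max ((Pl.fin p).abs x) ((Pl.fin p).abs y) :=
  HeightOneSpectrum.adicAbv_add_le_max K p x y

lemma fin_int (p : HeightOneSpectrum (𝓞 K)) (x : 𝓞 K) : (Pl.fin p).abs (x : K) ≤ 1 := by
  have := (fin_le p (x := (x : K)) (y := 1)).2 (by simpa using p.valuation_le_one x)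
  simpa using this

lemma Pl.nontriv (v : Pl K) : v.abs.IsNontrivial := by
  cases v with
  | inf v => exact v.isNontrivial
  | fin p =>
    obtain ⟨x, hx⟩ := p.valuation_exists_uniformizer K
    have hx0 : x ≠ 0 := by
      rintro rfl; rw [map_zero] at hx; exact WithZero.coe_ne_zero hx.symm
    refine ⟨x, hx0, ?_⟩
    have : (Pl.fin p).abs x < (Pl.fin p).abs 1 := (fin_lt p).2 (by
      rw [hx, map_one, ← WithZero.coe_one, WithZero.exp, WithZero.coe_lt_coe]; decide)
    rw [map_one] at this
    exact this.ne

lemma Pl.ineq {v w : Pl K} (h : v.abs.IsEquiv w.abs) : v = w := by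
  have key : ∀ (p : HeightOneSpectrum (𝓞 K)) (w : InfinitePlace K),
      ¬ (Pl.fin p).abs.IsEquiv (Pl.inf w).abs := by
    intro p w h
    have h2 := (AbsoluteValue.isEquiv_iff_lt_one_iff.1 h) (1 / 2)
    have h1 : (Pl.inf w).abs (1 / 2 : K) < 1 := by
      change w (1 / 2) < 1
      rw [map_div₀, map_one]
      have : w (2 : K) = 2 := by
        rw [← InfinitePlace.norm_embedding_eq, map_ofNat]; norm_num
      rw [this]; norm_num
    have h3 := h2.2 h1
    have h4 := fin_int p (2 : 𝓞 K)
    have h5 : (Pl.fin p).abs (1 / 2 : K) * (Pl.fin p).abs ((2 : 𝓞 K) : K) = 1 := by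
      rw [← map_mul, show ((2 : 𝓞 K) : K) = 2 from map_ofNat (algebraMap (𝓞 K) K) 2]; norm_num
    nlinarith [(Pl.fin p).abs.nonneg (1 / 2 : K), (Pl.fin p).abs.nonneg ((2 : 𝓞 K) : K)]
  cases v with
  | inf v => cases w with
    | inf w => exact congrArg _ (InfinitePlace.eq_iff_isEquiv.2 h)
    | fin p => exact (key _ _ h.symm).elim
  | fin p => cases w with
    | inf w => exact (key _ _ h).elim
    | fin q =>
      refine congrArg _ (HeightOneSpectrum.eq_of_valuation_isEquiv_valuation (K := K) ?_)
      intro x y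
      rw [← fin_le, ← fin_le]
      exact h x y

lemma weak_approx (S : Finset (Pl K)) (z : Pl K → K) {ε : ℝ} (hε : 0 < ε) :
    ∃ x : K, ∀ v ∈ S, v.abs (x - z v) < ε := by
  have := AbsoluteValue.denseRange_algebraMap_pi (F := K) (ι := S) (v := fun i => i.1.abs)
    (fun i => i.1.nontriv) (fun i j hij h => hij (Subtype.ext (Pl.ineq h)))
  obtain ⟨x, hx⟩ := Metric.denseRange_iff.1 this (fun i => WithAbs.toAbs _ (z i.1)) ε hε
  refine ⟨x, fun v hv => ?_⟩
  have := (dist_pi_lt_iff hε).1 hx ⟨v, hv⟩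
  rw [dist_comm, dist_eq_norm] at this
  exact this

lemma weak_approxC (S : Finset (Pl K)) (z : ∀ v : Pl K, v.C) {ε : ℝ} (hε : 0 < ε) :
    ∃ x : K, ∀ v ∈ S, ‖algebraMap K v.C x - z v‖ < ε := by
  have : ∀ v : Pl K, ∃ y : K, ‖algebraMap K v.C y - z v‖ < ε / 2 := fun v => by
    obtain ⟨y, hy⟩ := Metric.denseRange_iff.1 (dense_alg v) (z v) (ε / 2) (by linarith)
    exact ⟨y, by rwa [dist_comm, dist_eq_norm] at hy⟩
  choose y hy using this
  obtain ⟨x, hx⟩ := weak_approx S y (half_pos hε)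
  refine ⟨x, fun v hv => ?_⟩
  calc _ = ‖algebraMap K v.C (x - y v) + (algebraMap K v.C (y v) - z v)‖ := by
        rw [map_sub]; congr 1; ring
    _ ≤ _ := norm_add_le _ _
    _ < ε / 2 + ε / 2 := add_lt_add (by rw [norm_alg]; exact hx v hv) (hy v)
    _ = ε := by ring

/-- square roots near one in a closed subgroup -/
lemma exists_sqrt {A : Type*} [NormedRing A] [CompleteSpace A] (W : AddSubgroup A)
    (hW : IsClosed (W : Set A)) (h : A) (h2 : 2 * h = 1)
    (hh : ∀ y ∈ W, h * y ∈ W) (hs : ∀ y ∈ W, y * y ∈ W) :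
    ∃ δ > 0, ∀ T ∈ W, ‖T‖ < δ → ∃ Y ∈ W, ‖Y‖ ≤ 1 / (4 * (‖h‖ + 1)) ∧ (1 + Y) * (1 + Y) = 1 + T := by
  set r : ℝ := 1 / (4 * (‖h‖ + 1)) with hr
  have hh0 := norm_nonneg h
  have hr0 : 0 < r := by positivity
  have hrh : ‖h‖ * r ≤ 1 / 4 := by
    rw [hr, mul_one_div, div_le_div_iff₀ (by positivity) (by norm_num)]; linarith
  refine ⟨r / (2 * (‖h‖ + 1)), by positivity, fun T hT hTd => ?_⟩
  have hTh : ‖h‖ * ‖T‖ ≤ r / 2 := by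
    have : ‖T‖ * (2 * (‖h‖ + 1)) < r := (lt_div_iff₀ (by positivity)).1 hTd
    nlinarith [norm_nonneg T]
  let X : Set A := {y | y ∈ W ∧ ‖y‖ ≤ r}
  have hXc : IsClosed X := hW.inter (isClosed_le continuous_norm continuous_const)
  have : CompleteSpace X := hXc.completeSpace_coe
  have : Nonempty X := ⟨⟨0, W.zero_mem, by simpa using hr0.le⟩⟩
  let F : X → X := fun y => ⟨h * (T - y * y), hh _ (W.sub_mem hT (hs _ y.2.1)), by
    calc ‖h * (T - y * y)‖ ≤ ‖h‖ * ‖T - y * y‖ := norm_mul_le _ _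
      _ ≤ ‖h‖ * (‖T‖ + ‖(y : A)‖ * ‖(y : A)‖) := by
        gcongr; exact (norm_sub_le _ _).trans (by gcongr; exact norm_mul_le _ _)
      _ ≤ ‖h‖ * (‖T‖ + r * r) := by gcongr <;> exact y.2.2
      _ ≤ r := by nlinarith⟩
  have hF : ContractingWith (1 / 2) F := by
    refine ⟨by norm_num [← NNReal.coe_lt_coe], LipschitzWith.of_dist_le_mul fun y z => ?_⟩
    rw [Subtype.dist_eq, Subtype.dist_eq, dist_eq_norm, dist_eq_norm]
    have e : (F y : A) - F z = h * ((z : A) * (z - y) + (z - y) * y) := by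
      simp only [F]; noncomm_ring
    rw [e]
    calc _ ≤ ‖h‖ * (‖(z : A)‖ * ‖(z - y : A)‖ + ‖(z - y : A)‖ * ‖(y : A)‖) := by
          refine (norm_mul_le _ _).trans ?_
          gcongr
          exact (norm_add_le _ _).trans (add_le_add (norm_mul_le _ _) (norm_mul_le _ _))
      _ ≤ ‖h‖ * (r * ‖(z - y : A)‖ + ‖(z - y : A)‖ * r) := by
          gcongr; exacts [z.2.2, y.2.2]
      _ ≤ _ := by
          rw [norm_sub_rev (z : A)]; push_cast
          nlinarith [norm_nonneg ((y : A) - z)]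
  obtain ⟨Y, hY⟩ : ∃ Y, F Y = Y := ⟨_, hF.fixedPoint_isFixedPt⟩
  refine ⟨Y, Y.2.1, Y.2.2, ?_⟩
  have hY' : h * (T - Y * Y) = (Y : A) := congrArg Subtype.val hY
  have : 2 * (Y : A) = T - Y * Y := by rw [← hY', ← mul_assoc, h2, one_mul, hY']
  calc (1 + (Y : A)) * (1 + Y) = 1 + (2 * Y + Y * Y) := by noncomm_ring
    _ = 1 + T := by rw [this]; abel

lemma sq_open (v : Pl K) : ∃ δ > 0, ∀ x : v.C, ‖x - 1‖ < δ → IsSquare x := by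
  obtain ⟨δ, h0, h⟩ := exists_sqrt (A := v.C) ⊤ (by simp) (2⁻¹) (by
    refine mul_inv_cancel₀ fun h => ?_
    have : algebraMap K v.C 2 = 0 := by rw [map_ofNat, h]
    simp at this) (by simp) (by simp)
  refine ⟨δ, h0, fun x hx => ?_⟩
  obtain ⟨Y, -, -, hY⟩ := h (x - 1) trivial hx
  exact ⟨1 + Y, by rw [hY]; ring⟩
end HM

namespace HM

/-- doubling -/
abbrev dbl (A : Type*) [AddCommGroup A] : A →+ A := nsmulAddMonoidHom 2

lemma index_dbl_congr {A B : Type*} [AddCommGroup A] [AddCommGroup B] (f : A ≃+ B) :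
    (dbl A).range.index = (dbl B).range.index ∧ Nat.card (dbl A).ker = Nat.card (dbl B).ker := by
  have h1 : (dbl B).range.comap (f : A →+ B) = (dbl A).range := by
    ext x
    simp only [AddSubgroup.mem_comap, AddMonoidHom.mem_range]
    constructor
    · rintro ⟨y, hy⟩; exact ⟨f.symm y, f.injective (by simpa using hy)⟩
    · rintro ⟨y, rfl⟩; exact ⟨f y, by simp⟩
  refine ⟨by rw [← h1, AddSubgroup.index_comap_of_surjective _ f.surjective], ?_⟩
  refine Nat.card_congr (f.toEquiv.subtypeEquiv fun x => ?_)
  simp only [AddMonoidHom.mem_ker, nsmulAddMonoidHom_apply]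
  rw [← f.map_eq_zero_iff, map_nsmul]; rfl

lemma rank_exact {A B : Type*} [AddCommGroup A] [AddCommGroup B] [Module.Finite ℤ A]
    (f : A →ₗ[ℤ] B) (hf : Function.Surjective f) :
    Module.finrank ℤ A = Module.finrank ℤ f.ker + Module.finrank ℤ B := by
  rw [← f.ker.finrank_quotient_add_finrank, (f.quotKerEquivOfSurjective hf).finrank_eq, add_comm]

lemma index_dbl_aux (n : ℕ) (T : Type*) [AddCommGroup T] [Finite T] :
    (dbl ((Fin n → ℤ) × T)).range.index = 2 ^ n * Nat.card (dbl ((Fin n → ℤ) × T)).ker := by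
  have h1 : (dbl ((Fin n → ℤ) × T)).range = (dbl (Fin n → ℤ)).range.prod (dbl T).range := by
    ext ⟨x, y⟩
    simp only [AddMonoidHom.mem_range, AddSubgroup.mem_prod, nsmulAddMonoidHom_apply, Prod.exists,
      Prod.smul_mk, Prod.mk.injEq, exists_and_left, exists_and_right]
  have h2 : (dbl (Fin n → ℤ)).range.index = 2 ^ n := by
    let g : (Fin n → ℤ) →+ (Fin n → ZMod 2) := (Int.castAddHom (ZMod 2)).compLeft (Fin n)
    have hg : Function.Surjective g := fun y => by
      choose z hz using fun i => ZMod.intCast_surjective (y i)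
      exact ⟨z, funext hz⟩
    have : (dbl (Fin n → ℤ)).range = g.ker := by
      ext x
      simp only [AddMonoidHom.mem_range, AddMonoidHom.mem_ker, funext_iff]
      have : ∀ i, g x i = (0 : Fin n → ZMod 2) i ↔ ∃ y, 2 * y = x i := fun i => by
        change ((x i : ℤ) : ZMod 2) = 0 ↔ _
        rw [ZMod.intCast_zmod_eq_zero_iff_dvd]
        exact ⟨fun ⟨y, hy⟩ => ⟨y, hy.symm⟩, fun ⟨y, hy⟩ => ⟨y, hy.symm⟩⟩
      simp only [this]
      constructor
      · rintro ⟨y, hy⟩ i; exact ⟨y i, by simpa using hy i⟩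
      · intro h; choose y hy using h; exact ⟨y, fun i => by simpa using hy i⟩
    rw [this, AddSubgroup.index_ker, AddMonoidHom.range_eq_top.2 hg]
    rw [AddSubgroup.card_top]; simp
  have h3 : Nat.card (dbl ((Fin n → ℤ) × T)).ker = Nat.card (dbl T).ker := by
    refine Nat.card_congr ⟨fun x => ⟨x.1.2, congrArg Prod.snd x.2⟩, fun x => ⟨(0, x.1), ?_⟩, ?_, ?_⟩
    · exact Prod.ext (by simp) x.2
    · rintro ⟨⟨x, y⟩, h⟩
      have : (2 : ℕ) • x = 0 := congrArg Prod.fst h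
      have : x = 0 := by
        funext i; have := congrFun this i; simp at this; simpa using this
      simp [this]
    · rintro ⟨x, h⟩; rfl
  rw [h1, AddSubgroup.index_prod, h2, h3, AddSubgroup.index_range]

lemma index_dbl (A : Type*) [AddCommGroup A] [Module.Finite ℤ A] :
    (dbl A).range.index = 2 ^ Module.finrank ℤ A * Nat.card (dbl A).ker := by
  have : AddGroup.FG A := Module.Finite.iff_addGroup_fg.1 inferInstance
  classical
  obtain ⟨n, ι, _, p, hp, e, ⟨f⟩⟩ := AddCommGroup.equiv_free_prod_directSum_zmod A
  have : ∀ i, NeZero (p i ^ e i) := fun i => ⟨pow_ne_zero _ (hp i).ne_zero⟩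
  let f' := f.trans ((Finsupp.addEquivFunOnFinite).prodCongr
    (DirectSum.addEquivProd (fun i => ZMod (p i ^ e i))))
  obtain ⟨h1, h2⟩ := index_dbl_congr f'
  rw [h1, h2, index_dbl_aux]
  have h3 := f'.toIntLinearEquiv.finrank_eq
  have h5 : Module.finrank ℤ (∀ i, ZMod (p i ^ e i)) = 0 := by
    rw [Module.finrank_eq_zero_iff_isTorsion]
    intro x
    refine ⟨⟨∏ i, (p i : ℤ) ^ e i, mem_nonZeroDivisors_of_ne_zero
      (Finset.prod_ne_zero_iff.2 fun i _ => pow_ne_zero _ (mod_cast (hp i).ne_zero))⟩, ?_⟩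
    funext i
    change (∏ i, (p i : ℤ) ^ e i) • x i = 0
    rw [← Finset.mul_prod_erase _ _ (Finset.mem_univ i), zsmul_eq_mul]
    push_cast
    have := ZMod.natCast_self (p i ^ e i)
    push_cast at this
    rw [this]; simp
  have h4 : Module.finrank ℤ A = n := by
    rw [h3, rank_exact (LinearMap.snd ℤ (Fin n → ℤ) (∀ i, ZMod (p i ^ e i)))
      LinearMap.snd_surjective, h5, add_zero, LinearMap.ker_snd,
      LinearMap.finrank_range_of_inj LinearMap.inl_injective]
    simp
  rw [h4]

/-- Herbrand count -/
lemma herbrand {A B : Type*} [AddCommGroup A] [AddCommGroup B] [Module.Finite ℤ A]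
    [Module.Finite ℤ B] (i : B →+ A) (N : A →+ B) (hi : Function.Injective i)
    (hN : ∀ b, N (i b) = 2 • b) (H0 : ∀ y, i (N y) = 2 • y → ∃ b, i b = y)
    (H1 : ∀ x, N x = 0 → ∃ y, x = 2 • y - i (N y))
    (tA : Nat.card (dbl N.ker).ker = 2) (tB : Nat.card (dbl B).ker = 2) :
    N.range.index * 2 ^ Module.finrank ℤ A = 2 ^ (2 * Module.finrank ℤ B) := by
  let φ : A →+ N.ker :=
    { toFun := fun y => ⟨2 • y - i (N y), by simp [AddMonoidHom.mem_ker, hN]⟩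
      map_zero' := by ext; simp
      map_add' := fun x y => by ext; simp; abel }
  have hφ : Function.Surjective φ := fun x => by
    obtain ⟨y, hy⟩ := H1 x x.2
    exact ⟨y, Subtype.ext hy.symm⟩
  have : Module.Finite ℤ N.ker := Module.Finite.of_surjective φ.toIntLinearMap hφ
  have hr : Module.finrank ℤ A = Module.finrank ℤ B + Module.finrank ℤ N.ker := by
    rw [rank_exact φ.toIntLinearMap hφ]
    congr 1
    have : LinearMap.ker φ.toIntLinearMap = LinearMap.range i.toIntLinearMap := by
      ext y
      simp only [LinearMap.mem_ker, LinearMap.mem_range, AddMonoidHom.coe_toIntLinearMap]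
      constructor
      · intro h
        exact H0 y (sub_eq_zero.1 (congrArg Subtype.val h)).symm
      · rintro ⟨b, rfl⟩
        exact Subtype.ext (by simp [φ, hN])
    rw [this, LinearMap.finrank_range_of_inj hi]
  have hle : (dbl B).range ≤ N.range := by
    rintro _ ⟨b, rfl⟩; exact ⟨i b, hN b⟩
  have h1 := AddSubgroup.relIndex_mul_index hle
  rw [← AddSubgroup.index_comap] at h1
  have h2 : (dbl B).range.comap N = (dbl N.ker).range.comap φ := by
    ext x
    simp only [AddSubgroup.mem_comap, AddMonoidHom.mem_range, nsmulAddMonoidHom_apply]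
    constructor
    · rintro ⟨b, hb⟩
      refine ⟨⟨x - i b, by simp [AddMonoidHom.mem_ker, hN, hb]⟩, Subtype.ext ?_⟩
      simp [φ, ← hb, smul_sub]
    · rintro ⟨⟨k, hk⟩, h⟩
      have h : 2 • k = 2 • x - i (N x) := congrArg Subtype.val h
      obtain ⟨b, hb⟩ := H0 (x - k) (by
        rw [map_sub, (AddMonoidHom.mem_ker).1 hk, smul_sub, h]; simp)
      refine ⟨b, ?_⟩
      rw [← hN, hb, map_sub, (AddMonoidHom.mem_ker).1 hk, sub_zero]
  rw [h2, AddSubgroup.index_comap_of_surjective _ hφ, index_dbl, index_dbl, tA, tB] at h1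
  rw [hr, two_mul, pow_add, pow_add]
  have : (2 : ℕ) ^ Module.finrank ℤ N.ker * N.range.index = 2 ^ Module.finrank ℤ B := by linarith
  rw [← this]; ring
end HM

namespace HM
open NumberField IsDedekindDomain
variable {K : Type*} [Field K] [NumberField K]

/-- order of vanishing -/
noncomputable def od (p : HeightOneSpectrum (𝓞 K)) (x : Kˣ) : ℤ := -(p.valuationOfNeZero x).toAdd

lemma od_mul (p : HeightOneSpectrum (𝓞 K)) (x y : Kˣ) : od p (x * y) = od p x + od p y := by
  simp [od]; ring
lemma od_one (p : HeightOneSpectrum (𝓞 K)) : od p 1 = 0 := by simp [od]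
lemma od_inv (p : HeightOneSpectrum (𝓞 K)) (x : Kˣ) : od p x⁻¹ = - od p x := by simp [od]
lemma od_div (p : HeightOneSpectrum (𝓞 K)) (x y : Kˣ) : od p (x / y) = od p x - od p y := by
  rw [div_eq_mul_inv, od_mul, od_inv]; ring
lemma od_pow (p : HeightOneSpectrum (𝓞 K)) (x : Kˣ) (n : ℕ) : od p (x ^ n) = n * od p x := by
  simp [od]
lemma od_zpow (p : HeightOneSpectrum (𝓞 K)) (x : Kˣ) (n : ℤ) : od p (x ^ n) = n * od p x := by
  simp [od]

lemma val_od (p : HeightOneSpectrum (𝓞 K)) (x : Kˣ) :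
    p.valuation K (x : K) = WithZero.exp (-od p x) := by
  rw [← HeightOneSpectrum.valuationOfNeZero_eq]; simp [od, WithZero.exp]

lemma od_neg (p : HeightOneSpectrum (𝓞 K)) (x : Kˣ) : od p (-x) = od p x := by
  have h := val_od p (-x)
  rw [Units.val_neg, Valuation.map_neg, val_od, WithZero.exp_inj] at h
  linarith

lemma od_le_iff (p : HeightOneSpectrum (𝓞 K)) (x y : Kˣ) :
    (Pl.fin p).abs (x : K) ≤ (Pl.fin p).abs (y : K) ↔ od p y ≤ od p x := by
  rw [fin_le, val_od, val_od, WithZero.exp_le_exp]; omega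

lemma od_nonneg_iff (p : HeightOneSpectrum (𝓞 K)) (x : Kˣ) :
    0 ≤ od p x ↔ (Pl.fin p).abs (x : K) ≤ 1 := by
  have := od_le_iff p x 1
  rw [od_one, Units.val_one, map_one] at this; exact this.symm

lemma od_eq_zero_iff (p : HeightOneSpectrum (𝓞 K)) (x : Kˣ) :
    od p x = 0 ↔ (Pl.fin p).abs (x : K) = 1 := by
  have h1 := od_nonneg_iff p x
  have h2 := od_le_iff p 1 x
  rw [od_one, Units.val_one, map_one] at h2
  rw [le_antisymm_iff, ← h2, h1, le_antisymm_iff, and_comm]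

/-- exponent in an ideal -/
noncomputable def cnt (p : HeightOneSpectrum (𝓞 K)) (I : Ideal (𝓞 K)) : ℕ :=
  (Associates.mk p.asIdeal).count (Associates.mk I).factors

lemma cnt_mul (p : HeightOneSpectrum (𝓞 K)) {I J : Ideal (𝓞 K)} (hI : I ≠ 0) (hJ : J ≠ 0) :
    cnt p (I * J) = cnt p I + cnt p J := by
  rw [cnt, ← Associates.mk_mul_mk, Associates.count_mul (Associates.mk_ne_zero.2 hI)
    (Associates.mk_ne_zero.2 hJ) p.associates_irreducible]; rfl

lemma cnt_pow (p : HeightOneSpectrum (𝓞 K)) {I : Ideal (𝓞 K)} (hI : I ≠ 0) (n : ℕ) :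
    cnt p (I ^ n) = n * cnt p I := by
  rw [cnt, Associates.mk_pow, Associates.count_pow (Associates.mk_ne_zero.2 hI)
    p.associates_irreducible]; rfl

lemma cnt_self (p : HeightOneSpectrum (𝓞 K)) : cnt p p.asIdeal = 1 :=
  Associates.count_self p.associates_irreducible

lemma cnt_ne {p q : HeightOneSpectrum (𝓞 K)} (h : p ≠ q) : cnt p q.asIdeal = 0 :=
  Associates.count_eq_zero_of_ne p.associates_irreducible q.associates_irreducible
    fun h' => h (HeightOneSpectrum.ext (by
      rwa [Associates.mk_eq_mk_iff_associated, associated_iff_eq] at h'))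

lemma od_span (p : HeightOneSpectrum (𝓞 K)) (x : Kˣ) (r : 𝓞 K) (hr : (r : K) = x) :
    od p x = cnt p (Ideal.span {r}) := by
  have h := val_od p x
  have hr0 : r ≠ 0 := by rintro rfl; exact x.ne_zero (by simpa using hr.symm)
  rw [← hr, p.valuation_of_algebraMap, p.intValuation_if_neg hr0, WithZero.exp_inj] at h
  rw [cnt]; omega

lemma cnt_finite {I : Ideal (𝓞 K)} (hI : I ≠ 0) : {p | cnt p I ≠ 0}.Finite := by
  refine (Ideal.finite_factors hI).subset fun p hp => ?_
  have := (Associates.count_ne_zero_iff_dvd hI p.irreducible).1 hp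
  exact this

lemma od_finite (x : Kˣ) : {p | od p x ≠ 0}.Finite := by
  obtain ⟨r, s, hs, h⟩ := IsFractionRing.div_surjective (A := 𝓞 K) (x : K)
  have hs0 : (s : K) ≠ 0 := by simpa using nonZeroDivisors.ne_zero hs
  have hr0 : (r : K) ≠ 0 := fun h' => x.ne_zero (by rw [← h]; simp [h'])
  have e : x = Units.mk0 (r : K) hr0 / Units.mk0 (s : K) hs0 := by
    ext; simp [← h]
  refine ((cnt_finite (I := Ideal.span {r}) (by simpa using hr0)).union
    (cnt_finite (I := Ideal.span {s}) (by simpa using hs0))).subset fun p hp => ?_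
  by_contra hc
  simp only [Set.mem_union, Set.mem_ofPred_eq, not_or, not_not] at hc
  apply hp
  rw [e, od_div, od_span p _ r rfl, od_span p _ s rfl, hc.1, hc.2]; rfl

lemma unit_of_od (x : Kˣ) (h : ∀ p, od p x = 0) : ∃ u : (𝓞 K)ˣ, ((u : 𝓞 K) : K) = x := by
  have h1 : ∀ y : Kˣ, (∀ p, od p y = 0) → ∃ r : 𝓞 K, (r : K) = y := fun y hy =>
    HeightOneSpectrum.mem_integers_of_valuation_le_one K (y : K) (fun p => by
      rw [val_od, hy]; simp)
  obtain ⟨r, hr⟩ := h1 x h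
  obtain ⟨s, hs⟩ := h1 x⁻¹ fun p => by rw [od_inv, h, neg_zero]
  have : r * s = 1 := by
    apply RingOfIntegers.coe_injective
    rw [map_mul, map_one]
    exact (congrArg₂ (· * ·) hr hs).trans (by simp)
  exact ⟨⟨r, s, this, by rw [mul_comm, this]⟩, hr⟩

lemma od_unit (p : HeightOneSpectrum (𝓞 K)) (u : (𝓞 K)ˣ) (x : Kˣ) (h : ((u : 𝓞 K) : K) = x) :
    od p x = 0 := by
  have : x = Units.map (algebraMap (𝓞 K) K : 𝓞 K →* K) u := by ext; exact h.symm
  rw [od, this, HeightOneSpectrum.valuation_of_unit_eq]; rfl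

/-- `S` generates the class group in the needed sense -/
def Gen (S : Finset (Pl K)) : Prop :=
  ∀ p, Pl.fin p ∉ S → ∃ x : Kˣ, od p x = 1 ∧ ∀ q, q ≠ p → Pl.fin q ∉ S → od q x = 0

lemma Gen.mono {S T : Finset (Pl K)} (h : S ⊆ T) (hS : Gen S) : Gen T := fun p hp => by
  obtain ⟨x, h1, h2⟩ := hS p (fun h' => hp (h h'))
  exact ⟨x, h1, fun q hq hqT => h2 q hq fun h' => hqT (h h')⟩

lemma span_of_principal {I : Ideal (𝓞 K)} (hI : I ≠ 0)
    (h : I.IsPrincipal) : ∃ x : Kˣ, ∀ p, od p x = cnt p I := by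
  obtain ⟨r, hr⟩ := h
  have hr' : I = Ideal.span {r} := hr
  have hr0 : (r : K) ≠ 0 := by
    intro h; apply hI
    have : r = 0 := by simpa using h
    rw [hr', this]; simp
  exact ⟨Units.mk0 (r : K) hr0, fun p => by rw [od_span p _ r rfl, hr']⟩

variable (K) in
lemma exists_gen : ∃ S : Finset (Pl K), Gen S := by
  classical
  choose I hI using ClassGroup.mk0_surjective (R := 𝓞 K)
  have hfin : (⋃ c : ClassGroup (𝓞 K), {p | cnt p (I c).1 ≠ 0}).Finite :=
    Set.finite_iUnion fun c => cnt_finite (nonZeroDivisors.ne_zero (I c).2)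
  refine ⟨hfin.toFinset.image Pl.fin, fun p hp => ?_⟩
  let P : nonZeroDivisors (Ideal (𝓞 K)) := ⟨p.asIdeal, mem_nonZeroDivisors_of_ne_zero p.ne_bot⟩
  let J := I (ClassGroup.mk0 P)⁻¹
  have hPJ : ClassGroup.mk0 (P * J) = 1 := by rw [map_mul, hI, mul_inv_cancel]
  obtain ⟨x, hx⟩ := span_of_principal (nonZeroDivisors.ne_zero (P * J).2)
    ((ClassGroup.mk0_eq_one_iff (P * J).2).1 hPJ)
  have h0 : ∀ q, Pl.fin q ∉ hfin.toFinset.image Pl.fin → cnt q J.1 = 0 := by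
    intro q hq
    by_contra hc
    exact hq (Finset.mem_image_of_mem _ (hfin.mem_toFinset.2 (Set.mem_iUnion.2 ⟨_, hc⟩)))
  have hm : ∀ q, cnt q (P * J).1 = cnt q p.asIdeal + cnt q J.1 := fun q =>
    cnt_mul q p.ne_bot (nonZeroDivisors.ne_zero J.2)
  refine ⟨x, ?_, fun q hq hqS => ?_⟩
  · rw [hx, hm, cnt_self, h0 p hp]; rfl
  · rw [hx, hm, cnt_ne hq, h0 q hqS]; rfl

lemma exists_pow_gen (p : HeightOneSpectrum (𝓞 K)) : ∃ x : Kˣ,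
    od p x = classNumber K ∧ ∀ q, q ≠ p → od q x = 0 := by
  let P : nonZeroDivisors (Ideal (𝓞 K)) := ⟨p.asIdeal, mem_nonZeroDivisors_of_ne_zero p.ne_bot⟩
  have hPJ : ClassGroup.mk0 (P ^ classNumber K) = 1 := by rw [map_pow]; exact pow_card_eq_one
  obtain ⟨x, hx⟩ := span_of_principal (nonZeroDivisors.ne_zero (P ^ classNumber K).2)
    ((ClassGroup.mk0_eq_one_iff (P ^ classNumber K).2).1 hPJ)
  have hm : ∀ q, cnt q (P ^ classNumber K).1 = classNumber K * cnt q p.asIdeal := fun q =>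
    cnt_pow q p.ne_bot _
  exact ⟨x, by rw [hx, hm, cnt_self, mul_one], fun q hq => by rw [hx, hm, cnt_ne hq]; simp⟩

/-- S-units -/
noncomputable def US (S : Finset (Pl K)) : Subgroup Kˣ where
  carrier := {x | ∀ p, Pl.fin p ∉ S → od p x = 0}
  one_mem' := fun p _ => od_one p
  mul_mem' := fun {x y} hx hy p hp => by rw [od_mul, hx p hp, hy p hp, add_zero]
  inv_mem' := fun {x} hx p hp => by rw [od_inv, hx p hp, neg_zero]

lemma US_mono {S T : Finset (Pl K)} (h : S ⊆ T) : US S ≤ US T := fun _ hx p hp =>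
  hx p fun h' => hp (h h')

/-- `S` contains infinite places -/
def Inf (S : Finset (Pl K)) : Prop := ∀ v, Pl.inf v ∈ S


open Module in
lemma US_rank (S : Finset (Pl K)) (hS : Inf S) : Module.Finite ℤ (Additive (US S)) ∧
    Module.finrank ℤ (Additive (US S)) + 1 = S.card := by
  classical
  let Sf := {p : HeightOneSpectrum (𝓞 K) // Pl.fin p ∈ S}
  have hSf : Finite Sf := Finite.of_injective (β := {v // v ∈ S}) (fun p => ⟨Pl.fin p.1, p.2⟩)
    fun p q h => Subtype.ext (by simpa using h)
  have := Fintype.ofFinite Sf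
  let f : Additive (US S) →ₗ[ℤ] (Sf → ℤ) := AddMonoidHom.toIntLinearMap
    { toFun := fun x p => od p.1 (x.toMul : Kˣ)
      map_zero' := by ext p; exact od_one _
      map_add' := fun x y => by ext p; exact od_mul _ _ _ }
  let g : Additive (𝓞 K)ˣ →ₗ[ℤ] f.ker := AddMonoidHom.toIntLinearMap
    { toFun := fun u => ⟨Additive.ofMul ⟨Units.map (algebraMap (𝓞 K) K : 𝓞 K →* K) u.toMul,
          fun p _ => od_unit p u.toMul _ rfl⟩, by
            rw [LinearMap.mem_ker]; ext p; exact od_unit p.1 u.toMul _ rfl⟩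
      map_zero' := by
        apply Subtype.ext; apply Additive.toMul.injective; apply Subtype.ext
        exact map_one _
      map_add' := fun x y => by
        apply Subtype.ext; apply Additive.toMul.injective; apply Subtype.ext
        exact map_mul _ _ _ }
  have hg : Function.Surjective g := by
    rintro ⟨x, hx⟩
    have hx' : ∀ p, od p (x.toMul : Kˣ) = 0 := fun p => by
      by_cases hp : Pl.fin p ∈ S
      · exact congrFun hx ⟨p, hp⟩
      · exact x.toMul.2 p hp
    obtain ⟨u, hu⟩ := unit_of_od _ hx'
    refine ⟨Additive.ofMul u, ?_⟩
    apply Subtype.ext; apply Additive.toMul.injective; apply Subtype.ext; ext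
    exact hu
  have hginj : Function.Injective g := by
    intro u w h
    have : (((u.toMul : (𝓞 K)ˣ) : 𝓞 K) : K) = ((w.toMul : (𝓞 K)ˣ) : 𝓞 K) :=
      congrArg (fun z : f.ker => (((z.1.toMul : US S) : Kˣ) : K)) h
    apply Additive.toMul.injective
    exact Units.ext (RingOfIntegers.coe_injective this)
  let e : Additive (𝓞 K)ˣ ≃ₗ[ℤ] f.ker := LinearEquiv.ofBijective g ⟨hginj, hg⟩
  have fin1 : Module.Finite ℤ (Additive (𝓞 K)ˣ) := inferInstance
  have fin2 : Module.Finite ℤ f.ker := Module.Finite.equiv e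
  have fin3 : Module.Finite ℤ (Additive (US S)) :=
    ⟨Submodule.fg_of_fg_map_of_fg_inf_ker f (IsNoetherian.noetherian _) (by
      rw [top_inf_eq]; exact (Submodule.fg_top _).1 fin2.1)⟩
  refine ⟨fin3, ?_⟩
  choose z hz hz' using fun p : HeightOneSpectrum (𝓞 K) => exists_pow_gen p
  have hr1 : finrank ℤ f.range ≤ Fintype.card Sf := by
    rw [← finrank_fintype_fun_eq_card ℤ]; exact Submodule.finrank_le _
  have hb : ∀ p : Sf, Pi.single p (classNumber K : ℤ) ∈ f.range := fun p => by
    refine ⟨Additive.ofMul ⟨z p.1, fun q hq => hz' p.1 q ?_⟩, ?_⟩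
    · rintro rfl; exact hq p.2
    · ext q
      change od q.1 (z p.1) = _
      by_cases h : q = p
      · subst h; rw [hz, Pi.single_eq_same]
      · rw [Pi.single_eq_of_ne h, hz' _ _ fun h' => h (Subtype.ext h')]
  have hr2 : Fintype.card Sf ≤ finrank ℤ f.range := by
    have hmem : ∀ x : Sf → ℤ, (classNumber K : ℤ) • x ∈ f.range := fun x => by
      have : (classNumber K : ℤ) • x = ∑ p, x p • Pi.single p (classNumber K : ℤ) := by
        ext q
        simp only [Finset.sum_apply, Pi.smul_apply, Pi.single_apply, smul_eq_mul, mul_ite, mul_zero]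
        rw [Finset.sum_ite_eq]; simp [mul_comm]
      rw [this]
      exact Submodule.sum_mem _ fun p _ => Submodule.smul_mem _ _ (hb p)
    rw [← finrank_fintype_fun_eq_card ℤ]
    refine LinearMap.finrank_le_finrank_of_injective
      (f := (LinearMap.lsmul ℤ (Sf → ℤ) (classNumber K : ℤ)).codRestrict f.range hmem) ?_
    intro x y h
    have h' : (classNumber K : ℤ) • x = (classNumber K : ℤ) • y := congrArg Subtype.val h
    have : (classNumber K : ℤ) ≠ 0 := by
      exact_mod_cast (classNumber_pos K).ne'
    exact smul_right_injective _ this h'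
  have hk : finrank ℤ f.ker + 1 = Fintype.card (InfinitePlace K) := by
    rw [← e.finrank_eq, Units.finrank_eq, Units.rank]
    have : 0 < Fintype.card (InfinitePlace K) := Fintype.card_pos
    omega
  have hs : finrank ℤ (Additive (US S)) = finrank ℤ f.ker + finrank ℤ f.range := by
    rw [rank_exact f.rangeRestrict f.surjective_rangeRestrict, LinearMap.ker_rangeRestrict]
  have hc : S.card = Fintype.card Sf + Fintype.card (InfinitePlace K) := by
    rw [← Fintype.card_sum, ← Fintype.card_coe]
    refine Fintype.card_congr
      { toFun := fun v => match v with
          | ⟨Pl.fin p, h⟩ => Sum.inl ⟨p, h⟩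
          | ⟨Pl.inf v, h⟩ => Sum.inr v
        invFun := Sum.elim (fun p => ⟨Pl.fin p.1, p.2⟩) (fun v => ⟨Pl.inf v, hS v⟩)
        left_inv := by rintro ⟨_ | _, _⟩ <;> rfl
        right_inv := by rintro (_ | _) <;> rfl }
  omega
end HM

namespace HM
open NumberField IsDedekindDomain
variable {K : Type*} [Field K] [NumberField K] {L : Type*} [Field L] [NumberField L]

/-- `w` lies over `v` -/
def Ov (φ : K →+* L) (w : Pl L) (v : Pl K) : Prop :=
  ∃ e : ℝ, 0 < e ∧ ∀ x, w.abs (φ x) = v.abs x ^ e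

lemma Ov.uniq {φ : K →+* L} {w : Pl L} {v v' : Pl K} (h : Ov φ w v) (h' : Ov φ w v') : v = v' := by
  obtain ⟨e, he, h⟩ := h
  obtain ⟨e', he', h'⟩ := h'
  apply Pl.ineq
  intro x y
  rw [← Real.rpow_le_rpow_iff (v.abs.nonneg x) (v.abs.nonneg y) he, ← h, ← h, h', h',
    Real.rpow_le_rpow_iff (v'.abs.nonneg x) (v'.abs.nonneg y) he']

lemma Ov.trans {M : Type*} [Field M] [NumberField M] {φ : K →+* L} {ψ : L →+* M}
    {u : Pl M} {w : Pl L} {v : Pl K} (h : Ov φ w v) (h' : Ov ψ u w) : Ov (ψ.comp φ) u v := by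
  obtain ⟨e, he, h⟩ := h
  obtain ⟨e', he', h'⟩ := h'
  exact ⟨e * e', by positivity, fun x => by
    rw [RingHom.comp_apply, h', h, ← Real.rpow_mul (v.abs.nonneg x)]⟩

lemma exists_od_one (p : HeightOneSpectrum (𝓞 K)) : ∃ x : Kˣ, od p x = 1 := by
  obtain ⟨x, hx⟩ := p.valuation_exists_uniformizer K
  have hx0 : x ≠ 0 := by
    rintro rfl; rw [map_zero] at hx; exact WithZero.coe_ne_zero hx.symm
  refine ⟨Units.mk0 x hx0, ?_⟩
  have := val_od p (Units.mk0 x hx0)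
  rw [Units.val_mk0, hx, WithZero.exp_inj] at this
  omega

lemma Ov.od {φ : K →+* L} {q : HeightOneSpectrum (𝓞 L)} {p : HeightOneSpectrum (𝓞 K)}
    (h : Ov φ (.fin q) (.fin p)) : ∃ e : ℕ, 0 < e ∧ ∀ x : Kˣ,
      HM.od q (Units.map (φ : K →* L) x) = e * HM.od p x := by
  obtain ⟨e, he, h⟩ := h
  obtain ⟨π, hπ⟩ := exists_od_one p
  have h1 : ∀ x : Kˣ, 0 ≤ HM.od p x ↔ 0 ≤ HM.od q (Units.map (φ : K →* L) x) := fun x => by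
    rw [od_nonneg_iff, od_nonneg_iff, Units.coe_map]
    change _ ↔ (Pl.fin q).abs (φ x) ≤ 1
    rw [h, ← Real.one_rpow e, Real.rpow_le_rpow_iff ((Pl.fin p).abs.nonneg _) zero_le_one he,
      Real.one_rpow]
  have h2 : ∀ x : Kˣ, HM.od p x = 0 ↔ HM.od q (Units.map (φ : K →* L) x) = 0 := fun x => by
    have a := h1 x
    have b := h1 x⁻¹
    rw [map_inv, od_inv, od_inv] at b
    omega
  have hpos : 0 < HM.od q (Units.map (φ : K →* L) π) := by
    have a := h1 π
    have b := h2 π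
    omega
  refine ⟨(HM.od q (Units.map (φ : K →* L) π)).toNat, by omega, fun x => ?_⟩
  have := (h2 (x / π ^ HM.od p x)).1 (by rw [od_div, od_zpow, hπ]; ring)
  rw [map_div, map_zpow, od_div, od_zpow] at this
  rw [Int.toNat_of_nonneg hpos.le]
  linarith

lemma toNNReal_rpow {b c : NNReal} (hb : 1 < b) (hc : 1 < c) (hb0 : b ≠ 0) (hc0 : c ≠ 0)
    (k : ℕ) (x : WithZero (Multiplicative ℤ)) (hk : 0 < k) :
    (WithZeroMulInt.toNNReal hc0 (x ^ k) : ℝ) =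
      (WithZeroMulInt.toNNReal hb0 x : ℝ) ^ (k * Real.logb b c) := by
  have hl : 0 < Real.logb b c := Real.logb_pos (by exact_mod_cast hb) (by exact_mod_cast hc)
  by_cases hx : x = 0
  · subst hx
    rw [zero_pow hk.ne', map_zero, map_zero, NNReal.coe_zero, Real.zero_rpow (by positivity)]
  · have hb' : (0 : ℝ) < b := by positivity
    rw [map_pow, WithZeroMulInt.toNNReal_neg_apply _ hx, WithZeroMulInt.toNNReal_neg_apply _ hx]
    push_cast
    rw [← Real.rpow_natCast, ← Real.rpow_intCast, ← Real.rpow_intCast, ← Real.rpow_mul (by positivity),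
      ← Real.rpow_mul (by positivity)]
    conv_lhs => rw [← Real.rpow_logb hb' (by exact_mod_cast hb.ne') (show (0 : ℝ) < c by positivity)]
    rw [← Real.rpow_mul hb'.le]
    congr 1; ring

lemma ov_of_liesOver [Algebra K L] {q : HeightOneSpectrum (𝓞 L)} {p : HeightOneSpectrum (𝓞 K)}
    (h : q.asIdeal.LiesOver p.asIdeal) : Ov (algebraMap K L) (.fin q) (.fin p) := by
  have hk : 0 < p.asIdeal.ramificationIdx' q.asIdeal := Nat.pos_of_ne_zero
    (Ideal.IsDedekindDomain.ramificationIdx'_ne_zero_of_liesOver q.asIdeal p.ne_bot)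
  refine ⟨p.asIdeal.ramificationIdx' q.asIdeal * Real.logb (Ideal.absNorm p.asIdeal)
    (Ideal.absNorm q.asIdeal), ?_, fun x => ?_⟩
  · have := Real.logb_pos (b := Ideal.absNorm p.asIdeal) (x := Ideal.absNorm q.asIdeal)
      (by exact_mod_cast HeightOneSpectrum.one_lt_absNorm p)
      (by exact_mod_cast HeightOneSpectrum.one_lt_absNorm q)
    positivity
  · rw [fin_abs, fin_abs, ← HeightOneSpectrum.valuation_liesOver L p q]
    exact toNNReal_rpow (HeightOneSpectrum.one_lt_absNorm_nnreal p)
      (HeightOneSpectrum.one_lt_absNorm_nnreal q) _ _ _ _ hk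

lemma ov_fin_exists (φ : K →+* L) (q : HeightOneSpectrum (𝓞 L)) : ∃ p, Ov φ (.fin q) (.fin p) := by
  letI := φ.toAlgebra
  have hp : q.asIdeal.under (𝓞 K) ≠ ⊥ := by
    intro h
    exact q.ne_bot (Ideal.eq_bot_of_comap_eq_bot h)
  let p : HeightOneSpectrum (𝓞 K) := ⟨q.asIdeal.under (𝓞 K), inferInstance, hp⟩
  exact ⟨p, ov_of_liesOver (p := p) ⟨rfl⟩⟩

lemma ov_inf (φ : K →+* L) (w : InfinitePlace L) : Ov φ (.inf w) (.inf (w.comap φ)) :=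
  ⟨1, one_pos, fun x => by rw [Real.rpow_one]; rfl⟩

lemma ov_exists (φ : K →+* L) (w : Pl L) : ∃ v, Ov φ w v := by
  cases w with
  | inf w => exact ⟨_, ov_inf φ w⟩
  | fin q => exact ⟨_, (ov_fin_exists φ q).choose_spec⟩

lemma ov_over (φ : K →+* L) (v : Pl K) : ∃ w, Ov φ w v := by
  letI := φ.toAlgebra
  cases v with
  | inf v =>
    obtain ⟨w, rfl⟩ := InfinitePlace.comap_surjective (K := L) (k := K) v
    exact ⟨_, ov_inf φ w⟩
  | fin p =>
    obtain ⟨Q, hQ, h⟩ := Ideal.exists_maximal_ideal_liesOver_of_isIntegral (S := 𝓞 L) p.asIdeal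
    let q : HeightOneSpectrum (𝓞 L) := ⟨Q, hQ.isPrime, by
      rintro rfl
      refine p.ne_bot ?_
      rw [h.over]
      exact Ideal.comap_bot_of_injective _ (FaithfulSMul.algebraMap_injective _ _)⟩
    exact ⟨_, ov_of_liesOver (q := q) h⟩

lemma ov_fin_iff {φ : K →+* L} {q : HeightOneSpectrum (𝓞 L)} {v : Pl K} (h : Ov φ (.fin q) v) :
    ∃ p, v = .fin p := by
  obtain ⟨p, hp⟩ := ov_fin_exists φ q
  exact ⟨p, h.uniq hp⟩

lemma ov_inf_iff {φ : K →+* L} {w : InfinitePlace L} {v : Pl K} (h : Ov φ (.inf w) v) :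
    ∃ v', v = .inf v' := ⟨_, h.uniq (ov_inf φ w)⟩

lemma ov_finite (φ : K →+* L) (v : Pl K) : {w | Ov φ w v}.Finite := by
  cases v with
  | inf v =>
    refine (Set.finite_range (fun w : InfinitePlace L => Pl.inf w)).subset ?_
    intro w hw
    cases w with
    | inf w => exact ⟨w, rfl⟩
    | fin q => obtain ⟨p, hp⟩ := ov_fin_iff hw; cases hp
  | fin p =>
    obtain ⟨x, hx⟩ := exists_od_one p
    refine ((od_finite (Units.map (φ : K →* L) x)).image Pl.fin).subset ?_
    intro w hw
    cases w with
    | inf w => obtain ⟨p, hp⟩ := ov_inf_iff hw; cases hp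
    | fin q =>
      refine ⟨q, ?_, rfl⟩
      obtain ⟨e, he, h⟩ := Ov.od hw
      rw [Set.mem_ofPred_eq, h, hx]
      omega

lemma Ov.hom {φ : K →+* L} {w : Pl L} {v : Pl K} (h : Ov φ w v) : ∃ f : v.C →+* w.C,
    Continuous f ∧ ∀ x, f (algebraMap K v.C x) = algebraMap L w.C (φ x) := by
  obtain ⟨e, he, h⟩ := h
  let g : WithAbs v.abs →+* WithAbs w.abs :=
    (WithAbs.equiv w.abs).symm.toRingHom.comp (φ.comp (WithAbs.equiv v.abs).toRingHom)
  have hg : Continuous g := by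
    refine continuous_of_continuousAt_zero g ?_
    rw [ContinuousAt, map_zero, tendsto_zero_iff_norm_tendsto_zero]
    have : ∀ x, ‖g x‖ = ‖x‖ ^ e := fun x => h _
    simp_rw [this]
    have h0 : (0 : ℝ) = ‖(0 : WithAbs v.abs)‖ ^ e := by rw [norm_zero, Real.zero_rpow he.ne']
    rw [h0]
    exact (continuous_norm.rpow_const fun _ => Or.inr he.le).continuousAt
  refine ⟨UniformSpace.Completion.mapRingHom g hg, UniformSpace.Completion.continuous_map,
    fun x => ?_⟩
  exact UniformSpace.Completion.mapRingHom_coe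
    hg (WithAbs.toAbs v.abs x)
end HM

namespace HM
open NumberField IsDedekindDomain

section field
variable {F : Type*} [Field F]
/-- norm group of the quadratic extension -/
def NF (a : F) : Subgroup Fˣ where
  carrier := {z | ∃ x y : F, x ^ 2 - a * y ^ 2 = z}
  one_mem' := ⟨1, 0, by simp⟩
  mul_mem' := by
    rintro z w ⟨x, y, h⟩ ⟨x', y', h'⟩
    exact ⟨x * x' + a * y * y', x * y' + y * x', by rw [Units.val_mul, ← h, ← h']; ring⟩
  inv_mem' := by
    rintro z ⟨x, y, h⟩
    refine ⟨x / z, y / z, ?_⟩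
    have : (z : F) ≠ 0 := z.ne_zero
    rw [Units.val_inv_eq_inv_val]; field_simp; exact h

lemma mem_NF {a : F} {z : Fˣ} : z ∈ NF a ↔ ∃ x y : F, x ^ 2 - a * y ^ 2 = z := Iff.rfl

lemma sq_mem_NF (a : F) {z : Fˣ} (h : IsSquare (z : F)) : z ∈ NF a := by
  obtain ⟨x, h⟩ := h; exact ⟨x, 0, by rw [h]; ring⟩

lemma NF_sq [NeZero (2 : F)] {a : F} (ha : a ≠ 0) (h : IsSquare a) : NF a = ⊤ := by
  obtain ⟨r, h⟩ := h
  have h2 : (2 : F) ≠ 0 := NeZero.ne 2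
  have hr : r ≠ 0 := by rintro rfl; exact ha (by simpa using h)
  rw [eq_top_iff]
  intro z _
  refine ⟨(z + 1) / 2, (z - 1) / (2 * r), ?_⟩
  rw [h]; field_simp; ring

lemma NF_symm [NeZero (2 : F)] {a b : Fˣ} (h : b ∈ NF (a : F)) : a ∈ NF (b : F) := by
  by_cases hb : IsSquare (b : F)
  · rw [NF_sq b.ne_zero hb]; trivial
  obtain ⟨x, y, h⟩ := h
  have hy : y ≠ 0 := by rintro rfl; exact hb ⟨x, by rw [← h]; ring⟩
  refine ⟨x / y, 1 / y, ?_⟩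
  field_simp
  linear_combination h

lemma NF_mul_sq (a : F) {c : F} (hc : c ≠ 0) : NF (a * c ^ 2) = NF a := by
  ext z
  constructor
  · rintro ⟨x, y, h⟩; exact ⟨x, c * y, by rw [← h]; ring⟩
  · rintro ⟨x, y, h⟩; exact ⟨x, y / c, by rw [← h]; field_simp⟩

lemma neg_mem_NF (a : Fˣ) : -a ∈ NF (a : F) := ⟨0, 1, by simp⟩

lemma NF_congr {a b : Fˣ} (h : IsSquare ((a / b : Fˣ) : F)) : NF (a : F) = NF (b : F) := by
  obtain ⟨c, hc⟩ := h
  have : (a : F) = b * c ^ 2 := by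
    rw [sq, ← hc]; simp [mul_div_cancel₀]
  rw [this, NF_mul_sq]
  rintro rfl
  exact a.ne_zero (by rw [this]; ring)
end field

variable {K : Type*} [Field K] [NumberField K]

instance (v : Pl K) : NeZero (2 : v.C) := ⟨fun h => by
    have : algebraMap K v.C 2 = 0 := by rw [map_ofNat, h]
    simp at this⟩

/-- local units -/
noncomputable abbrev Pl.u (v : Pl K) : Kˣ →* (v.C)ˣ := Units.map (algebraMap K v.C : K →* v.C)

/-- local squares -/
noncomputable def Sq (v : Pl K) : Subgroup Kˣ where
  carrier := {x | IsSquare (algebraMap K v.C x)}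
  one_mem' := by simp
  mul_mem' := fun hx hy => by
    simp only [Set.mem_ofPred_eq, Units.val_mul, map_mul] at *; exact hx.mul hy
  inv_mem' := fun hx => by
    simp only [Set.mem_ofPred_eq, Units.val_inv_eq_inv_val, map_inv₀] at *; exact hx.inv

lemma mem_Sq {v : Pl K} {x : Kˣ} : x ∈ Sq v ↔ IsSquare (algebraMap K v.C x) := Iff.rfl

lemma sq_mem_Sq (v : Pl K) (x : Kˣ) : x ^ 2 ∈ Sq v := ⟨algebraMap K v.C x, by simp [sq]⟩

/-- local norms -/
noncomputable def Nm (a : Kˣ) (v : Pl K) : Subgroup Kˣ :=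
  (NF (algebraMap K v.C a)).comap v.u

lemma mem_Nm {a : Kˣ} {v : Pl K} {z : Kˣ} : z ∈ Nm a v ↔
  ∃ x y : v.C, x ^ 2 - algebraMap K v.C a * y ^ 2 = algebraMap K v.C z := Iff.rfl

lemma Sq_le_Nm (a : Kˣ) (v : Pl K) : Sq v ≤ Nm a v := fun _ h => sq_mem_NF _ h

lemma Nm_symm {a b : Kˣ} {v : Pl K} (h : b ∈ Nm a v) : a ∈ Nm b v :=
  NF_symm (a := v.u a) (b := v.u b) h

lemma Nm_comm {a b : Kˣ} {v : Pl K} : b ∈ Nm a v ↔ a ∈ Nm b v := ⟨Nm_symm, Nm_symm⟩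

lemma Nm_congr {a b : Kˣ} {v : Pl K} (h : a / b ∈ Sq v) : Nm a v = Nm b v := by
  have := NF_congr (a := v.u a) (b := v.u b) (by rw [← map_div]; exact h)
  rw [Nm, Nm]; exact congrArg _ this

lemma Nm_top {a : Kˣ} {v : Pl K} (h : a ∈ Sq v) : Nm a v = ⊤ := by
  rw [Nm, NF_sq (by simp) h]; rfl

lemma neg_mem_Nm (a : Kˣ) (v : Pl K) : -a ∈ Nm a v := ⟨0, 1, by simp⟩

lemma NF_le_Nm (a : Kˣ) (v : Pl K) : NF (a : K) ≤ Nm a v := by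
  rintro z ⟨x, y, h⟩
  exact ⟨algebraMap _ _ x, algebraMap _ _ y, by rw [← map_pow, ← map_pow, ← map_mul, ← map_sub, h]; rfl⟩

/-- approximation -/
lemma approxU (S : Finset (Pl K)) (z : Pl K → Kˣ) {ε : ℝ} (hε : 0 < ε) :
    ∃ x : Kˣ, ∀ v ∈ S, v.abs ((x / z v : Kˣ) - 1) < ε := by
  classical
  by_cases hS : S = ∅
  · subst hS; exact ⟨1, by simp⟩
  have hne : S.Nonempty := Finset.nonempty_of_ne_empty hS
  let m := S.inf' hne (fun v => v.abs (z v : K))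
  have hm : 0 < m := by
    rw [Finset.lt_inf'_iff]; exact fun v _ => v.abs.pos (z v).ne_zero
  obtain ⟨x, hx⟩ := weak_approx S (fun v => (z v : K)) (ε := min ε 1 * m) (by positivity)
  have key : ∀ v ∈ S, v.abs (x / (z v : K) - 1) < min ε 1 := fun v hv => by
    have h0 := v.abs.pos (z v).ne_zero
    have : x / (z v : K) - 1 = (x - z v) / z v := by field_simp
    rw [this, map_div₀, div_lt_iff₀ h0]
    exact (hx v hv).trans_le (mul_le_mul_of_nonneg_left (Finset.inf'_le _ hv) (by positivity))
  have hx0 : x ≠ 0 := by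
    rintro rfl
    obtain ⟨v, hv⟩ := hne
    have := key v hv
    rw [zero_div, zero_sub, v.abs.map_neg, map_one] at this
    exact absurd (this.trans_le (min_le_right _ _)) (lt_irrefl _)
  refine ⟨Units.mk0 x hx0, fun v hv => ?_⟩
  rw [Units.val_div_eq_div_val]
  exact (key v hv).trans_le (min_le_left _ _)

lemma od_of_close {p : HeightOneSpectrum (𝓞 K)} {x : Kˣ} (h : (Pl.fin p).abs ((x : K) - 1) < 1) :
    od p x = 0 := by
  rw [od_eq_zero_iff]
  have h1 := fin_add p ((x : K) - 1) 1
  have h2 := fin_add p (1 - (x : K)) x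
  rw [(Pl.fin p).abs.map_sub] at h2
  simp only [sub_add_cancel, map_one] at h1 h2
  rw [max_eq_right h.le] at h1
  rcases le_max_iff.1 h2 with h3 | h3
  · linarith
  · exact le_antisymm h1 h3

lemma sq_of_close (v : Pl K) : ∃ δ > 0, ∀ x : Kˣ, v.abs ((x : K) - 1) < δ → x ∈ Sq v := by
  obtain ⟨δ, h0, h⟩ := sq_open v
  refine ⟨δ, h0, fun x hx => h _ ?_⟩
  rwa [← map_one (algebraMap K v.C), ← map_sub, norm_alg]

/-- approximation modulo squares with order -/
lemma approxS (S : Finset (Pl K)) (z : Pl K → Kˣ) :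
    ∃ x : Kˣ, (∀ v ∈ S, x / z v ∈ Sq v) ∧ ∀ p, Pl.fin p ∈ S → od p x = od p (z (.fin p)) := by
  classical
  choose δ h0 h using sq_of_close (K := K)
  by_cases hS : S = ∅
  · subst hS; exact ⟨1, by simp⟩
  have hne : S.Nonempty := Finset.nonempty_of_ne_empty hS
  obtain ⟨x, hx⟩ := approxU S z (ε := min (S.inf' hne δ) 1) (by
    rw [lt_min_iff, Finset.lt_inf'_iff]; exact ⟨fun v _ => h0 v, one_pos⟩)
  refine ⟨x, fun v hv => h v _ ((hx v hv).trans_le ((min_le_left _ _).trans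
    (Finset.inf'_le _ hv))), fun p hp => ?_⟩
  have := od_of_close ((hx _ hp).trans_le (min_le_right _ _))
  rw [od_div] at this; omega

/-- finite intersection -/
noncomputable def IS (S : Finset (Pl K)) (H : Pl K → Subgroup Kˣ) : Subgroup Kˣ := ⨅ v ∈ S, H v

lemma mem_IS {S : Finset (Pl K)} {H : Pl K → Subgroup Kˣ} {x : Kˣ} :
    x ∈ IS S H ↔ ∀ v ∈ S, x ∈ H v := by simp [IS, Subgroup.mem_iInf]

lemma index_iInf {G ι : Type*} [CommGroup G] [Fintype ι] (H : ι → Subgroup G)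
    (h : ∀ z : ι → G, ∃ x, ∀ i, x / z i ∈ H i) : (⨅ i, H i).index = ∏ i, (H i).index := by
  have e : (G ⧸ (⨅ i, H i)) ≃ ∀ i, G ⧸ H i := Equiv.ofBijective
    (fun q i => Subgroup.quotientMapOfLE (iInf_le H i) q) ⟨by
      intro x y
      induction x using QuotientGroup.induction_on with | _ x => ?_
      induction y using QuotientGroup.induction_on with | _ y => ?_
      intro hxy
      refine QuotientGroup.eq.2 ((Subgroup.mem_iInf).2 fun i => ?_)
      exact QuotientGroup.eq.1 (congrFun hxy i), by
      intro y
      choose z hz using fun i => QuotientGroup.mk_surjective (s := H i) (y i)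
      obtain ⟨x, hx⟩ := h z
      refine ⟨(x : G ⧸ _), funext fun i => ?_⟩
      rw [← hz]
      refine (QuotientGroup.eq.2 ?_).symm
      have := hx i
      rwa [div_eq_mul_inv, mul_comm] at this⟩
  rw [Subgroup.index, Nat.card_congr e, Nat.card_pi]; rfl

lemma index_IS (S : Finset (Pl K)) (H : Pl K → Subgroup Kˣ) (hH : ∀ v ∈ S, Sq v ≤ H v) :
    (IS S H).index = ∏ v ∈ S, (H v).index := by
  classical
  have : IS S H = ⨅ v : S, H v := by rw [IS, iInf_subtype]
  rw [this, index_iInf, Finset.prod_coe_sort S (fun v => (H v).index)]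
  intro z
  obtain ⟨x, hx, -⟩ := approxS S fun v => if h : v ∈ S then z ⟨v, h⟩ else 1
  refine ⟨x, fun v => ?_⟩
  have := hH v v.2 (hx v v.2)
  rwa [dif_pos v.2] at this
end HM

namespace HM
open NumberField IsDedekindDomain
set_option linter.unusedSectionVars false
variable {K : Type*} [Field K] [NumberField K] {L : Type*} [Field L] [NumberField L]

lemma od_add {p : HeightOneSpectrum (𝓞 L)} {x y z : Lˣ} (h : (x : L) + y = z) (n : ℤ)
    (hx : n ≤ od p x) (hy : n ≤ od p y) : n ≤ od p z := by
  rcases le_total (od p x) (od p y) with hxy | hxy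
  · have := fin_add p (x : L) y
    rw [max_eq_left ((od_le_iff p y x).2 hxy), h] at this
    exact hx.trans ((od_le_iff p z x).1 this)
  · have := fin_add p (x : L) y
    rw [max_eq_right ((od_le_iff p x y).2 hxy), h] at this
    exact hy.trans ((od_le_iff p z y).1 this)

/-- quadratic extension data -/
structure Quad (a : Kˣ) (ι : K →+* L) (s : L) (τ : L →+* L) : Prop where
  hs : s ^ 2 = ι a
  dec : ∀ z, ∃ x y, z = ι x + ι y * s
  hτ : ∀ x, τ (ι x) = ι x
  hτs : τ s = -s
  nsq : ¬ IsSquare (a : K)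


lemma exists_quad {K : Type u} [Field K] [NumberField K] (a : Kˣ) (ha : ¬ IsSquare (a : K)) :
    ∃ (L : Type u)  (_ : Field L) (_ : NumberField L) (ι : K →+* L) (s : L) (τ : L →+* L),
      Quad a ι s τ := by
  have : Fact (∀ r : K, r ^ 2 ≠ (a : K) + 0 * r) := ⟨fun r h => ha ⟨r, by
    rw [← sq, h]; ring⟩⟩
  have : FiniteDimensional ℚ (QuadraticAlgebra K (a : K) 0) := FiniteDimensional.trans ℚ K _
  refine ⟨QuadraticAlgebra K (a : K) 0, inferInstance, ⟨⟩, algebraMap K _, ⟨0, 1⟩,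
    starRingEnd _, ?_, ?_, ?_, ?_, ha⟩
  · ext <;> simp [sq]
  · intro z
    exact ⟨z.re, z.im, by ext <;> simp⟩
  · intro x; rw [starRingEnd_apply]; ext <;> simp
  · rw [starRingEnd_apply]; ext <;> simp

namespace Quad
variable {a : Kˣ} {ι : K →+* L} {s : L} {τ : L →+* L} (Q : Quad a ι s τ)
include Q

lemma s_ne : s ≠ 0 := by
  rintro rfl
  have := Q.hs
  rw [zero_pow two_ne_zero] at this
  exact a.ne_zero ((map_eq_zero ι).1 this.symm)

lemma ττ (z : L) : τ (τ z) = z := by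
  obtain ⟨x, y, rfl⟩ := Q.dec z
  simp [Q.hτ, Q.hτs]

lemma nrm (x y : K) : (ι x + ι y * s) * τ (ι x + ι y * s) = ι (x ^ 2 - a * y ^ 2) := by
  simp only [map_add, map_mul, Q.hτ, Q.hτs, map_sub, map_pow]
  linear_combination -(ι y) ^ 2 * Q.hs

lemma fix {z : L} (h : τ z = z) : ∃ x, z = ι x := by
  obtain ⟨x, y, rfl⟩ := Q.dec z
  simp only [map_add, map_mul, Q.hτ, Q.hτs] at h
  have : ι y * s = 0 := by
    have : 2 * (ι y * s) = 0 := by linear_combination -h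
    simpa using this
  exact ⟨x, by rw [this, add_zero]⟩

lemma exN (z : Lˣ) : ∃ x : Kˣ, ι x = z * τ z ∧ x ∈ NF (a : K) := by
  obtain ⟨x, y, h⟩ := Q.dec z
  have h1 := Q.nrm x y
  rw [← h] at h1
  have h0 : x ^ 2 - a * y ^ 2 ≠ 0 := by
    intro h0
    rw [h0, map_zero] at h1
    simp at h1
  exact ⟨Units.mk0 _ h0, h1.symm, x, y, rfl⟩

/-- norm -/
noncomputable def N : Lˣ →* Kˣ where
  toFun z := (Q.exN z).choose
  map_one' := Units.ext (ι.injective (by rw [(Q.exN 1).choose_spec.1]; simp))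
  map_mul' x y := Units.ext (ι.injective (by
    rw [(Q.exN _).choose_spec.1, Units.val_mul, map_mul, Units.val_mul, map_mul, (Q.exN x).choose_spec.1,
      (Q.exN y).choose_spec.1]; ring))

lemma N_spec (z : Lˣ) : ι (Q.N z) = z * τ z := (Q.exN z).choose_spec.1
lemma N_mem (z : Lˣ) : Q.N z ∈ NF (a : K) := (Q.exN z).choose_spec.2

lemma N_ι (x : Kˣ) : Q.N (Units.map (ι : K →* L) x) = x ^ 2 := Units.ext (ι.injective (by
  rw [N_spec]; simp [Q.hτ, sq]))

lemma ov_τ {w w' : Pl L} (h : Ov τ w w') : Ov τ w' w := by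
  obtain ⟨w'', h'⟩ := ov_exists τ w'
  have e : τ.comp τ = RingHom.id L := RingHom.ext Q.ττ
  have h2 := h'.trans h
  rw [e] at h2
  have h3 : Ov (RingHom.id L) w w := ⟨1, one_pos, fun x => by simp⟩
  rw [h3.uniq h2]; exact h'

lemma ov_ι {w w' : Pl L} {v : Pl K} (h : Ov τ w w') (hv : Ov ι w v) : Ov ι w' v := by
  obtain ⟨v', h'⟩ := ov_exists ι w'
  have e : τ.comp ι = ι := RingHom.ext Q.hτ
  have h2 := h'.trans h
  rw [e] at h2
  rw [hv.uniq h2]; exact h'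

lemma od_τ {q q' : HeightOneSpectrum (𝓞 L)} (h : Ov τ (.fin q) (.fin q')) (x : Lˣ) :
    od q (Units.map (τ : L →* L) x) = od q' x := by
  obtain ⟨e, he, h1⟩ := h.od
  obtain ⟨e', he', h2⟩ := (Q.ov_τ h).od
  obtain ⟨y, hy⟩ := exists_od_one q
  have h3 : Units.map (τ : L →* L) (Units.map (τ : L →* L) y) = y := by
    ext; exact Q.ττ _
  have h4 := h1 (Units.map (τ : L →* L) y)
  rw [h3, h2, hy] at h4
  have : e = 1 := by
    have : e * e' = 1 := by exact_mod_cast (by linarith : (e : ℤ) * e' = 1)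
    exact Nat.eq_one_of_mul_eq_one_right this
  rw [h1, this]; simp

lemma trans_fin {q q' : HeightOneSpectrum (𝓞 L)} {p : HeightOneSpectrum (𝓞 K)}
    (h : Ov ι (.fin q) (.fin p)) (h' : Ov ι (.fin q') (.fin p)) :
    q' = q ∨ Ov τ (.fin q) (.fin q') := by
  classical
  by_contra hc
  push Not at hc
  obtain ⟨r, hr⟩ := ov_fin_exists τ q
  obtain ⟨r', hr'⟩ := ov_fin_exists τ q'
  have h1 : q' ≠ r := by rintro rfl; exact hc.2 hr
  have h2 : r' ≠ q := by rintro rfl; exact hc.2 (Q.ov_τ hr')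
  have h3 : r' ≠ r := by
    rintro rfl
    have := (Q.ov_τ hr).uniq (Q.ov_τ hr')
    simp only [Pl.fin.injEq] at this; exact hc.1 this.symm
  choose π hπ using fun q : HeightOneSpectrum (𝓞 L) => exists_od_one q
  obtain ⟨y, -, hy⟩ := approxS ({.fin q, .fin q', .fin r, .fin r'} : Finset (Pl L))
    (fun w => if w = .fin q' then π q' else if w = .fin r' then π r' else 1)
  have oq : od q y = 0 := by
    rw [hy q (by simp), if_neg (by simpa using Ne.symm hc.1), if_neg (by simpa using h2.symm), od_one]
  have or : od r y = 0 := by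
    rw [hy r (by simp), if_neg (by simpa using h1.symm), if_neg (by simpa using h3.symm), od_one]
  have oq' : od q' y = 1 := by
    rw [hy q' (by simp), if_pos rfl, hπ]
  have or' : 0 ≤ od r' y := by
    rw [hy r' (by simp)]
    by_cases h : r' = q'
    · subst h; rw [if_pos rfl, hπ]; exact zero_le_one
    · rw [if_neg (by simpa using h), if_pos rfl, hπ]; exact zero_le_one
  have hN : Units.map (ι : K →* L) (Q.N y) = y * Units.map (τ : L →* L) y := by
    ext; exact Q.N_spec y
  obtain ⟨e, he, h4⟩ := h.od
  obtain ⟨e', he', h5⟩ := h'.od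
  have h4 := h4 (Q.N y)
  have h5 := h5 (Q.N y)
  rw [hN, od_mul, Q.od_τ hr] at h4
  rw [hN, od_mul, Q.od_τ hr'] at h5
  have : od p (Q.N y) = 0 := by
    have : (e : ℤ) * od p (Q.N y) = 0 := by omega
    rcases mul_eq_zero.1 this with h | h
    · omega
    · exact h
  rw [this] at h5; omega

/-- unramified outside `2a` -/
lemma od_ι {q : HeightOneSpectrum (𝓞 L)} {p : HeightOneSpectrum (𝓞 K)}
    (h : Ov ι (.fin q) (.fin p)) (h2 : od p (Units.mk0 (2 : K) two_ne_zero) = 0) (ha : od p a = 0)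
    (x : Kˣ) : od q (Units.map (ι : K →* L) x) = od p x := by
  classical
  obtain ⟨e, he, h1⟩ := h.od
  suffices he1 : e = 1 by rw [h1, he1]; simp
  obtain ⟨r, hr⟩ := ov_fin_exists τ q
  choose π hπ using fun q : HeightOneSpectrum (𝓞 L) => exists_od_one q
  obtain ⟨y, -, hy⟩ := approxS ({.fin q, .fin r} : Finset (Pl L))
    (fun w => if w = .fin q then π q else π r)
  have oq : od q y = 1 := by rw [hy q (by simp), if_pos rfl, hπ]
  have or : od r y = 1 := by
    rw [hy r (by simp)]
    by_cases h : r = q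
    · subst h; rw [if_pos rfl, hπ]
    · rw [if_neg (by simpa using h), hπ]
  obtain ⟨α, β, hz⟩ := Q.dec y
  have hs0 := Q.s_ne
  have os : od q (Units.mk0 s hs0) = 0 := by
    have h3 := h1 a
    have : Units.map (ι : K →* L) a = (Units.mk0 s hs0) ^ 2 := by ext; exact Q.hs.symm
    rw [this, od_pow, ha] at h3
    push_cast at h3; omega
  have o2 : od q (Units.mk0 (2 : L) two_ne_zero) = 0 := by
    have h3 := h1 (Units.mk0 (2 : K) two_ne_zero)
    have : Units.map (ι : K →* L) (Units.mk0 (2 : K) two_ne_zero) =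
      Units.mk0 (2 : L) two_ne_zero := by ext; exact map_ofNat ι 2
    rw [this, h2] at h3; omega
  have oτ : od q (Units.map (τ : L →* L) y) = 1 := by rw [Q.od_τ hr, or]
  have hτy : τ y = ι α - ι β * s := by rw [hz]; simp [Q.hτ, Q.hτs]; ring
  have oα : ∀ h : α ≠ 0, 1 ≤ od q (Units.map (ι : K →* L) (Units.mk0 α h)) := fun h => by
    have := od_add (p := q) (x := y) (y := Units.map (τ : L →* L) y)
      (z := Units.mk0 (2 : L) two_ne_zero * Units.map (ι : K →* L) (Units.mk0 α h)) (by
        change (y : L) + τ y = 2 * ι α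
        rw [hτy, hz]; ring) 1 oq.ge oτ.ge
    rwa [od_mul, o2, zero_add] at this
  have oβ : ∀ h : β ≠ 0, 1 ≤ od q (Units.map (ι : K →* L) (Units.mk0 β h)) := fun h => by
    have := od_add (p := q) (x := y) (y := -Units.map (τ : L →* L) y)
      (z := Units.mk0 (2 : L) two_ne_zero * Units.map (ι : K →* L) (Units.mk0 β h) *
        Units.mk0 s hs0) (by
        change (y : L) + -τ y = 2 * ι β * s
        rw [hτy, hz]; ring) 1 oq.ge (by rw [od_neg]; exact oτ.ge)
    rwa [od_mul, od_mul, o2, os, zero_add, add_zero] at this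
  by_contra hne
  have hdiv : ∀ x : Kˣ, 1 ≤ od q (Units.map (ι : K →* L) x) →
      2 ≤ od q (Units.map (ι : K →* L) x) := fun x hx => by
    rw [h1] at hx ⊢
    have : 0 < od p x := by
      by_contra hc
      have : (e : ℤ) * od p x ≤ 0 := mul_nonpos_of_nonneg_of_nonpos (by positivity) (by omega)
      omega
    have : 2 ≤ (e : ℤ) := by omega
    nlinarith
  by_cases hα : α = 0
  · have hβ : β ≠ 0 := by rintro rfl; simp [hα] at hz
    have : y = Units.map (ι : K →* L) (Units.mk0 β hβ) * Units.mk0 s hs0 := by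
      ext; rw [hz, hα]; simp
    have h5 := hdiv _ (oβ hβ)
    rw [this, od_mul, os] at oq
    omega
  by_cases hβ : β = 0
  · have : y = Units.map (ι : K →* L) (Units.mk0 α hα) := by
      ext; rw [hz, hβ]; simp
    have h5 := hdiv _ (oα hα)
    rw [this] at oq
    omega
  have := od_add (p := q) (x := Units.map (ι : K →* L) (Units.mk0 α hα))
    (y := Units.map (ι : K →* L) (Units.mk0 β hβ) * Units.mk0 s hs0) (z := y) hz.symm 2
    (hdiv _ (oα hα)) (by rw [od_mul, os, add_zero]; exact hdiv _ (oβ hβ))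
  omega

/-- split places -/
lemma split {v : Pl K} (hv : a ∈ Sq v) {w w' : Pl L} (hw : Ov ι w v) (h : Ov τ w w') : w ≠ w' := by
  rintro rfl
  obtain ⟨e, he, h1⟩ := h
  obtain ⟨f, hf, hf'⟩ := hw.hom
  obtain ⟨r, hr⟩ := hv
  set S := algebraMap L w.C s with hS
  have hfr : (f r - S) * (f r + S) = 0 := by
    have h2 : f (algebraMap K v.C a) = S ^ 2 := by rw [hf', ← Q.hs, map_pow]
    rw [hr, map_mul] at h2
    linear_combination h2
  have hpos : 0 < ‖2 * S‖ := by
    rw [norm_pos_iff]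
    refine mul_ne_zero (NeZero.ne 2) ?_
    simpa [hS] using Q.s_ne
  -- choose sign
  have main : ∀ ρ : v.C, f ρ = S → False := fun ρ hρ => by
    have hτ' : ∀ x : K, w.abs (ι x + s) = w.abs (ι x - s) ^ e := fun x => by
      rw [← h1]; simp [Q.hτ, Q.hτs]
    have hcont : Continuous fun y : v.C => ‖f y + S‖ - ‖f y - S‖ ^ e :=
      ((hf.add continuous_const).norm).sub
        (((hf.sub continuous_const).norm).rpow_const fun _ => Or.inr he.le)
    have hz : (fun y : v.C => ‖f y + S‖ - ‖f y - S‖ ^ e) = fun _ => 0 := by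
      refine (dense_alg v).equalizer hcont continuous_const ?_
      ext x
      simp only [Function.comp, hf', hS, ← map_add, ← map_sub, norm_alg]
      rw [hτ' x, sub_self]
    have := congrFun hz ρ
    simp only [hρ, sub_self, norm_zero, Real.zero_rpow he.ne', sub_zero] at this
    rw [← two_mul] at this; linarith
  rcases mul_eq_zero.1 hfr with h | h
  · exact main r (sub_eq_zero.1 h)
  · exact main (-r) (by rw [map_neg]; linear_combination -h)
end Quad
end HM

namespace HM
open NumberField IsDedekindDomain
set_option linter.unusedSectionVars false
variable {K : Type*} [Field K] [NumberField K] {L : Type*} [Field L] [NumberField L]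

lemma Gen.solve {S : Finset (Pl K)} (hS : Gen S) (n : HeightOneSpectrum (𝓞 K) → ℤ)
    (hn : {p | n p ≠ 0}.Finite) : ∃ k : Kˣ, ∀ p, Pl.fin p ∉ S → od p k = n p := by
  classical
  choose! g hg hg' using hS
  refine ⟨∏ p ∈ hn.toFinset with Pl.fin p ∉ S, g p ^ n p, fun p hp => ?_⟩
  have hsum : ∀ (T : Finset (HeightOneSpectrum (𝓞 K))) (f : HeightOneSpectrum (𝓞 K) → Kˣ),
      od p (∏ q ∈ T, f q) = ∑ q ∈ T, od p (f q) := fun T f => by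
    induction T using Finset.induction_on with
    | empty => simp [od_one]
    | insert a s h ih => rw [Finset.prod_insert h, Finset.sum_insert h, od_mul, ih]
  rw [hsum]
  by_cases hp0 : n p = 0
  · rw [hp0]
    refine Finset.sum_eq_zero fun q hq => ?_
    rw [Finset.mem_filter, Set.Finite.mem_toFinset] at hq
    rw [od_zpow, hg' q hq.2 p (by rintro rfl; exact hq.1 hp0) hp, mul_zero]
  · rw [Finset.sum_eq_single p, od_zpow, hg p hp, mul_one]
    · intro q hq hqp
      rw [Finset.mem_filter, Set.Finite.mem_toFinset] at hq
      rw [od_zpow, hg' q hq.2 p hqp.symm hp, mul_zero]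
    · intro h; exact absurd (by simp [hp, hp0]) h

lemma card_two_tors {A : Type*} [AddCommGroup A] (j : A →+ Additive Kˣ)
    (hj : Function.Injective j) (m : A) (hm : j m = Additive.ofMul (-1)) :
    Nat.card (dbl A).ker = 2 := by
  have h1 : ∀ x : Kˣ, x ^ 2 = 1 → x = 1 ∨ x = -1 := fun x hx => by
    have : (x : K) ^ 2 = 1 := by rw [← Units.val_pow_eq_pow_val, hx]; rfl
    rcases (by simpa using this : (x : K) = 1 ∨ (x : K) = -1) with h | h
    · exact Or.inl (Units.ext h)
    · exact Or.inr (Units.ext h)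
  have hm2 : (2 : ℕ) • m = 0 := hj (by
    rw [map_nsmul, hm, map_zero, ← ofMul_pow]; simp)
  rw [Nat.card_eq_two_iff]
  refine ⟨0, ⟨m, hm2⟩, fun h => ?_, ?_⟩
  · have h : (0 : A) = m := congrArg Subtype.val h
    rw [← h, map_zero] at hm
    have h2 : (1 : Kˣ) = -1 := hm
    have : (1 : K) = -1 := congrArg Units.val h2
    exact two_ne_zero (α := K) (by linear_combination this)
  · rw [Set.eq_univ_iff_forall]
    rintro ⟨x, hx⟩
    have hx : (2 : ℕ) • x = 0 := hx
    have hx : (j x).toMul ^ 2 = 1 := by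
      rw [← toMul_nsmul, ← map_nsmul, hx, map_zero]; rfl
    rcases h1 _ hx with h | h
    · left; exact Subtype.ext (hj (h.trans (map_zero j).symm))
    · right; exact Subtype.ext (hj (by rw [hm]; exact h))

lemma neg_one_mem_US (S : Finset (Pl K)) : -1 ∈ US S := fun p _ => by rw [od_neg, od_one]

/-- places over `S` -/
noncomputable def up (ι : K →+* L) (S : Finset (Pl K)) : Finset (Pl L) := by
  classical exact S.biUnion fun v => (ov_finite ι v).toFinset

lemma mem_up {ι : K →+* L} {S : Finset (Pl K)} {w : Pl L} : w ∈ up ι S ↔ ∃ v ∈ S, Ov ι w v := by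
  classical
  simp [up]

lemma mem_up_iff {ι : K →+* L} {S : Finset (Pl K)} {w : Pl L} {v : Pl K} (h : Ov ι w v) :
    w ∈ up ι S ↔ v ∈ S := by
  rw [mem_up]
  exact ⟨fun ⟨v', h1, h2⟩ => by rwa [h.uniq h2], fun h1 => ⟨v, h1, h⟩⟩

lemma up_inf {ι : K →+* L} {S : Finset (Pl K)} (h : Inf S) : Inf (up ι S) := fun w =>
  (mem_up_iff (ov_inf ι w)).2 (h _)

lemma map_US {ι : K →+* L} {S : Finset (Pl K)} {x : Kˣ} (hx : x ∈ US S) :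
    Units.map (ι : K →* L) x ∈ US (up ι S) := fun q hq => by
  obtain ⟨p, hp⟩ := ov_fin_exists ι q
  obtain ⟨e, he, h⟩ := hp.od
  rw [h, hx p (fun h' => hq ((mem_up_iff hp).2 h')), mul_zero]

/-- quadratic good set -/
structure Good (a : Kˣ) (S : Finset (Pl K)) : Prop where
  inf : Inf S
  gen : Gen S
  two : ∀ p, Pl.fin p ∉ S → od p (Units.mk0 (2 : K) two_ne_zero) = 0
  od : ∀ p, Pl.fin p ∉ S → od p a = 0

lemma Good.mono {a : Kˣ} {S T : Finset (Pl K)} (h : Good a S) (hST : S ⊆ T) : Good a T :=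
  ⟨fun v => hST (h.inf v), h.gen.mono hST, fun p hp => h.two p fun h' => hp (hST h'),
    fun p hp => h.od p fun h' => hp (hST h')⟩

lemma exists_good (a : Kˣ) : ∃ S, Good a S := by
  classical
  obtain ⟨S, hS⟩ := exists_gen (K := K)
  let T := S ∪ (Finset.univ.image Pl.inf) ∪ (od_finite a).toFinset.image Pl.fin ∪
    (od_finite (Units.mk0 (2 : K) two_ne_zero)).toFinset.image Pl.fin
  refine ⟨T, fun v => by simp [T], hS.mono fun x hx => by simp [T, hx], fun p hp => ?_, fun p hp => ?_⟩
  · by_contra h; exact hp (by simp [T, h])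
  · by_contra h; exact hp (by simp [T, h])

namespace Quad
variable {a : Kˣ} {ι : K →+* L} {s : L} {τ : L →+* L} (Q : Quad a ι s τ)
include Q

lemma hilbert90 {x : Lˣ} (h : Q.N x = 1) : ∃ y : Lˣ, x = y / Units.map (τ : L →* L) y := by
  have h1 : (x : L) * τ x = 1 := by rw [← Q.N_spec, h]; simp
  by_cases hx : (x : L) = -1
  · refine ⟨Units.mk0 s Q.s_ne, Units.ext ?_⟩
    rw [Units.val_div_eq_div_val]
    change (x : L) = s / τ s
    rw [Q.hτs, hx, div_neg, div_self Q.s_ne]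
  · have h2 : 1 + (x : L) ≠ 0 := fun h => hx (by linear_combination h)
    refine ⟨Units.mk0 (1 + (x : L)) h2, Units.ext ?_⟩
    rw [Units.val_div_eq_div_val, eq_div_iff (Units.ne_zero _)]
    change (x : L) * τ (1 + x) = 1 + x
    rw [map_add, map_one]; linear_combination h1

lemma hilbert90S {S : Finset (Pl K)} (G : Good a S) {x : Lˣ}
    (hx : x ∈ US (up ι S)) (h : Q.N x = 1) :
    ∃ y ∈ US (up ι S), x = y / Units.map (τ : L →* L) y := by
  classical
  obtain ⟨y, hy⟩ := Q.hilbert90 h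
  choose w hw using fun p : HeightOneSpectrum (𝓞 K) => ov_over ι (.fin p)
  have hq : ∀ p, ∃ q, w p = .fin q := fun p => by
    cases hwp : w p with
    | fin q => exact ⟨q, rfl⟩
    | inf u =>
      have := hw p; rw [hwp] at this
      obtain ⟨v', h⟩ := ov_inf_iff this; cases h
  choose q hq using hq
  have hq' : ∀ p, Ov ι (.fin (q p)) (.fin p) := fun p => hq p ▸ hw p
  obtain ⟨k, hk⟩ := G.gen.solve (fun p => HM.od (q p) y) (by
    refine ((od_finite y).preimage (f := q) ?_)
    intro p _ p' _ h
    have := (hq' p).uniq (h ▸ hq' p')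
    simpa using this)
  have hkτ : Units.map (τ : L →* L) (Units.map (ι : K →* L) k) = Units.map (ι : K →* L) k := by
    ext; exact Q.hτ k
  refine ⟨y / Units.map (ι : K →* L) k, fun r hr => ?_, ?_⟩
  · obtain ⟨p, hp⟩ := ov_fin_exists ι r
    have hpS : Pl.fin p ∉ S := fun h' => hr ((mem_up_iff hp).2 h')
    rw [od_div, Q.od_ι hp (G.two p hpS) (G.od p hpS), hk p hpS]
    rcases Q.trans_fin hp (hq' p) with h | h
    · rw [h, sub_self]
    · have := hx r hr
      rw [hy, od_div, Q.od_τ h] at this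
      exact this
  · rw [map_div, hkτ, div_div_div_cancel_right, hy]

lemma N_US {S : Finset (Pl K)} {x : Lˣ} (hx : x ∈ US (up ι S)) : Q.N x ∈ US S := fun p hp => by
  obtain ⟨w, hw⟩ := ov_over ι (.fin p)
  cases w with
  | inf u => obtain ⟨v', h⟩ := ov_inf_iff hw; cases h
  | fin q =>
    obtain ⟨e, he, h⟩ := hw.od
    obtain ⟨r, hr⟩ := ov_fin_exists τ q
    have h1 : Units.map (ι : K →* L) (Q.N x) = x * Units.map (τ : L →* L) x := by
      ext; exact Q.N_spec x
    have h2 := h (Q.N x)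
    rw [h1, od_mul, Q.od_τ hr, hx q (fun h' => hp ((mem_up_iff hw).1 h')),
      hx r (fun h' => hp ((mem_up_iff (Q.ov_ι hr hw)).1 h'))] at h2
    rcases mul_eq_zero.1 h2.symm with h | h
    · omega
    · exact h

open Classical in
lemma card_up {S : Finset (Pl K)} : 2 * S.card ≤ (up ι S).card + (S.filter fun v => a ∉ Sq v).card := by
  have h1 : ∀ v ∈ S, 2 ≤ (ov_finite ι v).toFinset.card + if a ∉ Sq v then 1 else 0 := fun v _ => by
    obtain ⟨w, hw⟩ := ov_over ι v
    have hw' : w ∈ (ov_finite ι v).toFinset := by simpa using hw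
    by_cases h : a ∉ Sq v
    · rw [if_pos h]
      have := Finset.card_pos.2 ⟨w, hw'⟩; omega
    · rw [if_neg h]
      push Not at h
      obtain ⟨w', hww⟩ := ov_exists τ w
      have := Finset.one_lt_card.2 ⟨w, hw', w', by simpa using Q.ov_ι hww hw, Q.split h hw hww⟩
      omega
  have h2 : (up ι S).card = ∑ v ∈ S, (ov_finite ι v).toFinset.card := by
    rw [up, Finset.card_biUnion]
    intro v _ v' _ hne
    refine Finset.disjoint_left.2 ?_
    intro w h h'
    simp only [Set.Finite.mem_toFinset, Set.mem_ofPred_eq] at h h'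
    exact hne (h.uniq h')
  rw [h2, Finset.card_filter, ← Finset.sum_add_distrib, mul_comm, ← smul_eq_mul]
  exact Finset.card_nsmul_le_sum _ _ _ h1

open Classical in
lemma key {S : Finset (Pl K)} (G : Good a S) : (NF (a : K)).relIndex (US S) ≠ 0 ∧
    2 * (NF (a : K)).relIndex (US S) ≤ 2 ^ (S.filter fun v => a ∉ Sq v).card := by
  obtain ⟨fB, rB⟩ := US_rank S G.inf
  obtain ⟨fA, rA⟩ := US_rank (up ι S) (up_inf G.inf)
  let i0 : US S →* US (up ι S) :=
    ((Units.map (ι : K →* L)).comp (US S).subtype).codRestrict _ fun x => map_US x.2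
  let N0 : US (up ι S) →* US S :=
    (Q.N.comp (US (up ι S)).subtype).codRestrict _ fun x => Q.N_US x.2
  have hiN : ∀ y : US (up ι S), ((i0 (N0 y) : Lˣ)) = y * Units.map (τ : L →* L) y := fun y => by
    ext; exact Q.N_spec y
  have hi : Function.Injective i0 := fun x y h => by
    have : ι (x : Kˣ) = ι (y : Kˣ) := congrArg (fun z : US (up ι S) => ((z : Lˣ) : L)) h
    exact Subtype.ext (Units.ext (ι.injective this))
  have H := herbrand (MonoidHom.toAdditive i0) (MonoidHom.toAdditive N0) hi (fun b => by
      change N0 (i0 b.toMul) = b.toMul ^ 2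
      ext1; exact Q.N_ι _) (fun y hy => by
      have hy : i0 (N0 y.toMul) = y.toMul ^ 2 := hy
      have hy : (i0 (N0 y.toMul) : Lˣ) = (y.toMul : Lˣ) ^ 2 := by rw [hy]; rfl
      rw [hiN, sq] at hy
      have hy := mul_left_cancel hy
      obtain ⟨x, hx⟩ := Q.fix (z := ((y.toMul : Lˣ) : L)) (congrArg Units.val hy)
      have hx0 : x ≠ 0 := by rintro rfl; rw [map_zero] at hx; exact Units.ne_zero _ hx
      have hxS : Units.mk0 x hx0 ∈ US S := fun p hp => by
        obtain ⟨w, hw⟩ := ov_over ι (.fin p)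
        cases w with
        | inf u => obtain ⟨v', h⟩ := ov_inf_iff hw; cases h
        | fin q =>
          have h1 := Q.od_ι hw (G.two p hp) (G.od p hp) (Units.mk0 x hx0)
          rw [← h1]
          have : Units.map (ι : K →* L) (Units.mk0 x hx0) = y.toMul := by ext; exact hx.symm
          rw [this]
          exact y.toMul.2 q (fun h' => hp ((mem_up_iff hw).1 h'))
      exact ⟨Additive.ofMul ⟨_, hxS⟩, Subtype.ext (Units.ext hx.symm)⟩) (fun x hx => by
      have hx : N0 x.toMul = 1 := hx
      obtain ⟨y, hy, hxy⟩ := Q.hilbert90S G x.toMul.2 (congrArg Subtype.val hx)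
      refine ⟨Additive.ofMul ⟨y, hy⟩, Subtype.ext ?_⟩
      change (x.toMul : Lˣ) = y ^ 2 / (i0 (N0 ⟨y, hy⟩) : Lˣ)
      rw [hiN, hxy, sq, mul_div_mul_left_eq_div]) ?_ ?_
  · set N1 : Additive (US (up ι S)) →+ Additive (US S) := MonoidHom.toAdditive N0
    have hr : N1.range.index = N0.range.index := rfl
    rw [hr] at H
    have hle : N0.range ≤ (NF (a : K)).subgroupOf (US S) := by
      rintro _ ⟨y, rfl⟩
      exact Q.N_mem y
    have h0 : N0.range.index ≠ 0 := by
      intro h; rw [h, zero_mul] at H; exact absurd H.symm (by positivity)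
    have hdvd := Subgroup.index_dvd_of_le hle
    have hle2 := Nat.le_of_dvd (Nat.pos_of_ne_zero h0) hdvd
    refine ⟨fun h => h0 (Nat.eq_zero_of_zero_dvd (h ▸ hdvd)), ?_⟩
    refine (Nat.mul_le_mul_left 2 hle2).trans ?_
    have hc := Q.card_up (S := S)
    set sA := (up ι S).card
    set ns := (S.filter fun v => a ∉ Sq v).card
    set fa := Module.finrank ℤ (Additive (US (up ι S)))
    set fb := Module.finrank ℤ (Additive (US S))
    refine Nat.le_of_mul_le_mul_right (c := 2 ^ fa) ?_ (by positivity)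
    rw [mul_assoc, H, ← pow_add, ← pow_succ']
    exact Nat.pow_le_pow_right (by norm_num) (by omega)
  · refine card_two_tors (K := L) ((MonoidHom.toAdditive (US (up ι S)).subtype).comp (AddSubgroup.subtype _)) ?_
      ⟨Additive.ofMul ⟨-1, neg_one_mem_US _⟩, ?_⟩ rfl
    · intro x y h
      exact Subtype.ext (Subtype.ext h)
    · change N0 ⟨-1, _⟩ = 1
      refine Subtype.ext (Units.ext (ι.injective ?_))
      change ι (Q.N (-1)) = ι 1
      rw [Q.N_spec]; simp
  · exact card_two_tors (MonoidHom.toAdditive (US S).subtype)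
      (fun x y h => Subtype.ext h) (Additive.ofMul ⟨-1, neg_one_mem_US _⟩) rfl
end Quad

open Classical in
/-- first inequality, raw -/
lemma key1 {a : Kˣ} (ha : ¬ IsSquare (a : K)) {S : Finset (Pl K)} (G : Good a S) :
    (NF (a : K)).relIndex (US S) ≠ 0 ∧
    2 * (NF (a : K)).relIndex (US S) ≤ 2 ^ (S.filter fun v => a ∉ Sq v).card := by
  obtain ⟨L, _, _, ι, s, τ, Q⟩ := exists_quad a ha
  exact Q.key G
end HM

namespace HM
open NumberField IsDedekindDomain
variable {K : Type*} [Field K] [NumberField K]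

open Classical in
/-- first inequality -/
lemma first_ineq {a : Kˣ} (ha : ¬ IsSquare (a : K)) {S : Finset (Pl K)} (G : Good a S) :
    (NF (a : K)).relIndex (US S ⊓ IS S (Nm a)) ≠ 0 ∧
    2 * (NF (a : K)).relIndex (US S ⊓ IS S (Nm a)) * (IS S (Nm a)).index ≤
      (US S ⊔ IS S (Nm a)).index * 2 ^ (S.filter fun v => a ∉ Sq v).card := by
  obtain ⟨h0, h1⟩ := key1 ha G
  set N := IS S (Nm a)
  set U := US S
  have hMN : NF (a : K) ≤ N := fun x hx => mem_IS.2 fun v _ => NF_le_Nm a v hx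
  have e1 : (NF (a : K)).relIndex U = (NF (a : K)).relIndex (U ⊓ N) * N.relIndex U := by
    rw [← Subgroup.inf_relIndex_right, ← Subgroup.relIndex_mul_relIndex (NF (a : K) ⊓ U) (U ⊓ N) U
      (le_inf inf_le_right (inf_le_left.trans hMN)) inf_le_left, ← Subgroup.inf_relIndex_right _ (U ⊓ N),
      inf_comm U N, Subgroup.inf_relIndex_right N U, ← Subgroup.inf_relIndex_right (NF (a : K)) (N ⊓ U)]
    congr 2
    ext x; simp only [Subgroup.mem_inf]; tauto
  have e2 : N.index = N.relIndex U * (U ⊔ N).index := by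
    rw [← Subgroup.relIndex_mul_index (le_sup_right : N ≤ U ⊔ N), Subgroup.relIndex_sup_right]
  refine ⟨fun h => h0 (by rw [e1, h, zero_mul]), ?_⟩
  rw [e2]
  calc _ = (U ⊔ N).index * (2 * (NF (a : K)).relIndex U) := by rw [e1]; ring
    _ ≤ _ := Nat.mul_le_mul_left _ h1

lemma Sq_approx {v : Pl K} {x : Kˣ} (h : x ∈ Sq v) {ε : ℝ} (hε : 0 < ε) :
    ∃ r : K, v.abs (r ^ 2 / x - 1) < ε := by
  obtain ⟨y, hy⟩ := h
  have hx : algebraMap K v.C x ≠ 0 := by simp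
  have hc : Continuous fun t : v.C => ‖t ^ 2 / algebraMap K v.C x - 1‖ := by fun_prop
  have : {t : v.C | ‖t ^ 2 / algebraMap K v.C x - 1‖ < ε} ∈ nhds y :=
    (isOpen_lt hc continuous_const).mem_nhds (by
      simp only [Set.mem_ofPred_eq]; rw [hy, sq, div_self (by rw [← hy]; exact hx)]; simpa)
  obtain ⟨r, hr⟩ := (dense_alg v).exists_mem_open (isOpen_lt hc continuous_const) ⟨y, mem_of_mem_nhds this⟩
  refine ⟨r, ?_⟩
  have hr : ‖(algebraMap K v.C r) ^ 2 / algebraMap K v.C x - 1‖ < ε := hr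
  rwa [← map_pow, ← map_div₀, ← map_one (algebraMap K v.C), ← map_sub, norm_alg] at hr

lemma Nm_approx {v : Pl K} {a z : Kˣ} (h : z ∈ Nm a v) {ε : ℝ} (hε : 0 < ε) :
    ∃ x y : K, v.abs ((x ^ 2 - a * y ^ 2) / z - 1) < ε := by
  obtain ⟨x, y, hy⟩ := h
  have hz : algebraMap K v.C z ≠ 0 := by simp
  have hc : Continuous fun t : v.C × v.C =>
    ‖(t.1 ^ 2 - algebraMap K v.C a * t.2 ^ 2) / algebraMap K v.C z - 1‖ := by fun_prop
  obtain ⟨⟨r, s⟩, hr⟩ := ((dense_alg v).prodMap (dense_alg v)).exists_mem_open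
    (isOpen_lt hc (continuous_const (y := ε))) ⟨(x, y), by
      change ‖(x ^ 2 - algebraMap K v.C a * y ^ 2) / algebraMap K v.C z - 1‖ < ε
      rw [hy]; simpa⟩
  refine ⟨r, s, ?_⟩
  have hr : ‖((algebraMap K v.C r) ^ 2 - algebraMap K v.C a * (algebraMap K v.C s) ^ 2) /
    algebraMap K v.C z - 1‖ < ε := hr
  rwa [← map_pow, ← map_pow, ← map_mul, ← map_sub, ← map_div₀, ← map_one (algebraMap K v.C),
    ← map_sub, norm_alg] at hr

section fin
variable (p : HeightOneSpectrum (𝓞 K))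

lemma fna : IsNonarchimedean (Pl.fin p).abs := fin_add p

lemma fin_sub (x y : K) : (Pl.fin p).abs (x - y) ≤ max ((Pl.fin p).abs x) ((Pl.fin p).abs y) := by
  have := fin_add p x (-y)
  rwa [(Pl.fin p).abs.map_neg, ← sub_eq_add_neg] at this

lemma fin_dom {x y : K} (h : (Pl.fin p).abs x < (Pl.fin p).abs y) :
    (Pl.fin p).abs (x + y) = (Pl.fin p).abs y := by
  refine le_antisymm ((fin_add p x y).trans (max_eq_right h.le).le) ?_
  have := fin_sub p (x + y) x
  rw [add_sub_cancel_left] at this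
  rcases le_max_iff.1 this with h1 | h1
  · exact h1
  · exact absurd h (not_lt.2 h1)

lemma od_lt_iff (x y : Kˣ) :
    (Pl.fin p).abs (x : K) < (Pl.fin p).abs (y : K) ↔ od p y < od p x := by
  rw [← not_le, od_le_iff, not_le]

lemma od_eq_iff (x y : Kˣ) :
    (Pl.fin p).abs (x : K) = (Pl.fin p).abs (y : K) ↔ od p x = od p y := by
  have h1 := od_le_iff p x y
  have h2 := od_le_iff p y x
  constructor
  · intro h; exact le_antisymm (h2.1 h.ge) (h1.1 h.le)
  · intro h; exact le_antisymm (h1.2 h.ge) (h2.2 h.le)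

lemma even_of_abs {n : Kˣ} {r : K} (h : (Pl.fin p).abs (n : K) = (Pl.fin p).abs r ^ 2) :
    Even (od p n) := by
  have hr : r ≠ 0 := by
    rintro rfl; rw [map_zero, zero_pow two_ne_zero] at h
    exact n.ne_zero ((Pl.fin p).abs.eq_zero.1 h)
  have := (od_eq_iff p n (Units.mk0 r hr ^ 2)).1 (by rw [h, ← map_pow]; rfl)
  rw [this, od_pow]; exact even_two_mul _

lemma fin_nat (n : ℕ) : (Pl.fin p).abs (n : K) ≤ 1 := by
  have : (Pl.fin p).abs (algebraMap (𝓞 K) K n) ≤ 1 := fin_int p (n : 𝓞 K)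
  rwa [map_natCast] at this

lemma fin_two : (Pl.fin p).abs (2 : K) ≤ 1 := by exact_mod_cast fin_nat p 2
lemma fin_four : (Pl.fin p).abs (4 : K) ≤ 1 := by exact_mod_cast fin_nat p 4

/-- sharp local square theorem -/
lemma sq_sharp {x : Kˣ} (h : (Pl.fin p).abs ((x : K) - 1) < (Pl.fin p).abs 4) : x ∈ Sq (.fin p) := by
  have h4 : (4 : K) ≠ 0 := by norm_num
  have h4' := (Pl.fin p).abs.pos h4
  set t : K := (x - 1) / 4 with ht
  have hx : (x : K) = 1 + 4 * t := by rw [ht]; field_simp; ring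
  have ht1 : (Pl.fin p).abs t < 1 := by rw [ht, map_div₀, div_lt_one h4']; exact h
  have h41 : (Pl.fin p).abs (4 : K) ≤ 1 := fin_four p
  have h21 : (Pl.fin p).abs (2 : K) ≤ 1 := fin_two p
  have it : ∀ n : ℕ, ∃ z : K, (Pl.fin p).abs z ≤ (Pl.fin p).abs t ∧
      (Pl.fin p).abs (z ^ 2 + z - t) ≤ (Pl.fin p).abs t ^ (n + 1) := fun n => by
    induction n with
    | zero => exact ⟨0, by simp, by simp⟩
    | succ n ih =>
      obtain ⟨z, h1, h2⟩ := ih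
      have hn : (Pl.fin p).abs (t - z ^ 2) ≤ (Pl.fin p).abs t := by
        refine (fin_sub p _ _).trans (max_le le_rfl ?_)
        rw [map_pow]
        nlinarith [(Pl.fin p).abs.nonneg z]
      refine ⟨t - z ^ 2, hn, ?_⟩
      have : (t - z ^ 2) ^ 2 + (t - z ^ 2) - t = -((z ^ 2 + z - t) * ((t - z ^ 2) + z)) := by ring
      rw [this, (Pl.fin p).abs.map_neg, map_mul, pow_succ _ (n + 1)]
      exact mul_le_mul h2 ((fin_add p _ _).trans (max_le hn h1)) ((Pl.fin p).abs.nonneg _)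
        (pow_nonneg ((Pl.fin p).abs.nonneg _) _)
  obtain ⟨δ, hδ, hsq⟩ := sq_of_close (Pl.fin p)
  obtain ⟨n, hn⟩ := exists_pow_lt_of_lt_one hδ ht1
  obtain ⟨z, h1, h2⟩ := it n
  have h3 : (Pl.fin p).abs (1 + 2 * z) = 1 := by
    rw [add_comm, fin_dom p (y := (1 : K)), map_one]
    rw [map_mul, map_one]
    have := (Pl.fin p).abs.nonneg z
    nlinarith
  have hz : 1 + 2 * z ≠ 0 := fun h => by rw [h, map_zero] at h3; exact zero_ne_one h3
  have h5 : x / (Units.mk0 _ hz) ^ 2 ∈ Sq (.fin p) := by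
    apply hsq
    have : ((x / (Units.mk0 _ hz) ^ 2 : Kˣ) : K) - 1 = -(4 * (z ^ 2 + z - t)) / (1 + 2 * z) ^ 2 := by
      rw [Units.val_div_eq_div_val]
      simp only [Units.val_pow_eq_pow_val, Units.val_mk0]
      rw [hx]; field_simp; ring
    rw [this, map_div₀, map_pow, h3, (Pl.fin p).abs.map_neg, map_mul, one_pow, div_one]
    have h6 : (Pl.fin p).abs t ^ (n + 1) ≤ (Pl.fin p).abs t ^ n :=
      pow_le_pow_of_le_one ((Pl.fin p).abs.nonneg _) ht1.le (Nat.le_succ n)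
    nlinarith [(Pl.fin p).abs.nonneg (z ^ 2 + z - t)]
  have := mul_mem h5 (sq_mem_Sq (.fin p) (Units.mk0 _ hz))
  rwa [div_mul_cancel] at this

/-- norms from the unramified extension have even order -/
lemma even_of_unram {a : Kˣ} {ρ : K} (hρ : (Pl.fin p).abs ρ ≤ 1) (ha : (a : K) = 1 + 4 * ρ)
    (h1 : (Pl.fin p).abs (a : K) = 1) (hns : a ∉ Sq (.fin p)) {x y : K} {n : Kˣ}
    (h : x ^ 2 - a * y ^ 2 = n) : Even (od p n) := by
  by_cases hy : y = 0
  · subst hy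
    refine even_of_abs p (r := x) ?_
    rw [← h]; simp
  set X := x / y with hX
  have hm : (n : K) = (X ^ 2 - a) * y ^ 2 := by rw [← h, hX]; field_simp
  suffices H : ∃ r : K, (Pl.fin p).abs (X ^ 2 - a) = (Pl.fin p).abs r ^ 2 by
    obtain ⟨r, hr⟩ := H
    refine even_of_abs p (r := r * y) ?_
    rw [hm, map_mul, hr, map_pow, map_mul]; ring
  have hX0 := (Pl.fin p).abs.nonneg X
  rcases lt_trichotomy ((Pl.fin p).abs X) 1 with hlt | heq | hgt
  · refine ⟨1, ?_⟩
    rw [sub_eq_add_neg, fin_dom p]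
    · rw [(Pl.fin p).abs.map_neg, h1]; simp
    · rw [(Pl.fin p).abs.map_neg, h1, map_pow]; nlinarith
  · have hX1 : X ≠ 0 := by rintro h; rw [h, map_zero] at heq; exact zero_ne_one heq
    have h4 : (Pl.fin p).abs 4 ≤ (Pl.fin p).abs (X ^ 2 - a) := by
      by_contra hc
      push Not at hc
      refine hns ?_
      have h5 := sq_sharp p (x := (Units.mk0 X hX1) ^ 2 / a) (by
        have : (((Units.mk0 X hX1) ^ 2 / a : Kˣ) : K) - 1 = (X ^ 2 - a) / a := by
          rw [Units.val_div_eq_div_val]; simp [sub_div]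
        rw [this, map_div₀, h1, div_one]; exact hc)
      have := mul_mem (inv_mem h5) (sq_mem_Sq (.fin p) (Units.mk0 X hX1))
      rwa [inv_div, div_mul_cancel] at this
    have e4 : (Pl.fin p).abs (4 : K) = (Pl.fin p).abs 2 ^ 2 := by rw [← map_pow]; norm_num
    have h2 := (Pl.fin p).abs.pos (two_ne_zero (α := K))
    have e : X ^ 2 - a = (-(4 * ρ) + 2 * (X - 1)) + (X - 1) ^ 2 := by rw [ha]; ring
    have h4ρ : (Pl.fin p).abs (-(4 * ρ)) ≤ (Pl.fin p).abs 2 ^ 2 := by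
      rw [(Pl.fin p).abs.map_neg, map_mul, e4]
      nlinarith [sq_nonneg ((Pl.fin p).abs (2 : K))]
    rcases le_or_gt ((Pl.fin p).abs (X - 1)) ((Pl.fin p).abs 2) with hle | hgt
    · refine ⟨2, le_antisymm ?_ (e4 ▸ h4)⟩
      rw [e]
      refine (fin_add p _ _).trans (max_le ((fin_add p _ _).trans (max_le h4ρ ?_)) ?_)
      · rw [map_mul, sq]; exact mul_le_mul_of_nonneg_left hle h2.le
      · rw [map_pow]; exact pow_le_pow_left₀ ((Pl.fin p).abs.nonneg _) hle 2
    · refine ⟨X - 1, ?_⟩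
      rw [e, fin_dom p, map_pow]
      refine (fin_add p _ _).trans_lt (max_lt (h4ρ.trans_lt ?_) ?_)
      · rw [map_pow]; exact pow_lt_pow_left₀ hgt h2.le two_ne_zero
      · rw [map_mul, map_pow, sq]; exact mul_lt_mul_of_pos_right hgt (h2.trans hgt)
  · refine ⟨X, ?_⟩
    rw [sub_eq_add_neg, add_comm, fin_dom p, map_pow]
    rw [(Pl.fin p).abs.map_neg, h1, map_pow]; nlinarith

lemma even_of_mem_Nm {a : Kˣ} {ρ : K} (hρ : (Pl.fin p).abs ρ ≤ 1) (ha : (a : K) = 1 + 4 * ρ)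
    (h1 : (Pl.fin p).abs (a : K) = 1) (hns : a ∉ Sq (.fin p)) {z : Kˣ} (h : z ∈ Nm a (.fin p)) :
    Even (od p z) := by
  obtain ⟨x, y, hxy⟩ := Nm_approx h one_pos
  have h0 : x ^ 2 - a * y ^ 2 ≠ 0 := fun h => by
    rw [h, zero_div, zero_sub, (Pl.fin p).abs.map_neg, map_one] at hxy
    exact lt_irrefl _ hxy
  have := od_of_close (p := p) (x := Units.mk0 _ h0 / z) (by
    rw [Units.val_div_eq_div_val]; exact hxy)
  have h2 := even_of_unram p hρ ha h1 hns (n := Units.mk0 _ h0) (x := x) (y := y) rfl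
  rw [od_div] at this
  rwa [show od p z = od p (Units.mk0 _ h0) by omega]

lemma int_approx {w : K} (hw : (Pl.fin p).abs w ≤ 1) : ∃ y : 𝓞 K, (Pl.fin p).abs (y - w) < 1 := by
  have h1 : p.valuation K w ≤ 1 := by
    have := (fin_le p (x := w) (y := 1)).1 (by simpa using hw)
    simpa using this
  obtain ⟨y, hy⟩ := p.exists_valuation_sub_lt_of_integer h1 (γ := 1)
  refine ⟨y, ?_⟩
  have := (fin_lt p (x := (y : K) - w) (y := 1)).2 (by simpa using hy)
  simpa using this

lemma mem_p_iff (y : 𝓞 K) : y ∈ p.asIdeal ↔ (Pl.fin p).abs (y : K) < 1 := by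
  have := fin_lt p (x := (y : K)) (y := 1)
  rw [map_one, map_one] at this
  rw [this]; exact (p.valuation_lt_one_iff_mem (K := K) y).symm

instance : Finite (𝓞 K ⧸ p.asIdeal) := Ideal.finiteQuotientOfFreeOfNeBot _ p.ne_bot

/-- unramified nonsquare unit -/
lemma exists_Δ : ∃ (Δ : Kˣ) (ρ : K), (Pl.fin p).abs ρ = 1 ∧ (Δ : K) = 1 + 4 * ρ ∧
    (Pl.fin p).abs (Δ : K) = 1 ∧ Δ ∉ Sq (.fin p) := by
  have hp := p.isPrime
  let f : 𝓞 K ⧸ p.asIdeal → 𝓞 K ⧸ p.asIdeal := fun y => y ^ 2 + y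
  have hf : ¬ Function.Injective f := fun h => by
    have := @h 0 (-1) (by simp [f])
    simp at this
  have hf' : ¬ Function.Surjective f := fun h => hf (Finite.injective_iff_surjective.2 h)
  simp only [Function.Surjective, not_forall, not_exists] at hf'
  obtain ⟨ρ', hρ'⟩ := hf'
  obtain ⟨ρ, rfl⟩ := Ideal.Quotient.mk_surjective ρ'
  have key : ∀ y : 𝓞 K, (Pl.fin p).abs ((y : K) ^ 2 + y - ρ) = 1 := fun y => by
    have e : algebraMap (𝓞 K) K (y ^ 2 + y - ρ) = (y : K) ^ 2 + y - ρ := by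
      rw [map_sub, map_add, map_pow]
    refine le_antisymm (e ▸ fin_int p (y ^ 2 + y - ρ)) ?_
    by_contra hc
    push Not at hc
    have h1 : y ^ 2 + y - ρ ∈ p.asIdeal := (mem_p_iff p _).2 (by rw [show ((y ^ 2 + y - ρ : 𝓞 K) : K) = _ from e]; exact hc)
    refine hρ' (Ideal.Quotient.mk _ y) ?_
    rw [← sub_eq_zero, ← Ideal.Quotient.eq_zero_iff_mem.2 h1, map_sub, map_add, map_pow]
  have key2 : ∀ w : K, (Pl.fin p).abs w ≤ 1 → 1 ≤ (Pl.fin p).abs (w ^ 2 + w - ρ) := fun w hw => by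
    obtain ⟨y, hy⟩ := int_approx p hw
    by_contra hc
    push Not at hc
    have e : (y : K) ^ 2 + y - ρ = ((y : K) - w) * (y + w + 1) + (w ^ 2 + w - ρ) := by ring
    have h1 := fin_add p (((y : K) - w) * (y + w + 1)) (w ^ 2 + w - ρ)
    rw [← e, key, map_mul] at h1
    have h2 : (Pl.fin p).abs ((y : K) + w + 1) ≤ 1 := (fin_add p _ _).trans (max_le
      ((fin_add p _ _).trans (max_le (fin_int p y) hw)) (by simp))
    rcases le_max_iff.1 h1 with h3 | h3
    · nlinarith [(Pl.fin p).abs.nonneg ((y : K) - w)]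
    · linarith
  have hρ1 : (Pl.fin p).abs (ρ : K) = 1 := by
    have : (Pl.fin p).abs ((algebraMap (𝓞 K) K 0) ^ 2 + algebraMap (𝓞 K) K 0 - ρ) = 1 := key 0
    rw [map_zero, zero_pow two_ne_zero, zero_add, zero_sub, (Pl.fin p).abs.map_neg] at this
    exact this
  have h2pos := (Pl.fin p).abs.pos (two_ne_zero (α := K))
  have h2le : (Pl.fin p).abs (2 : K) ≤ 1 := fin_two p
  have e4 : (Pl.fin p).abs (4 : K) = (Pl.fin p).abs 2 ^ 2 := by rw [← map_pow]; norm_num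
  have hΔ1 : (Pl.fin p).abs (1 + 4 * (ρ : K)) = 1 := by
    refine le_antisymm ((fin_add p _ _).trans (by
      rw [map_one, map_mul, hρ1, e4]; exact max_le le_rfl (by nlinarith))) ?_
    by_contra hc
    push Not at hc
    rcases lt_or_eq_of_le h2le with h2 | h2
    · rw [add_comm, fin_dom p, map_one] at hc
      · exact lt_irrefl _ hc
      · rw [map_mul, hρ1, e4, map_one]; nlinarith
    · have := key2 (-1 / 2) (by rw [map_div₀, (Pl.fin p).abs.map_neg, h2]; simp)
      rw [show (-1 / 2 : K) ^ 2 + -1 / 2 - ρ = -((1 + 4 * ρ) / 4) by ring,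
        (Pl.fin p).abs.map_neg, map_div₀, e4, h2] at this
      simp at this; linarith
  have hΔ0 : 1 + 4 * (ρ : K) ≠ 0 := fun h => by rw [h, map_zero] at hΔ1; exact zero_ne_one hΔ1
  refine ⟨Units.mk0 _ hΔ0, ρ, hρ1, rfl, hΔ1, fun hs => ?_⟩
  have h4pos : 0 < (Pl.fin p).abs (4 : K) := by rw [e4]; positivity
  obtain ⟨r, hr⟩ := Sq_approx hs h4pos
  have hr : (Pl.fin p).abs (r ^ 2 - (1 + 4 * ρ)) < (Pl.fin p).abs 4 := by
    rw [Units.val_mk0] at hr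
    have e : r ^ 2 / (1 + 4 * (ρ : K)) - 1 = (r ^ 2 - (1 + 4 * ρ)) / (1 + 4 * ρ) := by
      field_simp
    rwa [e, map_div₀, hΔ1, div_one] at hr
  have h5 : (Pl.fin p).abs ((r - 1) * (r + 1)) ≤ (Pl.fin p).abs 4 := by
    have e : (r - 1) * (r + 1) = (r ^ 2 - (1 + 4 * ρ)) + 4 * ρ := by ring
    rw [e]
    refine (fin_add p _ _).trans (max_le hr.le ?_)
    rw [map_mul, hρ1, mul_one]
  have h6 : (Pl.fin p).abs (r - 1) ≤ (Pl.fin p).abs 2 := by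
    by_contra hc
    push Not at hc
    have e : r + 1 = 2 + (r - 1) := by ring
    rw [map_mul, e, fin_dom p hc, e4] at h5
    nlinarith
  have h7 := key2 ((r - 1) / 2) (by rw [map_div₀]; exact div_le_one_of_le₀ h6 h2pos.le)
  rw [show ((r - 1) / 2) ^ 2 + (r - 1) / 2 - ρ = (r ^ 2 - (1 + 4 * ρ)) / 4 by ring, map_div₀,
    le_div_iff₀ h4pos, one_mul] at h7
  linarith
end fin
end HM

namespace HM
open NumberField IsDedekindDomain
variable {K : Type*} [Field K] [NumberField K]

lemma relIndex_le_of_fun {G : Type*} [CommGroup G] (A B : Subgroup G) {T : Type*} [Finite T]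
    (f : G → T) (h : ∀ x ∈ A, ∀ y ∈ A, f x = f y → x / y ∈ B) :
    B.relIndex A ≠ 0 ∧ B.relIndex A ≤ Nat.card T := by
  let g : A ⧸ B.subgroupOf A → T := fun q => f (Quotient.out q : A)
  have hg : Function.Injective g := fun q q' hq => by
    have := h _ (Quotient.out q : A).2 _ (Quotient.out q' : A).2 hq
    rw [← Quotient.out_eq q, ← Quotient.out_eq q']
    refine (QuotientGroup.eq.2 ?_).symm
    rw [Subgroup.mem_subgroupOf]
    rw [div_eq_mul_inv, mul_comm] at this
    exact this
  have : Finite (A ⧸ B.subgroupOf A) := Finite.of_injective g hg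
  exact ⟨Nat.card_pos.ne', Nat.card_le_card_of_injective g hg⟩

section fin
variable (p : HeightOneSpectrum (𝓞 K))

/-- the order of 2 -/
noncomputable abbrev e2 : ℤ := od p (Units.mk0 (2 : K) two_ne_zero)

lemma e2_nonneg : 0 ≤ e2 p := (od_nonneg_iff p _).2 (fin_two p)

lemma exists_nNm_fin {a : Kˣ} (ha : a ∉ Sq (.fin p)) : ∃ b, b ∉ Nm a (.fin p) := by
  by_contra hc
  push Not at hc
  obtain ⟨Δ, ρ, hρ, hΔ, hΔ1, hΔs⟩ := exists_Δ p
  obtain ⟨π, hπ⟩ := exists_od_one p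
  have hπ1 : (Pl.fin p).abs (π : K) < 1 := by
    have := (od_lt_iff p π 1).2 (by rw [od_one, hπ]; exact one_pos)
    simpa using this
  have hev : Even (od p a) := even_of_mem_Nm p hρ.le hΔ hΔ1 hΔs (Nm_symm (hc Δ))
  obtain ⟨m, hm⟩ := hev
  let four : Kˣ := Units.mk0 (4 : K) (by norm_num)
  have o4 : od p four = 2 * e2 p := by
    have : four = (Units.mk0 (2 : K) two_ne_zero) ^ 2 := by
      ext; simp only [four, Units.val_mk0, Units.val_pow_eq_pow_val]; norm_num
    rw [this, od_pow]; rfl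
  let P : ℤ → Prop := fun d => ∃ r c : Kˣ, ((a / r ^ 2 : Kˣ) : K) = 1 + c ∧ od p c = d ∧
    od p (a / r ^ 2) = 0
  have hsqr : ∀ r : Kˣ, a / r ^ 2 ∉ Sq (.fin p) := fun r h => ha (by
    have := mul_mem h (sq_mem_Sq (.fin p) r)
    rwa [div_mul_cancel] at this)
  have hb : ∀ d, P d → d ≤ od p four := by
    rintro d ⟨r, c, h1, rfl, -⟩
    by_contra hlt
    push Not at hlt
    refine hsqr r (sq_sharp p ?_)
    rw [h1, add_sub_cancel_left]; exact (od_lt_iff p c four).2 hlt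
  have hcr : ∀ r : Kˣ, ∃ c : Kˣ, ((a / r ^ 2 : Kˣ) : K) = 1 + c := fun r => by
    have h0 : ((a / r ^ 2 : Kˣ) : K) - 1 ≠ 0 := fun h => hsqr r (by
      have : a / r ^ 2 = 1 := Units.ext (by simpa using sub_eq_zero.1 h)
      rw [this]; exact one_mem _)
    exact ⟨Units.mk0 _ h0, by simp⟩
  obtain ⟨d, ⟨r, c, hac, hd, ho⟩, hmax⟩ := Int.exists_greatest_of_bdd (P := P) ⟨_, hb⟩ (by
    obtain ⟨c, hc⟩ := hcr (π ^ m)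
    exact ⟨_, π ^ m, c, hc, rfl, by rw [od_div, od_pow, od_zpow, hπ, hm]; push_cast; ring⟩)
  set a' := a / r ^ 2 with ha'
  have hN : ∀ b, b ∈ Nm a' (.fin p) := fun b => by
    rw [Nm_congr (a := a') (b := a)]
    · exact hc b
    · rw [ha', div_div, mul_comm, ← div_div, div_self', one_div]
      exact inv_mem (sq_mem_Sq _ r)
  have ha1 : (Pl.fin p).abs (a' : K) = 1 := (od_eq_zero_iff p a').1 ho
  have hd0 : 0 ≤ d := by
    rw [← hd, od_nonneg_iff]
    have e : (c : K) = a' - 1 := by rw [hac]; ring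
    rw [e]; exact (fin_sub p _ _).trans (by simp [ha1])
  have hdle := hb d ⟨r, c, hac, hd, ho⟩
  rcases lt_or_eq_of_le hdle with hlt | heq
  swap
  · have hc4 : (Pl.fin p).abs (c : K) = (Pl.fin p).abs 4 :=
      (od_eq_iff p c four).2 (by rw [hd, heq])
    have h4 : (Pl.fin p).abs (4 : K) ≠ 0 := (Pl.fin p).abs.ne_zero (by norm_num)
    have := even_of_mem_Nm p (a := a') (ρ := c / 4) (by rw [map_div₀, hc4, div_self h4])
      (by rw [hac]; field_simp) ha1 (hsqr r) (hN π)
    rw [hπ] at this; exact absurd this (by decide)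
  rcases Int.even_or_odd d with ⟨k, hk⟩ | hodd
  · -- improve the approximation
    have hk0 : 0 ≤ k := by omega
    have hke : k < e2 p := by omega
    have h2lt : (Pl.fin p).abs (2 : K) < 1 := by
      have := (od_lt_iff p (Units.mk0 (2 : K) two_ne_zero) 1).2 (by
        rw [od_one]; exact lt_of_le_of_lt hk0 hke)
      simpa using this
    have hp := p.isPrime
    have h2 : (2 : 𝓞 K ⧸ p.asIdeal) = 0 := by
      have : (2 : 𝓞 K) ∈ p.asIdeal := (mem_p_iff p 2).2 (by
        have : (Pl.fin p).abs (algebraMap (𝓞 K) K 2) < 1 := by rw [map_ofNat]; exact h2lt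
        exact this)
      exact (map_ofNat (Ideal.Quotient.mk p.asIdeal) 2).symm.trans
        (Ideal.Quotient.eq_zero_iff_mem.2 this)
    have hinj : Function.Injective fun x : 𝓞 K ⧸ p.asIdeal => x ^ 2 := fun x y h => by
      have h : x ^ 2 = y ^ 2 := h
      have : (x - y) ^ 2 = 0 := by linear_combination h + (y ^ 2 - x * y) * h2
      exact sub_eq_zero.1 (pow_eq_zero_iff two_ne_zero |>.1 this)
    have hsurj := Finite.surjective_of_injective hinj
    let u : Kˣ := c / (π ^ k) ^ 2
    have hu : (Pl.fin p).abs (u : K) = 1 := (od_eq_zero_iff p u).1 (by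
      rw [od_div, od_pow, od_zpow, hd, hπ, hk]; push_cast; ring)
    obtain ⟨y, hy⟩ := int_approx p hu.le
    obtain ⟨s', hs'⟩ := hsurj (Ideal.Quotient.mk _ y)
    obtain ⟨s, rfl⟩ := Ideal.Quotient.mk_surjective s'
    have hs : (Pl.fin p).abs ((s : K) ^ 2 - y) < 1 := by
      have h1 : s ^ 2 - y ∈ p.asIdeal := by
        rw [← Ideal.Quotient.eq_zero_iff_mem, map_sub, map_pow, sub_eq_zero]; exact hs'
      have h1 : (Pl.fin p).abs (algebraMap (𝓞 K) K (s ^ 2 - y)) < 1 := (mem_p_iff p _).1 h1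
      rwa [map_sub, map_pow] at h1
    have hsu : (Pl.fin p).abs ((s : K) ^ 2 - u) < 1 := by
      have e : (s : K) ^ 2 - u = (s ^ 2 - y) + (y - u) := by ring
      rw [e]; exact (fin_add p _ _).trans_lt (max_lt hs hy)
    set q : K := 1 + s * (π ^ k : Kˣ) with hq
    have hcu : (c : K) = u * ((π ^ k : Kˣ) : K) ^ 2 := by
      simp only [u]
      rw [← Units.val_pow_eq_pow_val, ← Units.val_mul, div_mul_cancel]
    have hcpos := (Pl.fin p).abs.pos c.ne_zero
    have hcabs : (Pl.fin p).abs (c : K) = (Pl.fin p).abs ((π ^ k : Kˣ) : K) ^ 2 := by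
      rw [hcu, map_mul, hu, one_mul, map_pow]
    have hπk := (Pl.fin p).abs.pos (π ^ k : Kˣ).ne_zero
    have h2k : (Pl.fin p).abs (2 : K) < (Pl.fin p).abs ((π ^ k : Kˣ) : K) :=
      (od_lt_iff p (Units.mk0 (2 : K) two_ne_zero) (π ^ k)).2 (by
        rw [od_zpow, hπ, mul_one]; exact hke)
    have hqa : (Pl.fin p).abs (-(q ^ 2 - a')) < (Pl.fin p).abs (c : K) := by
      have e : q ^ 2 - a' = 2 * (s * (π ^ k : Kˣ)) + (s ^ 2 - u) * ((π ^ k : Kˣ) : K) ^ 2 := by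
        rw [hac, hcu, hq]; ring
      rw [(Pl.fin p).abs.map_neg, e]
      refine (fin_add p _ _).trans_lt (max_lt ?_ ?_)
      · rw [map_mul, map_mul, hcabs, sq]
        have := fin_int p s
        have h2p : 0 ≤ (Pl.fin p).abs (2 : K) := (Pl.fin p).abs.nonneg _
        refine lt_of_le_of_lt ?_ (mul_lt_mul_of_pos_right h2k hπk)
        exact mul_le_mul_of_nonneg_left (mul_le_of_le_one_left hπk.le this) h2p
      · rw [map_mul, map_pow, hcabs]
        nlinarith [pow_pos hπk 2]
    have hc1 : (Pl.fin p).abs (c : K) ≤ 1 := (od_nonneg_iff p c).1 (hd.symm ▸ hd0)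
    have hq1 : (Pl.fin p).abs (q ^ 2) = 1 := by
      have e : q ^ 2 = (q ^ 2 - a') + a' := by ring
      rw [e, fin_dom p, ha1]
      rw [ha1, ← (Pl.fin p).abs.map_neg]; exact hqa.trans_le hc1
    have hq0 : q ≠ 0 := fun h => by rw [h] at hq1; simp at hq1
    obtain ⟨c', hc'⟩ := hcr (r * Units.mk0 q hq0)
    have e1 : a / (r * Units.mk0 q hq0) ^ 2 = a' / (Units.mk0 q hq0) ^ 2 := by
      rw [ha', mul_pow, div_div]
    have hlt' : od p c < od p c' := by
      rw [← od_lt_iff]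
      have : (c' : K) = -(q ^ 2 - a') / q ^ 2 := by
        rw [e1, Units.val_div_eq_div_val, Units.val_pow_eq_pow_val, Units.val_mk0] at hc'
        have : (c' : K) = a' / q ^ 2 - 1 := by rw [hc']; ring
        rw [this]; field_simp; ring
      rw [this, map_div₀, hq1, div_one]; exact hqa
    have := hmax _ ⟨r * Units.mk0 q hq0, c', hc', rfl, by
      rw [e1, od_div, ho]
      have := (od_eq_zero_iff p (Units.mk0 q hq0 ^ 2)).2 (by simpa using hq1)
      omega⟩
    omega
  · set t : K := -(4 * ρ) / c with ht
    have hc0 : (c : K) ≠ 0 := c.ne_zero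
    have ht1 : (Pl.fin p).abs t < 1 := by
      rw [ht, map_div₀, (Pl.fin p).abs.map_neg, map_mul, hρ, mul_one,
        div_lt_one ((Pl.fin p).abs.pos hc0)]
      exact (od_lt_iff p four c).2 (by rw [hd]; exact hlt)
    have h1t : (Pl.fin p).abs (t + 1) = 1 := by rw [fin_dom p, map_one]; rwa [map_one]
    have h1t0 : t + 1 ≠ 0 := fun h => by rw [h, map_zero] at h1t; exact zero_ne_one h1t
    let z : Kˣ := -(c * Units.mk0 _ h1t0) / Δ
    have hz : (z : K) = -(c * (t + 1)) / Δ := by simp [z, Units.val_div_eq_div_val]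
    have hab : (a' : K) + -(c * (t + 1)) = Δ := by rw [hac, hΔ, ht]; field_simp; ring
    have hoz : od p z = d := by
      have h1 := (od_eq_zero_iff p (Units.mk0 _ h1t0)).2 h1t
      have h2 := (od_eq_zero_iff p Δ).2 hΔ1
      rw [od_div, od_neg, od_mul, h1, h2, hd]; ring
    have h1 : z ∈ Nm (a' / Δ) (.fin p) := NF_le_Nm _ _ ⟨1, 1, by
      rw [hz, Units.val_div_eq_div_val]
      have := Δ.ne_zero
      field_simp; linear_combination -hab⟩
    have h2 : Δ ∈ Nm z (.fin p) := by
      have := div_mem (Nm_symm (hN z)) (Nm_symm h1)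
      rwa [div_div_cancel] at this
    have := even_of_mem_Nm p hρ.le hΔ hΔ1 hΔs (Nm_symm h2)
    rw [hoz] at this
    exact Int.not_even_iff_odd.2 hodd this
end fin
end HM

namespace HM
open NumberField IsDedekindDomain
variable {K : Type*} [Field K] [NumberField K]

lemma Sq_complex {v : InfinitePlace K} (hv : v.IsComplex) (a : Kˣ) : a ∈ Sq (.inf v) := by
  have e : (Pl.inf v).C ≃+* ℂ := (InfinitePlace.Completion.equiv v).symm.trans
    (InfinitePlace.Completion.ringEquivComplexOfIsComplex hv)
  obtain ⟨r, hr⟩ := IsAlgClosed.exists_eq_mul_self (e (algebraMap K _ a))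
  exact ⟨e.symm r, e.injective (by rw [map_mul, e.apply_symm_apply]; exact hr)⟩

lemma exists_realEquiv {v : InfinitePlace K} (hv : v.IsReal) : ∃ e : (Pl.inf v).C ≃+* ℝ,
    ∀ x : K, e (algebraMap K _ x) = InfinitePlace.embedding_of_isReal hv x :=
  ⟨(InfinitePlace.Completion.equiv v).symm.trans
    (InfinitePlace.Completion.ringEquivRealOfIsReal hv), fun x =>
    InfinitePlace.Completion.extensionEmbeddingOfIsReal_coe hv (WithAbs.toAbs v.1 x)⟩

lemma mem_Sq_real {v : InfinitePlace K} (hv : v.IsReal) (a : Kˣ) :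
    a ∈ Sq (.inf v) ↔ 0 < InfinitePlace.embedding_of_isReal hv a := by
  obtain ⟨e, he⟩ := exists_realEquiv hv
  have h0 : InfinitePlace.embedding_of_isReal hv (a : K) ≠ 0 := by simp
  rw [mem_Sq, ← he]
  rw [← he] at h0
  constructor
  · rintro ⟨r, hr⟩
    rw [hr, map_mul] at h0 ⊢
    exact lt_of_le_of_ne (mul_self_nonneg _) h0.symm
  · intro h
    exact ⟨e.symm (Real.sqrt (e (algebraMap K _ a))), e.injective (by
      rw [map_mul, e.apply_symm_apply, Real.mul_self_sqrt h.le])⟩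

lemma neg_one_nNm {v : InfinitePlace K} {a : Kˣ} (ha : a ∉ Sq (.inf v)) : -1 ∉ Nm a (.inf v) := by
  rcases v.isReal_or_isComplex with hv | hv
  swap
  · exact absurd (Sq_complex hv a) ha
  rintro ⟨x, y, h⟩
  rw [mem_Sq_real hv] at ha
  obtain ⟨e, he⟩ := exists_realEquiv hv
  have h2 : e (algebraMap K _ (((-1 : Kˣ) : Kˣ) : K)) = -1 := by rw [he]; simp
  have h1 := he (a : K)
  have h3 : e (x ^ 2 - algebraMap K _ (a : K) * y ^ 2) = -1 := by rw [← h2]; exact congrArg e h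
  rw [map_sub, map_mul, map_pow, map_pow, h1] at h3
  nlinarith [sq_nonneg (e x), mul_nonneg (neg_nonneg.2 (not_lt.1 ha)) (sq_nonneg (e y))]

lemma exists_nNm {v : Pl K} {a : Kˣ} (ha : a ∉ Sq v) : ∃ b, b ∉ Nm a v := by
  cases v with
  | fin p => exact exists_nNm_fin p ha
  | inf v => exact ⟨-1, neg_one_nNm ha⟩

open Classical in
lemma index_Sq_inf (v : InfinitePlace K) : (Sq (.inf v)).index ≠ 0 ∧
    (Sq (.inf v)).index * 2 ^ v.mult ≤ 4 := by
  rcases v.isReal_or_isComplex with hv | hv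
  swap
  · have : Sq (.inf v) = ⊤ := by ext a; simp [Sq_complex hv a]
    rw [this, InfinitePlace.mult, if_neg (InfinitePlace.not_isReal_iff_isComplex.2 hv)]; simp
  have := relIndex_le_of_fun ⊤ (Sq (.inf v))
    (fun x : Kˣ => decide (0 < InfinitePlace.embedding_of_isReal hv x)) (fun x _ y _ h => by
      rw [mem_Sq_real hv, Units.val_div_eq_div_val, map_div₀]
      have hx : InfinitePlace.embedding_of_isReal hv (x : K) ≠ 0 := by simp
      have hy : InfinitePlace.embedding_of_isReal hv (y : K) ≠ 0 := by simp
      simp only [decide_eq_decide] at h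
      rcases hx.lt_or_gt with h1 | h1
      · have : ¬ 0 < InfinitePlace.embedding_of_isReal hv (y : K) := by rw [← h]; exact h1.not_gt
        exact div_pos_of_neg_of_neg h1 (lt_of_le_of_ne (not_lt.1 this) hy)
      · exact div_pos h1 (h.1 h1))
  rw [Subgroup.relIndex_top_right] at this
  rw [InfinitePlace.mult, if_pos hv]
  have h2 : Nat.card Bool = 2 := by simp
  rw [h2] at this
  exact ⟨this.1, by omega⟩

section fin
variable (p : HeightOneSpectrum (𝓞 K))

/-- higher unit groups -/
noncomputable def Wu (π : Kˣ) (_hπ : od p π = 1) (i : ℕ) : Subgroup Kˣ where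
  carrier := {x | (Pl.fin p).abs (x : K) = 1 ∧ (Pl.fin p).abs ((x : K) - 1) ≤ (Pl.fin p).abs ((π ^ i : Kˣ) : K)}
  one_mem' := by simp
  mul_mem' := by
    rintro x y ⟨hx, hx'⟩ ⟨hy, hy'⟩
    refine ⟨by simp [hx, hy], ?_⟩
    have e : ((x * y : Kˣ) : K) - 1 = x * (y - 1) + (x - 1) := by push_cast; ring
    rw [e]
    exact (fin_add p _ _).trans (max_le (by rwa [map_mul, hx, one_mul]) hx')
  inv_mem' := by
    rintro x ⟨hx, hx'⟩
    refine ⟨by simp [hx], ?_⟩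
    have e : ((x⁻¹ : Kˣ) : K) - 1 = -(x - 1) / x := by
      rw [Units.val_inv_eq_inv_val]; field_simp; ring
    rw [e, map_div₀, hx, div_one, (Pl.fin p).abs.map_neg]; exact hx'

variable {p} {π : Kˣ} (hπ : od p π = 1)

lemma mem_Wu {i : ℕ} {x : Kˣ} : x ∈ Wu p π hπ i ↔ (Pl.fin p).abs (x : K) = 1 ∧
  (Pl.fin p).abs ((x : K) - 1) ≤ (Pl.fin p).abs ((π ^ i : Kˣ) : K) := Iff.rfl

include hπ in
lemma abs_disc {z : K} {i : ℕ} (h : (Pl.fin p).abs z < (Pl.fin p).abs ((π ^ i : Kˣ) : K)) :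
    (Pl.fin p).abs z ≤ (Pl.fin p).abs ((π ^ (i + 1) : Kˣ) : K) := by
  by_cases hz : z = 0
  · rw [hz, map_zero]; exact (Pl.fin p).abs.nonneg _
  have h1 := (od_lt_iff p (Units.mk0 z hz) (π ^ i)).1 h
  refine (od_le_iff p (Units.mk0 z hz) (π ^ (i + 1))).2 ?_
  rw [od_pow, hπ] at *; omega

lemma Wu_anti {i j : ℕ} (h : i ≤ j) : Wu p π hπ j ≤ Wu p π hπ i := fun x hx =>
  ⟨hx.1, hx.2.trans ((od_le_iff p (π ^ j) (π ^ i)).2 (by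
    rw [od_pow, od_pow, hπ]; push_cast; omega))⟩

lemma Wu_step (i : ℕ) : (Wu p π hπ (i + 1)).relIndex (Wu p π hπ i) ≠ 0 ∧
    (Wu p π hπ (i + 1)).relIndex (Wu p π hπ i) ≤ Nat.card (𝓞 K ⧸ p.asIdeal) := by
  have : ∀ x : Kˣ, ∃ y : 𝓞 K, x ∈ Wu p π hπ i →
      (Pl.fin p).abs (y - ((x : K) - 1) / ((π ^ i : Kˣ) : K)) < 1 := fun x => by
    by_cases hx : x ∈ Wu p π hπ i
    · obtain ⟨y, hy⟩ := int_approx p (w := ((x : K) - 1) / ((π ^ i : Kˣ) : K)) (by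
        rw [map_div₀]; exact div_le_one_of_le₀ hx.2 ((Pl.fin p).abs.nonneg _))
      exact ⟨y, fun _ => hy⟩
    · exact ⟨0, fun h => absurd h hx⟩
  choose f hf using this
  refine relIndex_le_of_fun _ _ (fun x => Ideal.Quotient.mk p.asIdeal (f x)) fun x hx y hy h => ?_
  have h1 : (Pl.fin p).abs (algebraMap (𝓞 K) K (f x - f y)) < 1 :=
    (mem_p_iff p _).1 (by rw [← Ideal.Quotient.eq_zero_iff_mem, map_sub, sub_eq_zero]; exact h)
  rw [map_sub] at h1
  have hpi : (0 : ℝ) < (Pl.fin p).abs ((π ^ i : Kˣ) : K) := (Pl.fin p).abs.pos (Units.ne_zero _)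
  have h2 : (Pl.fin p).abs (((x : K) - y) / ((π ^ i : Kˣ) : K)) < 1 := by
    have e : ((x : K) - y) / ((π ^ i : Kˣ) : K) = ((f x : K) - f y) -
      ((f x - ((x : K) - 1) / ((π ^ i : Kˣ) : K)) - (f y - ((y : K) - 1) / ((π ^ i : Kˣ) : K))) := by
      have := (π ^ i).ne_zero
      field_simp; ring
    rw [e]
    exact (fin_sub p _ _).trans_lt (max_lt h1 ((fin_sub p _ _).trans_lt (max_lt (hf x hx) (hf y hy))))
  rw [map_div₀, div_lt_one hpi] at h2
  refine ⟨by rw [Units.val_div_eq_div_val, map_div₀, hx.1, hy.1, div_one], ?_⟩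
  have e : ((x / y : Kˣ) : K) - 1 = (x - y) / y := by
    rw [Units.val_div_eq_div_val]; have := y.ne_zero; field_simp
  rw [e, map_div₀, hy.1, div_one]
  exact abs_disc hπ h2

lemma Wu_steps (i j : ℕ) : (Wu p π hπ (i + j)).relIndex (Wu p π hπ i) ≠ 0 ∧
    (Wu p π hπ (i + j)).relIndex (Wu p π hπ i) ≤ Nat.card (𝓞 K ⧸ p.asIdeal) ^ j := by
  induction j with
  | zero => simp
  | succ j ih =>
    have h := Wu_step hπ (i + j)
    have := Subgroup.relIndex_mul_relIndex _ _ _ (Wu_anti hπ (Nat.le_succ (i + j)))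
      (Wu_anti hπ (Nat.le_add_right i j))
    rw [← add_assoc, ← Nat.succ_eq_add_one, ← this, pow_succ, mul_comm]
    exact ⟨mul_ne_zero ih.1 h.1, Nat.mul_le_mul ih.2 h.2⟩

include hπ in
lemma relIndex_Sq_units : ∃ U : Subgroup Kˣ, (∀ x, x ∈ U ↔ od p x = 0) ∧
    (Sq (.fin p)).relIndex U ≠ 0 ∧
    (Sq (.fin p)).relIndex U ≤ 2 * Nat.card (𝓞 K ⧸ p.asIdeal) ^ (e2 p).toNat := by
  set e := (e2 p).toNat with he
  have hee : (e : ℤ) = e2 p := Int.toNat_of_nonneg (e2_nonneg p)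
  have h2 : (Pl.fin p).abs (2 : K) = (Pl.fin p).abs ((π ^ e : Kˣ) : K) :=
    (od_eq_iff p (Units.mk0 (2 : K) two_ne_zero) (π ^ e)).2 (by
      rw [od_pow, hπ, mul_one, hee])
  set V := Wu p π hπ (2 * e + 1) with hV
  set U := Wu p π hπ 0 with hU
  have hmU : ∀ x, x ∈ U ↔ od p x = 0 := fun x => by
    rw [hU, mem_Wu, od_eq_zero_iff, and_iff_left_iff_imp]
    intro hx
    refine (fin_sub p _ _).trans ?_
    simp [hx]
  let s : Kˣ →* Kˣ := powMonoidHom 2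
  have hs : ∀ x, s x = x ^ 2 := fun x => rfl
  set Y := V.comap s with hY
  set Z := U.map s ⊔ V with hZ
  have hVU : V ≤ U := Wu_anti hπ (Nat.zero_le _)
  have hVY : V ≤ Y := fun x hx => pow_mem hx 2
  have hYU : Y ≤ U := fun x hx => by
    have := hVU hx
    rw [hmU, hs, od_pow] at this
    rw [hmU]; push_cast at this; omega
  have hZU : Z ≤ U := sup_le (by
    rintro _ ⟨x, hx, rfl⟩; exact pow_mem hx 2) hVU
  have hVS : V ≤ Sq (.fin p) := fun x hx => sq_sharp p (hx.2.trans_lt (by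
    have : (4 : K) = 2 * 2 := by norm_num
    rw [this, map_mul, h2, ← map_mul, ← Units.val_mul, od_lt_iff, od_mul, od_pow, od_pow, hπ]
    push_cast; omega))
  have hZS : Z ≤ Sq (.fin p) := sup_le (by
    rintro _ ⟨x, hx, rfl⟩; exact sq_mem_Sq _ x) hVS
  have hVUi : V.relIndex U ≠ 0 := by
    have := (Wu_steps hπ 0 (2 * e + 1)).1
    rwa [zero_add] at this
  have i1 : Y.relIndex U = V.relIndex Z := by
    rw [hY, Subgroup.relIndex_comap, hZ, Subgroup.relIndex_sup_right]
  have i2 := Subgroup.relIndex_mul_relIndex _ _ _ hVY hYU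
  have i3 := Subgroup.relIndex_mul_relIndex _ _ _ (le_sup_right : V ≤ Z) hZU
  have i4 : Z.relIndex U = V.relIndex Y := by
    rw [← i3, i1, mul_comm] at i2
    rw [← i3] at hVUi
    exact (Nat.eq_of_mul_eq_mul_left (Nat.pos_of_ne_zero (left_ne_zero_of_mul hVUi)) i2).symm
  have key : ∀ x ∈ Y, x ∈ Wu p π hπ (e + 1) ∨ -x ∈ Wu p π hπ (e + 1) := fun x hx => by
    have h1 : (Pl.fin p).abs (x : K) = 1 := (hYU hx).1
    have h3 : (Pl.fin p).abs ((x : K) - 1) * (Pl.fin p).abs ((x : K) + 1) <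
        (Pl.fin p).abs ((π ^ e : Kˣ) : K) * (Pl.fin p).abs ((π ^ e : Kˣ) : K) := by
      have h := hx.2
      rw [hs] at h
      have e1 : ((x ^ 2 : Kˣ) : K) - 1 = (x - 1) * (x + 1) := by push_cast; ring
      rw [e1, map_mul] at h
      refine h.trans_lt ?_
      rw [← map_mul, ← Units.val_mul, od_lt_iff, od_mul, od_pow, od_pow, hπ]
      push_cast; omega
    by_cases hc : (Pl.fin p).abs ((x : K) - 1) < (Pl.fin p).abs ((π ^ e : Kˣ) : K)
    · exact Or.inl ⟨h1, abs_disc hπ hc⟩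
    · have hc' : (Pl.fin p).abs ((x : K) + 1) < (Pl.fin p).abs ((π ^ e : Kˣ) : K) := by
        by_contra hc'
        exact h3.not_ge (mul_le_mul (not_lt.1 hc) (not_lt.1 hc') ((Pl.fin p).abs.nonneg _)
          ((Pl.fin p).abs.nonneg _))
      refine Or.inr ⟨by simpa using h1, abs_disc hπ ?_⟩
      have e1 : ((-x : Kˣ) : K) - 1 = -(x + 1) := by push_cast; ring
      rw [e1, (Pl.fin p).abs.map_neg]; exact hc'
  classical
  have j1 := relIndex_le_of_fun Y (Wu p π hπ (e + 1))
    (fun x => decide (x ∈ Wu p π hπ (e + 1))) (fun x hx y hy h => by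
      simp only [decide_eq_decide] at h
      rcases key x hx with h1 | h1
      · exact div_mem h1 (h.1 h1)
      · rcases key y hy with h4 | h4
        · exact div_mem (h.2 h4) h4
        · have := div_mem h1 h4; rwa [neg_div_neg_eq] at this)
  have j2 := Wu_steps hπ (e + 1) e
  have j3 : V.relIndex Y ≤ V.relIndex (Wu p π hπ (e + 1)) * (Wu p π hπ (e + 1)).relIndex Y := by
    have hle : V.relIndex (Wu p π hπ (e + 1) ⊓ Y) ≤ V.relIndex (Wu p π hπ (e + 1)) :=
      Subgroup.relIndex_le_of_le_right inf_le_left (by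
        rw [hV, show 2 * e + 1 = e + 1 + e by ring]; exact j2.1)
    have := Subgroup.relIndex_inf_mul_relIndex V (Wu p π hπ (e + 1)) Y
    rw [inf_eq_left.2 (Wu_anti hπ (by omega))] at this
    rw [← this]
    exact Nat.mul_le_mul_right _ hle
  have hfin : Z.relIndex U ≠ 0 := by rw [← i3] at hVUi; exact right_ne_zero_of_mul hVUi
  refine ⟨U, hmU, mt (Subgroup.relIndex_eq_zero_of_le_left hZS) hfin, ?_⟩
  refine (Subgroup.relIndex_le_of_le_left hZS hfin).trans ?_
  rw [i4]
  refine j3.trans ?_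
  rw [hV, show 2 * e + 1 = e + 1 + e by ring, mul_comm]
  exact Nat.mul_le_mul (by simpa using j1.2) j2.2

end fin
end HM

namespace HM
open NumberField IsDedekindDomain
variable {K : Type*} [Field K] [NumberField K]

lemma div_mem_of_index_le_two {G : Type*} [CommGroup G] {A B : Subgroup G} (h0 : B.relIndex A ≠ 0)
    (h : B.relIndex A ≤ 2) {x y : G} (hx : x ∈ A) (hy : y ∈ A) (hx' : x ∉ B) (hy' : y ∉ B) :
    x / y ∈ B := by
  have h2 : (B.subgroupOf A).index = 1 ∨ (B.subgroupOf A).index = 2 := by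
    have h0 : (B.subgroupOf A).index ≠ 0 := h0
    have h : (B.subgroupOf A).index ≤ 2 := h
    omega
  rcases h2 with h2 | h2
  · rw [Subgroup.index_eq_one] at h2
    have : (⟨x, hx⟩ : A) ∈ B.subgroupOf A := by rw [h2]; trivial
    exact absurd this hx'
  · have := Subgroup.mul_mem_iff_of_index_two h2 (a := ⟨x, hx⟩) (b := (⟨y, hy⟩ : A)⁻¹)
    have h3 : (⟨x, hx⟩ : A) * (⟨y, hy⟩ : A)⁻¹ ∈ B.subgroupOf A := by
      rw [this]
      constructor
      · intro h; exact absurd h hx'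
      · intro h; rw [inv_mem_iff] at h; exact absurd h hy'
    rw [div_eq_mul_inv]; exact h3

section fin
variable (p : HeightOneSpectrum (𝓞 K))

/-- two non-square units have square ratio at odd primes -/
lemma unit_ratio (h2 : e2 p = 0) {x y : Kˣ} (hx : od p x = 0) (hy : od p y = 0)
    (hx' : x ∉ Sq (.fin p)) (hy' : y ∉ Sq (.fin p)) : x / y ∈ Sq (.fin p) := by
  obtain ⟨π, hπ⟩ := exists_od_one p
  obtain ⟨U, hU, h0, h⟩ := relIndex_Sq_units hπ
  rw [h2] at h
  exact div_mem_of_index_le_two h0 (by simpa using h) ((hU x).2 hx) ((hU y).2 hy) hx' hy'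

lemma abs_two : (Pl.fin p).abs (2 : K) * (Nat.card (𝓞 K ⧸ p.asIdeal) : ℝ) ^ (e2 p).toNat = 1 := by
  have h := val_od p (Units.mk0 (2 : K) two_ne_zero)
  have hne : WithZero.exp (-od p (Units.mk0 (2 : K) two_ne_zero)) ≠ 0 := WithZero.exp_ne_zero
  rw [fin_abs]
  rw [Units.val_mk0] at h
  rw [h, WithZeroMulInt.toNNReal_neg_apply _ hne]
  have hN : ((Ideal.absNorm p.asIdeal : NNReal) : ℝ) ≠ 0 :=
    NNReal.coe_ne_zero.2 (HeightOneSpectrum.absNorm_ne_zero p)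
  have e : (Nat.card (𝓞 K ⧸ p.asIdeal) : ℝ) = ((Ideal.absNorm p.asIdeal : NNReal) : ℝ) := by
    rw [Ideal.absNorm_apply, Submodule.cardQuot_apply]; simp
  rw [e, NNReal.coe_zpow, ← zpow_natCast, ← zpow_add₀ hN, Int.toNat_of_nonneg (e2_nonneg p)]
  have : (WithZero.unzero hne).toAdd = - e2 p := rfl
  rw [this, neg_add_cancel, zpow_zero]

open Classical in
lemma index_Sq_fin : (Sq (.fin p)).index ≠ 0 ∧
    ((Sq (.fin p)).index : ℝ) * (Pl.fin p).abs (2 : K) ≤ 4 := by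
  obtain ⟨π, hπ⟩ := exists_od_one p
  obtain ⟨U, hU, h0, h⟩ := relIndex_Sq_units hπ
  have h1 := relIndex_le_of_fun ⊤ (U ⊔ Sq (.fin p)) (fun x : Kˣ => decide (Even (od p x)))
    (fun x _ y _ hxy => by
      simp only [decide_eq_decide] at hxy
      have : Even (od p (x / y)) := by rw [od_div, Int.even_sub]; exact hxy
      obtain ⟨m, hm⟩ := this
      have e : x / y = (x / y / (π ^ m) ^ 2) * (π ^ m) ^ 2 := by rw [div_mul_cancel]
      rw [e]
      refine Subgroup.mul_mem_sup ((hU _).2 ?_) (sq_mem_Sq _ _)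
      rw [od_div, od_pow, od_zpow, hm, hπ]; push_cast; ring)
  rw [Subgroup.relIndex_top_right] at h1
  have hb : Nat.card Bool = 2 := by simp
  rw [hb] at h1
  have h2 := Subgroup.relIndex_mul_index (le_sup_right : Sq (.fin p) ≤ U ⊔ Sq (.fin p))
  rw [Subgroup.relIndex_sup_right] at h2
  rw [← h2]
  refine ⟨mul_ne_zero h0 h1.1, ?_⟩
  have h3 : (Sq (.fin p)).relIndex U * (U ⊔ Sq (.fin p)).index ≤
    (2 * Nat.card (𝓞 K ⧸ p.asIdeal) ^ (e2 p).toNat) * 2 := Nat.mul_le_mul h h1.2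
  have h4 := abs_two p
  have h5 := (Pl.fin p).abs.nonneg (2 : K)
  have h3' : (((Sq (.fin p)).relIndex U * (U ⊔ Sq (.fin p)).index : ℕ) : ℝ) ≤
    (2 * (Nat.card (𝓞 K ⧸ p.asIdeal) : ℝ) ^ (e2 p).toNat) * 2 := by exact_mod_cast h3
  calc _ ≤ (2 * (Nat.card (𝓞 K ⧸ p.asIdeal) : ℝ) ^ (e2 p).toNat) * 2 * (Pl.fin p).abs (2 : K) :=
        mul_le_mul_of_nonneg_right h3' h5
    _ = 4 := by linear_combination 4 * h4

lemma exists_two_ns (D₁ D₂ : Kˣ) : ∃ c : Kˣ, c * D₁ ∉ Sq (.fin p) ∧ c * D₂ ∉ Sq (.fin p) := by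
  obtain ⟨π, hπ⟩ := exists_od_one p
  obtain ⟨Δ, ρ, hρ, hΔ, hΔ1, hΔs⟩ := exists_Δ p
  have hev : ∀ {x}, x ∈ Sq (.fin p) → Even (od p x) := fun {x} hx =>
    even_of_mem_Nm p hρ.le hΔ hΔ1 hΔs (Sq_le_Nm _ _ hx)
  have hΔ0 : od p Δ = 0 := (od_eq_zero_iff p Δ).2 hΔ1
  have key : ∀ D : Kˣ, ∀ x y : Kˣ, x / y ∉ Sq (.fin p) → x * D ∈ Sq (.fin p) →
      y * D ∉ Sq (.fin p) := fun D x y h h1 h2 => h (by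
    have := div_mem h1 h2
    rwa [mul_div_mul_right_eq_div] at this)
  have h1 : Δ / 1 ∉ Sq (.fin p) := by rwa [div_one]
  have h2 : π / 1 ∉ Sq (.fin p) := fun h => by
    have := hev h; rw [div_one, hπ] at this; exact absurd this (by decide)
  have h3 : π / Δ ∉ Sq (.fin p) := fun h => by
    have := hev h; rw [od_div, hπ, hΔ0] at this; exact absurd this (by decide)
  by_contra hc
  push Not at hc
  have hc' : ∀ c : Kˣ, c * D₁ ∈ Sq (.fin p) ∨ c * D₂ ∈ Sq (.fin p) := fun c =>
    or_iff_not_imp_left.2 (hc c)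
  have k1 := fun D h h' => key D Δ 1 h1 h h'
  have k2 := fun D h h' => key D π 1 h2 h h'
  have k3 := fun D h h' => key D π Δ h3 h h'
  rcases hc' 1 with x | x <;> rcases hc' Δ with y | y <;> rcases hc' π with z | z <;>
  first | exact k1 _ y x | exact k2 _ z x | exact k3 _ z y
end fin

/-- normalised absolute value of two -/
noncomputable def n2 : Pl K → ℝ
  | .fin p => (Pl.fin p).abs 2
  | .inf v => 2 ^ v.mult

lemma n2_nonneg (v : Pl K) : 0 ≤ n2 v := by
  cases v with
  | fin p => exact (Pl.fin p).abs.nonneg _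
  | inf v => unfold n2; positivity

open Classical in
lemma prod_n2 {S : Finset (Pl K)} (hS : Inf S)
    (h2 : ∀ p, Pl.fin p ∉ S → od p (Units.mk0 (2 : K) two_ne_zero) = 0) :
    ∏ v ∈ S, n2 v = 1 := by
  have hfi : Function.Injective (Pl.fin (K := K)) := fun a b h => by cases h; rfl
  have hii : Function.Injective (Pl.inf (K := K)) := fun a b h => by cases h; rfl
  set A := S.preimage Pl.fin hfi.injOn with hA
  have hSA : S = A.image Pl.fin ∪ Finset.univ.image Pl.inf := by
    ext v
    cases v with
    | fin p => simp [hA]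
    | inf v => simp [hS v]
  rw [hSA, Finset.prod_union (by
    rw [Finset.disjoint_left]; simp), Finset.prod_image hfi.injOn, Finset.prod_image hii.injOn]
  have h := prod_abs_eq_one (K := K) (x := 2) two_ne_zero
  rw [← finprod_comp_equiv FinitePlace.equivHeightOneSpectrum.symm] at h
  simp only [FinitePlace.equivHeightOneSpectrum_symm_apply, FinitePlace.norm_embedding] at h
  rw [finprod_eq_prod_of_mulSupport_subset (s := A)] at h
  · rw [mul_comm]
    have e : ∀ v : InfinitePlace K, n2 (.inf v) = v 2 ^ v.mult := fun v => by
      rw [← v.norm_embedding_eq, map_ofNat]; simp [n2]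
    simp only [e]; exact h
  · intro p hp
    by_contra hpA
    refine hp ?_
    have : Pl.fin p ∉ S := by simpa [hA] using hpA
    exact (od_eq_zero_iff p _).1 (h2 p this)

lemma index_Sq (v : Pl K) : (Sq v).index ≠ 0 ∧ ((Sq v).index : ℝ) * n2 v ≤ 4 := by
  cases v with
  | fin p => exact index_Sq_fin p
  | inf v =>
    refine ⟨(index_Sq_inf v).1, ?_⟩
    have : (((Sq (.inf v)).index * 2 ^ v.mult : ℕ) : ℝ) ≤ (4 : ℕ) :=
      Nat.cast_le.2 (index_Sq_inf v).2
    push_cast at this; exact this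

lemma index_IS_Sq {S : Finset (Pl K)} (hS : Inf S)
    (h2 : ∀ p, Pl.fin p ∉ S → od p (Units.mk0 (2 : K) two_ne_zero) = 0) :
    (IS S Sq).index ≠ 0 ∧ (IS S Sq).index ≤ 4 ^ S.card := by
  rw [index_IS S Sq fun _ _ => le_rfl]
  refine ⟨Finset.prod_ne_zero_iff.2 fun v _ => (index_Sq v).1, ?_⟩
  have : ((∏ v ∈ S, (Sq v).index : ℕ) : ℝ) ≤ 4 ^ S.card := by
    push_cast
    rw [← mul_one (∏ v ∈ S, _), ← prod_n2 hS h2, ← Finset.prod_mul_distrib]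
    calc _ ≤ ∏ v ∈ S, (4 : ℝ) := Finset.prod_le_prod (fun v _ => mul_nonneg (by positivity)
            (n2_nonneg v)) fun v _ => (index_Sq v).2
      _ = _ := by simp
  exact_mod_cast this
end HM

namespace HM
open NumberField IsDedekindDomain
variable {K : Type u} [Field K] [NumberField K]

lemma infinite_Pl (K : Type*) [Field K] [NumberField K] : Infinite (Pl K) := by
  choose f hf using fun p : Nat.Primes => ov_over (algebraMap ℚ K)
    (.fin ((Rat.HeightOneSpectrum.primesEquiv (R := 𝓞 ℚ)).symm p))
  refine Infinite.of_injective f fun p q h => ?_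
  have h1 := hf p
  rw [h] at h1
  have := h1.uniq (hf q)
  simpa using this

/-- squares are detected locally -/
lemma sq_of_local {a : Kˣ} (h : ∀ v, a ∈ Sq v) : IsSquare (a : K) := by
  classical
  by_contra ha
  obtain ⟨S, G⟩ := exists_good a
  obtain ⟨h0, h1⟩ := first_ineq ha G
  have e1 : IS S (Nm a) = ⊤ := by
    ext x; simp [mem_IS, Nm_top (h _)]
  have e2 : (S.filter fun v => a ∉ Sq v).card = 0 := by simp [h]
  rw [e1] at h1 h0
  rw [e2, sup_top_eq, Subgroup.index_top] at h1
  omega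

lemma Ov.Sq {L : Type*} [Field L] [NumberField L] {φ : K →+* L} {w : Pl L} {v : Pl K}
    (h : Ov φ w v) {x : Kˣ} (hx : x ∈ HM.Sq v) : Units.map (φ : K →* L) x ∈ HM.Sq w := by
  obtain ⟨f, -, hf⟩ := h.hom
  obtain ⟨r, hr⟩ := hx
  exact ⟨f r, by rw [← map_mul, ← hr, hf]; rfl⟩

lemma Ov.Nm {L : Type*} [Field L] [NumberField L] {φ : K →+* L} {w : Pl L} {v : Pl K}
    (h : Ov φ w v) {x a : Kˣ} (hx : x ∈ HM.Nm a v) :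
    Units.map (φ : K →* L) x ∈ HM.Nm (Units.map (φ : K →* L) a) w := by
  obtain ⟨f, -, hf⟩ := h.hom
  obtain ⟨r, s, hr⟩ := hx
  refine ⟨f r, f s, ?_⟩
  have e1 := hf (a : K)
  have e2 := hf (x : K)
  have := congrArg f hr
  rw [map_sub, map_mul, map_pow, map_pow, e1] at this
  exact this.trans e2

lemma Quad.sq_of {L : Type*} [Field L] [NumberField L] {a : Kˣ} {ι : K →+* L} {s : L} {τ : L →+* L}
    (Q : Quad a ι s τ) {x : K} (h : IsSquare (ι x)) : IsSquare x ∨ IsSquare (x * a) := by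
  obtain ⟨z, hz⟩ := h
  have h1 : τ z = z ∨ τ z = -z := by
    rw [← sq_eq_sq_iff_eq_or_eq_neg, sq, sq, ← hz, ← map_mul, ← hz, Q.hτ]
  rcases h1 with h1 | h1
  · obtain ⟨y, rfl⟩ := Q.fix h1
    exact Or.inl ⟨y, ι.injective (by rw [hz, map_mul])⟩
  · obtain ⟨y, hy⟩ := Q.fix (z := z * s) (by rw [map_mul, h1, Q.hτs]; ring)
    exact Or.inr ⟨y, ι.injective (by
      rw [map_mul, map_mul, ← hy, hz, ← Q.hs]; ring)⟩

lemma od_even_of_sq {a : Kˣ} (h : IsSquare (a : K)) (p : HeightOneSpectrum (𝓞 K)) : Even (od p a) := by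
  obtain ⟨r, hr⟩ := h
  refine even_of_abs p (r := r) ?_
  rw [hr, map_mul, sq]

/-- non-squares are non-squares at places outside any given finite set -/
lemma exists_ns {a : Kˣ} (ha : ¬ IsSquare (a : K)) (S : Finset (Pl K)) :
    ∃ p, Pl.fin p ∉ S ∧ a ∉ Sq (.fin p) := by
  classical
  by_contra hc
  push Not at hc
  set S₁ := S ∪ Finset.univ.image Pl.inf with hS₁
  have := infinite_Pl K
  obtain ⟨v, hv⟩ := Infinite.exists_notMem_finset (S₁ ∪ (od_finite a).toFinset.image Pl.fin)
  obtain ⟨q, rfl⟩ : ∃ q, v = .fin q := by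
    cases v with
    | fin q => exact ⟨q, rfl⟩
    | inf v => exact absurd (by simp [hS₁]) hv
  simp only [Finset.mem_union, not_or] at hv
  have hqa : od q a = 0 := by
    by_contra h; exact hv.2 (by simp [h])
  have hq1 : Pl.fin q ∉ S₁ := by simpa [hS₁] using hv.1
  obtain ⟨π, hπ⟩ := exists_od_one q
  obtain ⟨e, he, heo⟩ := approxS (insert (.fin q) S₁) (fun v => if v = .fin q then π else 1)
  have ho : od q e = 1 := by rw [heo q (by simp)]; simp [hπ]
  have hes : ∀ v ∈ S₁, e ∈ Sq v := fun v hv => by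
    have := he v (Finset.mem_insert_of_mem hv)
    rwa [if_neg (by rintro rfl; exact hq1 hv), div_one] at this
  have hcns : ¬ IsSquare ((a * e : Kˣ) : K) := fun h => by
    have := od_even_of_sq h q
    rw [od_mul, hqa, ho] at this; exact absurd this (by decide)
  obtain ⟨L, _, _, ι, s, τ, Q⟩ := exists_quad (a * e) hcns
  have hL : IsSquare ((Units.map (ι : K →* L) a : Lˣ) : L) := by
    refine sq_of_local fun w => ?_
    obtain ⟨v, hv⟩ := ov_exists ι w
    by_cases hvS : v ∈ S₁
    · have h1 := hv.Sq (hes v hvS)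
      have h2 : Units.map (ι : K →* L) (a * e) ∈ Sq w := by
        have : Units.map (ι : K →* L) (a * e) = (Units.mk0 s Q.s_ne) ^ 2 := Units.ext (by
          have := Q.hs; simpa using this.symm)
        rw [this]; exact sq_mem_Sq _ _
      have := div_mem h2 h1
      rwa [← map_div, mul_div_cancel_right] at this
    · refine hv.Sq ?_
      cases v with
      | inf v => exact absurd (by simp [hS₁]) hvS
      | fin p => exact hc p fun h => hvS (by simp [hS₁, h])
  rcases Q.sq_of hL with h | h
  · exact ha h
  · have := od_even_of_sq (a := a * (a * e)) (by simpa using h) q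
    rw [od_mul, od_mul, hqa, ho] at this; exact absurd this (by decide)
end HM

namespace HM
open NumberField IsDedekindDomain
variable {K : Type*} [Field K] [NumberField K]

/-- global squares -/
abbrev SqK (K : Type*) [Field K] : Subgroup Kˣ := (powMonoidHom 2 : Kˣ →* Kˣ).range

lemma mem_SqK {x : Kˣ} : x ∈ SqK K ↔ IsSquare (x : K) := by
  constructor
  · rintro ⟨y, rfl⟩; exact ⟨y, by simp [sq]⟩
  · rintro ⟨y, hy⟩
    have : y ≠ 0 := by rintro rfl; simp at hy
    exact ⟨Units.mk0 y this, Units.ext (by simp [hy, sq])⟩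

lemma SqK_le (v : Pl K) : SqK K ≤ Sq v := by
  rintro _ ⟨y, rfl⟩; exact sq_mem_Sq v y

lemma relIndex_SqK (S : Finset (Pl K)) (hS : Inf S) : (SqK K).relIndex (US S) = 2 ^ S.card := by
  obtain ⟨fB, rB⟩ := US_rank S hS
  have h1 := index_dbl (Additive (US S))
  have h2 := card_two_tors (MonoidHom.toAdditive (US S).subtype)
    (Subtype.val_injective) (Additive.ofMul ⟨-1, neg_one_mem_US S⟩) rfl
  rw [h2, ← pow_succ, rB] at h1
  rw [← h1]
  have : (SqK K).subgroupOf (US S) = (powMonoidHom 2 : US S →* US S).range := by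
    ext x
    constructor
    · rintro ⟨y, hy⟩
      have hy : y ^ 2 = (x : Kˣ) := hy
      refine ⟨⟨y, fun p hp => ?_⟩, Subtype.ext hy⟩
      have := x.2 p hp
      rw [← hy, od_pow] at this
      simpa using this
    · rintro ⟨y, rfl⟩; exact ⟨y, rfl⟩
  rw [Subgroup.relIndex, this, ← Subgroup.index_toAddSubgroup]
  congr 1

lemma IS_insert {S : Finset (Pl K)} [DecidableEq (Pl K)] {v : Pl K} {H : Pl K → Subgroup Kˣ} :
    IS (insert v S) H = H v ⊓ IS S H := by
  ext x; simp [mem_IS]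

/-- the data of the auxiliary set `T` -/
structure Aux (a : Kˣ) (S T : Finset (Pl K)) : Prop where
  fin : ∀ v ∈ T, ∃ p, v = .fin p ∧ v ∉ S
  spl : ∀ v ∈ T, a ∈ Sq v
  ind : (IS T Sq).relIndex (US S) = 2 ^ T.card
  sur : ∀ z : Pl K → Kˣ, (∀ p, Pl.fin p ∈ T → od p (z (.fin p)) = 0) →
    ∃ u ∈ US S, ∀ v ∈ T, u / z v ∈ Sq v

lemma Aux.step {a : Kˣ} (ha : ¬ IsSquare (a : K)) {S T : Finset (Pl K)} (G : Good a S)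
    (A : Aux a S T) {b : Kˣ} (hb : b ∈ US S) (hbT : b ∈ IS T Sq) (h1 : ¬ IsSquare (b : K))
    (h2 : ¬ IsSquare (b * a : K)) : ∃ T', T'.card = T.card + 1 ∧ Aux a S T' := by
  classical
  obtain ⟨L, _, _, ι, s, τ, Q⟩ := exists_quad a ha
  have hbL : ¬ IsSquare ((Units.map (ι : K →* L) b : Lˣ) : L) := fun h => by
    rcases Q.sq_of h with h | h
    exacts [h1 h, h2 h]
  obtain ⟨q, hq, hbq⟩ := exists_ns hbL (up ι S)
  obtain ⟨p, hp⟩ := ov_fin_exists ι q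
  rw [mem_up_iff hp] at hq
  have hbp : b ∉ Sq (.fin p) := fun h => hbq (hp.Sq h)
  have hpT : Pl.fin p ∉ T := fun h => hbp (mem_IS.1 hbT _ h)
  have hap : a ∈ Sq (.fin p) := by
    by_contra hap
    have := hp.Sq (unit_ratio p (G.two p hq) (hb p hq) (G.od p hq) hbp hap)
    rw [map_div] at this
    have h2 : Units.map (ι : K →* L) a ∈ Sq (.fin q) := by
      have : Units.map (ι : K →* L) a = (Units.mk0 s Q.s_ne) ^ 2 := Units.ext (by
        have := Q.hs; simpa using this.symm)
      rw [this]; exact sq_mem_Sq _ _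
    exact hbq (by simpa using mul_mem this h2)
  refine ⟨insert (.fin p) T, Finset.card_insert_of_notMem hpT, ⟨?_, ?_, ?_, ?_⟩⟩
  · intro v hv
    rcases Finset.mem_insert.1 hv with rfl | hv
    exacts [⟨p, rfl, hq⟩, A.fin v hv]
  · intro v hv
    rcases Finset.mem_insert.1 hv with rfl | hv
    exacts [hap, A.spl v hv]
  · rw [IS_insert, ← Subgroup.relIndex_inf_mul_relIndex, A.ind, Finset.card_insert_of_notMem hpT,
      pow_succ']
    congr 1
    rw [Subgroup.relIndex_eq_two_iff_exists_notMem_and]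
    refine ⟨b, ⟨hbT, hb⟩, hbp, fun c hc => ?_⟩
    by_cases hcp : c ∈ Sq (.fin p)
    · exact Or.inr hcp
    · have := unit_ratio p (G.two p hq) (hc.2 p hq) (hb p hq) hcp hbp
      left
      have e : c * b = c / b * b ^ 2 := by rw [sq, ← mul_assoc, div_mul_cancel]
      rw [e]; exact mul_mem this (sq_mem_Sq _ _)
  · intro z hz
    obtain ⟨u, hu, huT⟩ := A.sur z fun p h => hz p (Finset.mem_insert_of_mem h)
    have h0 := hz p (Finset.mem_insert_self _ _)
    by_cases hup : u / z (.fin p) ∈ Sq (.fin p)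
    · refine ⟨u, hu, fun v hv => ?_⟩
      rcases Finset.mem_insert.1 hv with rfl | hv
      exacts [hup, huT v hv]
    · refine ⟨u * b, mul_mem hu hb, fun v hv => ?_⟩
      rcases Finset.mem_insert.1 hv with rfl | hv
      · have := unit_ratio p (G.two p hq) (by rw [od_div, hu p hq, h0, sub_zero]) (hb p hq) hup hbp
        have e : u * b / z (.fin p) = u / z (.fin p) / b * b ^ 2 := by
          rw [sq, ← mul_assoc, div_mul_cancel, mul_div_right_comm]
        rw [e]; exact mul_mem this (sq_mem_Sq _ _)
      · rw [mul_div_right_comm]; exact mul_mem (huT v hv) (mem_IS.1 hbT v hv)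

lemma exists_aux {a : Kˣ} (ha : ¬ IsSquare (a : K)) {S : Finset (Pl K)} (G : Good a S) :
    ∃ T, Aux a S T ∧ S.card ≤ T.card + 1 := by
  classical
  by_contra hc
  push Not at hc
  have hR := relIndex_SqK S G.inf
  have main : ∀ k : ℕ, ∃ T, T.card = k ∧ Aux a S T := fun k => by
    induction k with
    | zero => exact ⟨∅, rfl, by simp, by simp, by simp [IS], fun z _ => ⟨1, one_mem _, by simp⟩⟩
    | succ k ih =>
      obtain ⟨T, rfl, A⟩ := ih
      by_cases h : ∃ b, b ∈ US S ∧ b ∈ IS T Sq ∧ ¬ IsSquare (b : K) ∧ ¬ IsSquare (b * a : K)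
      · obtain ⟨b, hb, hbT, h1, h2⟩ := h
        exact A.step ha G hb hbT h1 h2
      · exfalso
        push Not at h
        refine (hc T A).not_ge ?_
        have h1 : (SqK K).relIndex (IS T Sq ⊓ US S) = 2 := by
          rw [Subgroup.relIndex_eq_two_iff_exists_notMem_and]
          refine ⟨a, ⟨mem_IS.2 A.spl, G.od⟩, fun h => ha (mem_SqK.1 h), fun b hb => ?_⟩
          by_cases hs : IsSquare (b : K)
          · exact Or.inr (mem_SqK.2 hs)
          · exact Or.inl (mem_SqK.2 (by simpa using h b hb.2 hb.1 hs))
        have h2 := Subgroup.relIndex_inf_mul_relIndex (SqK K) (IS T Sq) (US S)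
        have h3 : SqK K ⊓ IS T Sq = SqK K :=
          inf_eq_left.2 fun x hx => mem_IS.2 fun v _ => SqK_le v hx
        rw [h3, h1, A.ind, hR, ← pow_succ'] at h2
        exact (Nat.pow_right_injective le_rfl h2).ge
  obtain ⟨T, hT, A⟩ := main (S.card + 1)
  have := hc T A
  omega

/-- `Kˣ = U_{S ∪ T} Sq_T` -/
lemma Aux.gen [DecidableEq (Pl K)] {a : Kˣ} {S T : Finset (Pl K)} (G : Good a S) (A : Aux a S T) :
    US (S ∪ T) ⊔ IS T Sq = ⊤ := by
  classical
  rw [eq_top_iff]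
  intro x _
  obtain ⟨k, hk⟩ := G.gen.solve (fun p => if Pl.fin p ∈ T then 0 else od p x)
    ((od_finite x).subset fun p hp => by
      simp only [Set.mem_ofPred_eq] at hp ⊢
      split_ifs at hp with h
      · exact absurd rfl hp
      · exact hp)
  obtain ⟨u, hu, huT⟩ := A.sur (fun _ => k) fun p hp => by
    obtain ⟨q, hq, hqS⟩ := A.fin _ hp
    rw [hk p hqS, if_pos hp]
  rw [Subgroup.mem_sup]
  refine ⟨x / k * u, mul_mem (fun p hp => ?_) (US_mono Finset.subset_union_left hu), k / u,
    mem_IS.2 fun v hv => ?_, by rw [mul_div, div_mul_eq_mul_div, div_mul_cancel, mul_div_cancel_right]⟩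
  · rw [Finset.mem_union, not_or] at hp
    rw [od_div, hk p hp.1, if_neg hp.2, sub_self]
  · simpa using inv_mem (huT v hv)

lemma two_le_index_Nm {a : Kˣ} {v : Pl K} (h : a ∉ Sq v) : 2 ≤ (Nm a v).index := by
  have h0 : (Nm a v).index ≠ 0 := fun h => (index_Sq v).1
    (Nat.eq_zero_of_zero_dvd (h ▸ Subgroup.index_dvd_of_le (Sq_le_Nm a v)))
  have h1 : (Nm a v).index ≠ 1 := fun h1 => by
    obtain ⟨b, hb⟩ := exists_nNm h
    rw [Subgroup.index_eq_one] at h1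
    exact hb (h1 ▸ trivial)
  omega

open Classical in
lemma index_Nm_ge (a : Kˣ) (S : Finset (Pl K)) : (IS S (Nm a)).index = ∏ v ∈ S, (Nm a v).index ∧
    2 ^ (S.filter fun v => a ∉ Sq v).card = ∏ v ∈ S, (if a ∉ Sq v then 2 else 1) ∧
    ∀ v, (if a ∉ Sq v then 2 else 1) ≤ (Nm a v).index := by
  refine ⟨index_IS S _ fun v _ => Sq_le_Nm a v, ?_, fun v => ?_⟩
  · rw [Finset.prod_ite]; simp
  · by_cases h : a ∈ Sq v
    · simp [h, Nm_top h]
    · rw [if_pos h]; exact two_le_index_Nm h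

/-- first inequality, normalised -/
lemma fi_ge {a : Kˣ} (ha : ¬ IsSquare (a : K)) {S : Finset (Pl K)} (G : Good a S) :
    2 ≤ (US S ⊔ IS S (Nm a)).index := by
  classical
  obtain ⟨h0, h1⟩ := first_ineq ha G
  obtain ⟨e1, e2, e3⟩ := index_Nm_ge a S
  rw [e1] at h1
  by_contra hc
  have h4 : 2 ^ (S.filter fun v => a ∉ Sq v).card ≤ ∏ v ∈ S, (Nm a v).index := by
    rw [e2]; exact Finset.prod_le_prod' fun v _ => e3 v
  have h5 : 0 < 2 ^ (S.filter fun v => a ∉ Sq v).card := by positivity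
  generalize 2 ^ (S.filter fun v => a ∉ Sq v).card = x at *
  generalize ∏ v ∈ S, (Nm a v).index = y at *
  have h6 : (US S ⊔ IS S (Nm a)).index * x ≤ 1 * x := Nat.mul_le_mul_right _ (by omega)
  have h7 : 2 * 1 * y ≤ 2 * (NF (a : K)).relIndex (US S ⊓ IS S (Nm a)) * y :=
    Nat.mul_le_mul_right _ (Nat.mul_le_mul_left _ (Nat.pos_of_ne_zero h0))
  omega

lemma Aux.sq [DecidableEq (Pl K)] {a : Kˣ} {S T : Finset (Pl K)} (G : Good a S) (A : Aux a S T) :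
    US (S ∪ T) ⊓ IS S Sq ≤ SqK K := by
  intro b hb
  rw [mem_SqK]
  by_contra hns
  have G' := G.mono (Finset.subset_union_left (s₂ := T))
  have := fi_ge hns (S := S ∪ T) ⟨G'.inf, G'.gen, G'.two, hb.1⟩
  have h2 : US (S ∪ T) ⊔ IS (S ∪ T) (Nm b) = ⊤ := by
    rw [eq_top_iff, ← A.gen G]
    refine sup_le_sup_left (fun x hx => mem_IS.2 fun v hv => ?_) _
    rcases Finset.mem_union.1 hv with hv | hv
    · rw [Nm_top (mem_IS.1 hb.2 v hv)]; trivial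
    · exact Sq_le_Nm _ _ (mem_IS.1 hx v hv)
  rw [h2, Subgroup.index_top] at this
  omega

lemma second [DecidableEq (Pl K)] {a : Kˣ} (ha : ¬ IsSquare (a : K)) {S : Finset (Pl K)} (G : Good a S) :
    ∃ T, Aux a S T ∧ (US (S ∪ T) ⊔ IS S Sq).index = 2 ∧ (US (S ∪ T) ⊔ IS S (Nm a)).index = 2 ∧
      US (S ∪ T) ⊓ IS S (Nm a) ≤ NF (a : K) ∧ ∀ v ∈ S, a ∉ Sq v → (Nm a v).index = 2 := by
  classical
  obtain ⟨T, A, hT⟩ := exists_aux ha G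
  refine ⟨T, A, ?_⟩
  have G' := G.mono (Finset.subset_union_left (s₂ := T))
  obtain ⟨h0, h1⟩ := first_ineq ha G'
  have hge := fi_ge ha G'
  have eS : IS (S ∪ T) (Nm a) = IS S (Nm a) := by
    ext x
    simp only [mem_IS, Finset.mem_union]
    refine ⟨fun h v hv => h v (Or.inl hv), fun h v hv => hv.elim (h v) fun hv => ?_⟩
    rw [Nm_top (A.spl v hv)]; trivial
  have eF : ((S ∪ T).filter fun v => a ∉ Sq v) = S.filter fun v => a ∉ Sq v := by
    ext v
    simp only [Finset.mem_filter, Finset.mem_union]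
    exact ⟨fun h => ⟨h.1.resolve_right fun hT => h.2 (A.spl v hT), h.2⟩, fun h => ⟨Or.inl h.1, h.2⟩⟩
  rw [eS] at h0 h1 hge
  rw [eF] at h1
  obtain ⟨e1, e2, e3⟩ := index_Nm_ge a S
  obtain ⟨i0, i1⟩ := index_IS_Sq G.inf G.two
  set U := US (S ∪ T) with hU
  have hUS : (U ⊔ IS S Sq).index ≤ 2 := by
    have h2 : (IS S Sq).index = (IS S Sq).relIndex U * (U ⊔ IS S Sq).index := by
      rw [← Subgroup.relIndex_mul_index (le_sup_right : IS S Sq ≤ U ⊔ IS S Sq), Subgroup.relIndex_sup_right]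
    have h3 : 2 ^ (S ∪ T).card ≤ (IS S Sq).relIndex U := by
      rw [← relIndex_SqK _ G'.inf, ← Subgroup.inf_relIndex_right (IS S Sq)]
      refine Subgroup.relIndex_le_of_le_left (by rw [inf_comm]; exact A.sq G) ?_
      rw [Subgroup.inf_relIndex_right]
      exact fun h => i0 (by rw [h2, h, zero_mul])
    have hd : (S ∪ T).card = S.card + T.card := Finset.card_union_of_disjoint
      (Finset.disjoint_right.2 fun v hv => (A.fin v hv).choose_spec.2)
    rw [hd] at h3
    have h4 : 4 ^ S.card ≤ 2 ^ (S.card + T.card) * 2 := by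
      rw [← pow_succ, show 4 = 2 ^ 2 by norm_num, ← pow_mul]
      exact Nat.pow_le_pow_right (by norm_num) (by omega)
    have h5 : 0 < 2 ^ (S.card + T.card) := by positivity
    rw [h2] at i1
    have := (Nat.mul_le_mul_right _ h3).trans (i1.trans h4)
    exact Nat.le_of_mul_le_mul_left this h5
  have hne : (U ⊔ IS S Sq).index ≠ 0 := fun h => i0 (Nat.eq_zero_of_zero_dvd
    (h ▸ Subgroup.index_dvd_of_le le_sup_right))
  have hle : (U ⊔ IS S (Nm a)).index ≤ (U ⊔ IS S Sq).index :=
    Nat.le_of_dvd (Nat.pos_of_ne_zero hne) (Subgroup.index_dvd_of_le (sup_le_sup_left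
      (fun x hx => mem_IS.2 fun v hv => Sq_le_Nm _ _ (mem_IS.1 hx v hv)) _))
  have hN : (U ⊔ IS S (Nm a)).index = 2 := by omega
  rw [e1, hN] at h1
  have h5 : 0 < 2 ^ (S.filter fun v => a ∉ Sq v).card := by positivity
  have h4 : 2 ^ (S.filter fun v => a ∉ Sq v).card ≤ ∏ v ∈ S, (Nm a v).index := by
    rw [e2]; exact Finset.prod_le_prod' fun v _ => e3 v
  have hk : (NF (a : K)).relIndex (U ⊓ IS S (Nm a)) = 1 ∧
      ∏ v ∈ S, (Nm a v).index = 2 ^ (S.filter fun v => a ∉ Sq v).card := by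
    generalize 2 ^ (S.filter fun v => a ∉ Sq v).card = x at *
    generalize ∏ v ∈ S, (Nm a v).index = y at *
    generalize (NF (a : K)).relIndex (U ⊓ IS S (Nm a)) = z at *
    have h6 : z * y ≤ x := by rw [mul_assoc] at h1; omega
    have : z ≤ 1 := by
      by_contra hz
      have : 2 * y ≤ z * y := Nat.mul_le_mul_right _ (by omega)
      omega
    have hz : z = 1 := by omega
    rw [hz] at h6
    exact ⟨hz, by omega⟩
  refine ⟨by omega, hN, Subgroup.relIndex_eq_one.1 hk.1, fun v hv hav => ?_⟩
  have := hk.2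
  rw [e2] at this
  by_contra h7
  refine this.not_gt (Finset.prod_lt_prod (fun w _ => by split_ifs <;> norm_num) (fun v _ => e3 v)
    ⟨v, hv, ?_⟩)
  rw [if_pos hav]; have := two_le_index_Nm hav; omega
end HM

namespace HM
open NumberField IsDedekindDomain
variable {K : Type*} [Field K] [NumberField K]

open Classical in
lemma exists_good_supp (a b : Kˣ) (R : Finset (Pl K)) : ∃ S, Good a S ∧ R ⊆ S ∧ b ∈ US S := by
  obtain ⟨S, G⟩ := exists_good a
  obtain ⟨S', G'⟩ := exists_good b
  exact ⟨S ∪ S' ∪ R, (G.mono Finset.subset_union_left).mono Finset.subset_union_left,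
    Finset.subset_union_right, US_mono (Finset.subset_union_right.trans Finset.subset_union_left) G'.od⟩

lemma index_Nm {a : Kˣ} {v : Pl K} (h : a ∉ Sq v) : (Nm a v).index = 2 := by
  classical
  have ha : ¬ IsSquare (a : K) := fun hs => h (SqK_le v (mem_SqK.2 hs))
  obtain ⟨S, G, hR, -⟩ := exists_good_supp a 1 {v}
  obtain ⟨T, -, -, -, -, h5⟩ := second ha G
  exact h5 v (hR (by simp)) h

lemma mul_mem_Nm {a b c : Kˣ} {v : Pl K} (hb : b ∉ Nm a v) (hc : c ∉ Nm a v) : b * c ∈ Nm a v := by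
  by_cases h : a ∈ Sq v
  · rw [Nm_top h]; trivial
  · rw [Subgroup.mul_mem_iff_of_index_two (index_Nm h)]; tauto

/-- Hasse norm theorem for quadratic extensions -/
theorem hasse_norm {a b : Kˣ} (h : ∀ v, b ∈ Nm a v) : b ∈ NF (a : K) := by
  classical
  by_cases ha : IsSquare (a : K)
  · rw [NF_sq a.ne_zero ha]; trivial
  obtain ⟨S, G, hR, hb⟩ := exists_good_supp a b ∅
  obtain ⟨T, -, -, -, h4, -⟩ := second ha G
  exact h4 ⟨US_mono Finset.subset_union_left hb, mem_IS.2 fun v _ => h v⟩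

/-- units are norms at odd primes -/
lemma unit_mem_Nm (p : HeightOneSpectrum (𝓞 K)) (h2 : e2 p = 0) {a b : Kˣ} (ha : od p a = 0)
    (hb : od p b = 0) : b ∈ Nm a (.fin p) := by
  by_cases hs : a ∈ Sq (.fin p)
  · rw [Nm_top hs]; trivial
  by_contra hn
  have h4 : (Pl.fin p).abs (4 : K) = 1 := by
    have := (od_eq_zero_iff p _).1 h2
    rw [Units.val_mk0] at this
    rw [show (4 : K) = 2 * 2 by norm_num, map_mul, this, one_mul]
  have ha1 := (od_eq_zero_iff p a).1 ha
  have hev : ∀ {z}, z ∈ Nm a (.fin p) → Even (od p z) := fun {z} hz =>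
    even_of_mem_Nm p (ρ := (a - 1) / 4) (by
      rw [map_div₀, h4, div_one]
      refine (fin_sub p _ _).trans ?_
      rw [ha1, map_one, max_self]) (by field_simp; ring) ha1 hs hz
  obtain ⟨π, hπ⟩ := exists_od_one p
  have h1 : π ∉ Nm a (.fin p) := fun h => by
    have := hev h; rw [hπ] at this; exact absurd this (by decide)
  have := hev (mul_mem_Nm hn h1)
  rw [od_mul, hb, hπ] at this; exact absurd this (by decide)

/-- reciprocity -/
theorem recip {a b : Kˣ} (v₀ : Pl K) (h : ∀ v, v ≠ v₀ → a ∈ Nm b v) : a ∈ Nm b v₀ := by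
  classical
  by_contra hn
  have hb : ¬ IsSquare (b : K) := fun hs => by
    rw [Nm_top (SqK_le _ (mem_SqK.2 hs))] at hn; exact hn trivial
  obtain ⟨S, G, hR, haS⟩ := exists_good_supp b a {v₀}
  have hv₀ : v₀ ∈ S := hR (by simp)
  obtain ⟨T, A, h2, h3, -, -⟩ := second hb G
  have hle : US (S ∪ T) ⊔ IS S Sq ≤ US (S ∪ T) ⊔ IS S (Nm b) := sup_le_sup_left
      (fun x hx => mem_IS.2 fun v hv => Sq_le_Nm _ _ (mem_IS.1 hx v hv)) _
  have heq : US (S ∪ T) ⊔ IS S (Nm b) ≤ US (S ∪ T) ⊔ IS S Sq := by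
    rw [← Subgroup.relIndex_eq_one]
    have := Subgroup.relIndex_mul_index hle
    rw [h2, h3] at this; omega
  obtain ⟨x, hx, -⟩ := approxS S (fun v => if v = v₀ then a else 1)
  have hx0 : x / a ∈ Sq v₀ := by simpa using hx v₀ hv₀
  have hxS : ∀ v ∈ S, v ≠ v₀ → x ∈ Sq v := fun v hv hne => by simpa [hne] using hx v hv
  have hxU : x ∈ US (S ∪ T) ⊔ IS S Sq := heq (by
    have : x = a * (x / a) := by rw [mul_div_cancel]
    rw [this]
    refine mul_mem (le_sup_left (α := Subgroup Kˣ) (US_mono Finset.subset_union_left haS))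
      (le_sup_right (α := Subgroup Kˣ) (mem_IS.2 fun v hv => ?_))
    by_cases hv0 : v = v₀
    · subst hv0; exact Sq_le_Nm _ _ hx0
    · exact div_mem (Sq_le_Nm _ _ (hxS v hv hv0)) (h v hv0))
  obtain ⟨c, hc, y, hy, rfl⟩ := Subgroup.mem_sup.1 hxU
  have hy := mem_IS.1 hy
  have hcS : ∀ v ∈ S, v ≠ v₀ → c ∈ Sq v := fun v hv hne => by
    simpa using div_mem (hxS v hv hne) (hy v hv)
  have hc0 : c / a ∈ Sq v₀ := by
    have := div_mem hx0 (hy v₀ hv₀)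
    rwa [div_right_comm, mul_div_cancel_right] at this
  have hcn : b ∉ Nm c v₀ := by rw [Nm_congr hc0, ← Nm_comm]; exact hn
  have hcs : ¬ IsSquare (c : K) := fun hs => by
    rw [Nm_top (SqK_le _ (mem_SqK.2 hs))] at hcn; exact hcn trivial
  have G' := G.mono (Finset.subset_union_left (s₂ := T))
  have := fi_ge hcs (S := S ∪ T) ⟨G'.inf, G'.gen, G'.two, hc⟩
  have htop : US (S ∪ T) ⊔ IS (S ∪ T) (Nm c) = ⊤ := by
    rw [eq_top_iff, ← A.gen G]
    refine sup_le le_sup_left fun x hx => ?_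
    have hx := mem_IS.1 hx
    have h1 : ∀ z : Kˣ, (∀ v ∈ T, z ∈ Sq v) → z ∈ Nm c v₀ → z ∈ IS (S ∪ T) (Nm c) := fun z hz h0 =>
      mem_IS.2 fun v hv => by
        rcases Finset.mem_union.1 hv with hv | hv
        · by_cases hv0 : v = v₀
          · rw [hv0]; exact h0
          · rw [Nm_top (hcS v hv hv0)]; trivial
        · exact Sq_le_Nm _ _ (hz v hv)
    by_cases hx0 : x ∈ Nm c v₀
    · exact le_sup_right (α := Subgroup Kˣ) (h1 x hx hx0)
    · have := h1 (x * b) (fun v hv => mul_mem (hx v hv) (A.spl v hv)) (mul_mem_Nm hx0 hcn)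
      have e : x = b⁻¹ * (x * b) := by rw [mul_comm x, inv_mul_cancel_left]
      rw [e]
      exact mul_mem (le_sup_left (α := Subgroup Kˣ) (inv_mem (G'.od)))
        (le_sup_right (α := Subgroup Kˣ) this)
  rw [htop, Subgroup.index_top] at this
  omega

/-- norm theorem with one exempt place -/
theorem norm_one {a b : Kˣ} (v₀ : Pl K) (h : ∀ v, v ≠ v₀ → b ∈ Nm a v) : b ∈ NF (a : K) :=
  hasse_norm fun v => (eq_or_ne v v₀).elim (fun e => e ▸ recip v₀ h) (h v)

/-- existence of elements with prescribed symbols -/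
theorem exists_symbol {a : Kˣ} {w₀ : Pl K} (hw : a ∉ Sq w₀) (R : Finset (Pl K)) (hR : w₀ ∉ R)
    (x : Pl K → Kˣ) : ∃ b : Kˣ, (∀ v ∈ R, b / x v ∈ Nm a v) ∧ ∀ v, v ∉ R → v ≠ w₀ → b ∈ Nm a v := by
  classical
  have ha : ¬ IsSquare (a : K) := fun hs => hw (SqK_le _ (mem_SqK.2 hs))
  obtain ⟨S, G, hRS, -⟩ := exists_good_supp a 1 (insert w₀ R)
  have hw₀ : w₀ ∈ S := hRS (by simp)
  obtain ⟨T, A, h2, h3, -, -⟩ := second ha G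
  have out : ∀ u ∈ US (S ∪ T), ∀ v, v ∉ S → u ∈ Nm a v := fun u hu v hv => by
    by_cases hT : v ∈ T
    · rw [Nm_top (A.spl v hT)]; trivial
    · cases v with
      | inf v => exact absurd (G.inf v) hv
      | fin p => exact unit_mem_Nm p (G.two p hv) (G.od p hv) (hu p (by simp [hv, hT]))
  obtain ⟨z, hz, -⟩ := approxS S (fun v => if v ∈ R then x v else 1)
  have fin : ∀ y : Kˣ, (∀ v ∈ S, v ≠ w₀ → y ∈ Sq v) → z * y ∈ US (S ∪ T) ⊔ IS S (Nm a) →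
      ∃ b : Kˣ, (∀ v ∈ R, b / x v ∈ Nm a v) ∧ ∀ v, v ∉ R → v ≠ w₀ → b ∈ Nm a v := fun y hy h => by
    obtain ⟨b, hb, n, hn, hbn⟩ := Subgroup.mem_sup.1 h
    have hn := mem_IS.1 hn
    have hb' : b = z * y / n := by rw [← hbn, mul_div_cancel_right]
    have key : ∀ v ∈ S, v ≠ w₀ → b / (if v ∈ R then x v else 1) ∈ Nm a v := fun v hv hne => by
      rw [hb', div_right_comm, mul_div_right_comm]
      exact div_mem (mul_mem (Sq_le_Nm _ _ (hz v hv)) (Sq_le_Nm _ _ (hy v hv hne))) (hn v hv)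
    refine ⟨b, fun v hv => ?_, fun v hv hne => ?_⟩
    · have := key v (hRS (Finset.mem_insert_of_mem hv)) (by rintro rfl; exact hR hv)
      rwa [if_pos hv] at this
    · by_cases hvS : v ∈ S
      · have := key v hvS hne
        rwa [if_neg hv, div_one] at this
      · exact out b hb v hvS
  obtain ⟨c, hc⟩ := exists_nNm hw
  obtain ⟨y, hy, -⟩ := approxS S (fun v => if v = w₀ then c else 1)
  have hyS : ∀ v ∈ S, v ≠ w₀ → y ∈ Sq v := fun v hv hne => by simpa [hne] using hy v hv
  have hy0 : y / c ∈ Sq w₀ := by simpa using hy w₀ hw₀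
  have hyn : y ∉ US (S ∪ T) ⊔ IS S (Nm a) := fun h => by
    obtain ⟨u, hu, n, hn, rfl⟩ := Subgroup.mem_sup.1 h
    have hn := mem_IS.1 hn
    have := recip (a := u) (b := a) w₀ fun v hv => by
      by_cases hvS : v ∈ S
      · simpa using div_mem (Sq_le_Nm a v (hyS v hvS hv)) (hn v hvS)
      · exact out u hu v hvS
    have := div_mem (mul_mem this (hn _ hw₀)) (Sq_le_Nm a _ hy0)
    rw [div_div_cancel] at this
    exact hc this
  by_cases h : z ∈ US (S ∪ T) ⊔ IS S (Nm a)
  · exact fin 1 (fun _ _ _ => one_mem _) (by rwa [mul_one])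
  · exact fin y hyS (by rw [Subgroup.mul_mem_iff_of_index_two h3]; tauto)
end HM

namespace HM
open NumberField IsDedekindDomain

section field
variable {F : Type*} [Field F]

/-- the pure quaternion form represents `d` -/
def Rp (a b d : F) : Prop := ∃ x y z : F, a * x ^ 2 + b * y ^ 2 - a * b * z ^ 2 = d

def Rep3 (a b c d : F) : Prop := ∃ x y z : F, a * x ^ 2 + b * y ^ 2 + c * z ^ 2 = d

lemma rep3_iff {a b c : F} (ha : a ≠ 0) (hb : b ≠ 0) (hc : c ≠ 0) (d : F) :
    Rep3 a b c d ↔ Rp (-(b * c)) (-(a * c)) (-(a * b * c * d)) := by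
  constructor
  · rintro ⟨x, y, z, rfl⟩
    exact ⟨a * x, b * y, z, by ring⟩
  · rintro ⟨x, y, z, h⟩
    refine ⟨x / a, y / b, z, ?_⟩
    field_simp
    apply mul_left_cancel₀ hc
    linear_combination -h

lemma Rp.univ [NeZero (2 : F)] {a b : F} (ha : a ≠ 0) (hb : b ≠ 0) {x y z : F} (h0 : ¬ (x = 0 ∧ y = 0 ∧ z = 0))
    (h : a * x ^ 2 + b * y ^ 2 - a * b * z ^ 2 = 0) (d : F) : Rp a b d := by
  have h2 : (2 : F) ≠ 0 := NeZero.ne _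
  by_cases hx : x = 0
  · by_cases hy : y = 0
    · have hz : z ≠ 0 := fun hz => h0 ⟨hx, hy, hz⟩
      refine ⟨0, 0, 0, ?_⟩
      rw [hx, hy] at h
      exfalso
      have : a * b * z ^ 2 ≠ 0 := by positivity
      exact this (by linear_combination -h)
    · refine ⟨(d - b) / (2 * b * y) * x, (d - b) / (2 * b * y) * y + 1, (d - b) / (2 * b * y) * z, ?_⟩
      have : (d - b) / (2 * b * y) * (2 * b * y) = d - b := by field_simp
      linear_combination ((d - b) / (2 * b * y)) ^ 2 * h + this
  · refine ⟨(d - a) / (2 * a * x) * x + 1, (d - a) / (2 * a * x) * y, (d - a) / (2 * a * x) * z, ?_⟩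
    have : (d - a) / (2 * a * x) * (2 * a * x) = d - a := by field_simp
    linear_combination ((d - a) / (2 * a * x)) ^ 2 * h + this

lemma Rp.of_NF [NeZero (2 : F)] {a b : Fˣ} (h : b ∈ NF (a : F)) (d : F) : Rp (a : F) b d := by
  obtain ⟨x, y, h⟩ := h
  refine Rp.univ a.ne_zero b.ne_zero (x := b) (y := a * y) (z := x) (fun h => b.ne_zero h.1) ?_ d
  linear_combination (-a * b : F) * h

lemma Rp.sq [NeZero (2 : F)] {a b : Fˣ} {e : F} (he : e ≠ 0) (h : Rp (a : F) b (e ^ 2)) :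
    b ∈ NF (a : F) := by
  by_cases hs : IsSquare (a : F)
  · rw [NF_sq a.ne_zero hs]; trivial
  obtain ⟨x, y, z, h⟩ := h
  have key : e ^ 2 - a * x ^ 2 = b * (y ^ 2 - a * z ^ 2) := by linear_combination -h
  have hn : ∀ u v : F, u ^ 2 - a * v ^ 2 = 0 → u = 0 := fun u v h => by
    by_contra hu
    have hv : v ≠ 0 := by rintro rfl; apply hu; simpa using h
    exact hs ⟨u / v, by field_simp; linear_combination -h⟩
  have h1 : e ^ 2 - a * x ^ 2 ≠ 0 := fun h => he (hn _ _ h)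
  have h2 : y ^ 2 - a * z ^ 2 ≠ 0 := fun h => h1 (by rw [key, h, mul_zero])
  have e1 : Units.mk0 _ h1 ∈ NF (a : F) := ⟨e, x, rfl⟩
  have e2 : Units.mk0 _ h2 ∈ NF (a : F) := ⟨y, z, rfl⟩
  have : b = Units.mk0 _ h1 / Units.mk0 _ h2 := by
    rw [eq_div_iff_mul_eq']; ext; simp [key]
  rw [this]; exact div_mem e1 e2

lemma Rp.map {F' : Type*} [Field F'] (f : F →+* F') {a b d : F} (h : Rp a b d) : Rp (f a) (f b) (f d) := by
  obtain ⟨x, y, z, rfl⟩ := h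
  exact ⟨f x, f y, f z, by simp⟩
end field

variable {K : Type*} [Field K] [NumberField K]

instance (v : Pl K) : CharZero v.C := charZero_of_injective_algebraMap (algebraMap K v.C).injective

/-- local representation of the pure quaternion form -/
abbrev Rpv (v : Pl K) (a b d : K) : Prop :=
  Rp (algebraMap K v.C a) (algebraMap K v.C b) (algebraMap K v.C d)

lemma Rpv.of_Nm {v : Pl K} {a b : Kˣ} (h : b ∈ Nm a v) (d : K) : Rpv v a b d :=
  Rp.of_NF (F := v.C) (a := Units.map (algebraMap K v.C : K →* v.C) a)
    (b := Units.map (algebraMap K v.C : K →* v.C) b) h _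

lemma exists_not_mem_two {G : Type*} [Group G] {A B : Subgroup G} (hA : A ≠ ⊤) (hB : B ≠ ⊤) :
    ∃ x, x ∉ A ∧ x ∉ B := by
  obtain ⟨a, ha⟩ : ∃ a, a ∉ A := by by_contra! h; exact hA (eq_top_iff.2 fun x _ => h x)
  obtain ⟨b, hb⟩ : ∃ a, a ∉ B := by by_contra! h; exact hB (eq_top_iff.2 fun x _ => h x)
  by_cases h1 : a ∈ B
  · by_cases h2 : b ∈ A
    · exact ⟨a * b, fun h => ha ((mul_mem_cancel_right h2).1 h), fun h => hb ((mul_mem_cancel_left h1).1 h)⟩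
    · exact ⟨b, h2, hb⟩
  · exact ⟨a, ha, h1⟩

lemma Nm_ne_top {a : Kˣ} {v : Pl K} (h : a ∉ Sq v) : Nm a v ≠ ⊤ := fun h' => by
  have := index_Nm h; rw [h', Subgroup.index_top] at this; omega

lemma Rpv.of_nsq {v : Pl K} {a b d : Kˣ} (hd : d ∉ Sq v) : Rpv v a b d := by
  by_cases hb : b ∈ Nm a v
  · exact Rpv.of_Nm hb _
  have ha : a ∉ Sq v := fun h => hb (by rw [Nm_top h]; trivial)
  obtain ⟨e, he, hed⟩ := exists_not_mem_two (Nm_ne_top ha) (Nm_ne_top hd)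
  have h1 := mul_mem_Nm he hb
  rw [Nm_comm] at he hed
  obtain ⟨x, y, h2⟩ := mul_mem_Nm hed he
  obtain ⟨z, w, h1⟩ := h1
  refine ⟨x / algebraMap K v.C a, algebraMap K v.C a * w * y / (algebraMap K v.C a * algebraMap K v.C b),
    z * y / (algebraMap K v.C a * algebraMap K v.C b), ?_⟩
  have ha0 : algebraMap K v.C a ≠ 0 := by simp
  have hb0 : algebraMap K v.C b ≠ 0 := by simp
  simp only [Units.coe_map, MonoidHom.coe_coe, map_mul, Units.val_mul] at h1 h2
  have h1 : z ^ 2 - algebraMap K v.C a * w ^ 2 = algebraMap K v.C e * algebraMap K v.C b := h1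
  have h2 : x ^ 2 - algebraMap K v.C e * y ^ 2 = algebraMap K v.C d * algebraMap K v.C a := h2
  field_simp
  linear_combination algebraMap K v.C b * h2 - y ^ 2 * h1

lemma Rpv.loc {a b : Kˣ} {e : K} (he : e ≠ 0) (h : ∀ v : Pl K, Rpv v a b (e ^ 2)) :
    b ∈ NF (a : K) := hasse_norm fun v => by
  have := h v
  rw [Rpv, map_pow] at this
  exact Rp.sq (F := v.C) (a := Units.map (algebraMap K v.C : K →* v.C) a)
    (b := Units.map (algebraMap K v.C : K →* v.C) b) (by simpa using he) this

theorem Rp.hasse {K : Type u} [Field K] [NumberField K] {a b d : Kˣ} (h : ∀ v : Pl K, Rpv v a b d) :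
    Rp (a : K) b d := by
  by_cases hs : IsSquare (d : K)
  · obtain ⟨e, he⟩ := hs
    rw [← pow_two] at he
    rw [he] at h
    exact Rp.of_NF (Rpv.loc (e := e) (by rintro rfl; simp at he) h) _
  obtain ⟨L, _, _, ι, s, τ, Q⟩ := exists_quad d hs
  have h1 := Rpv.loc (a := Units.map (ι : K →* L) a) (b := Units.map (ι : K →* L) b) Q.s_ne fun w => by
    obtain ⟨v, hv⟩ := ov_exists ι w
    obtain ⟨f, -, hf⟩ := hv.hom
    have := (h v).map f
    rw [hf, hf, hf, ← Q.hs] at this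
    exact this
  obtain ⟨y, x, h1⟩ := h1
  have h1 : y ^ 2 - ι a * x ^ 2 = ι b := h1
  obtain ⟨x0, x1, rfl⟩ := Q.dec x
  obtain ⟨y0, y1, rfl⟩ := Q.dec y
  -- isotropic vector (b, a x, y)
  have hss := Q.hs
  have li : ∀ r t : K, ι r + ι t * s = 0 → r = 0 ∧ t = 0 := fun r t h => by
    have h' := congrArg τ h
    rw [map_add, map_mul, Q.hτ, Q.hτ, Q.hτs, map_zero] at h'
    have e1 : (2 : L) * ι t * s = 0 := by linear_combination h - h'
    have e2 : ι t = 0 := by simpa [Q.s_ne] using e1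
    rw [e2, zero_mul, add_zero] at h
    exact ⟨by simpa using h, by simpa using e2⟩
  have e := li (y0 ^ 2 + d * y1 ^ 2 - a * (x0 ^ 2 + d * x1 ^ 2) - b) (2 * (y0 * y1 - a * x0 * x1)) (by
    simp only [map_add, map_sub, map_mul, map_pow, map_ofNat]
    linear_combination h1 - ((ι y1) ^ 2 - ι a * ι x1 ^ 2) * hss)
  obtain ⟨e1, e2⟩ := e
  have e2 : y0 * y1 - a * x0 * x1 = 0 := by simpa using e2
  by_cases hq : (b : K) * (a * x1) ^ 2 - a * b * y1 ^ 2 = 0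
  · refine Rp.univ a.ne_zero b.ne_zero (x := b) (y := a * x0) (z := y0) (fun h => b.ne_zero h.1) ?_ d
    linear_combination (-a * b : K) * e1 - d * hq
  · have id : (a : K) * (-b * (a * x0 * y1 - y0 * (a * x1))) ^ 2 + b * (-a * (- b * y1)) ^ 2 -
        a * b * (b * (a * x1)) ^ 2 = d * ((b : K) * (a * x1) ^ 2 - a * b * y1 ^ 2) ^ 2 := by
      linear_combination (a * b * ((b : K) * (a * x1) ^ 2 - a * b * y1 ^ 2)) * e1 +
        (a ^ 2 * b ^ 2 : K) * (y0 * y1 - a * x0 * x1) * e2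
    generalize (b : K) * (a * x1) ^ 2 - a * b * y1 ^ 2 = q at hq id
    refine ⟨-b * (a * x0 * y1 - y0 * (a * x1)) / q, -a * (- b * y1) / q, b * (a * x1) / q, ?_⟩
    rw [div_pow, div_pow, div_pow, ← mul_div_assoc, ← mul_div_assoc, ← mul_div_assoc, ← add_div, ← sub_div,
      id, mul_div_assoc, div_self (pow_ne_zero 2 hq), mul_one]

/-- ternary forms: local-global principle with one exempt place -/
theorem rep3_hasse {a b c d : Kˣ} (v₀ : Pl K) (h0 : -(a * b * c * d) ∉ Sq v₀)
    (h : ∀ v, v ≠ v₀ → Rep3 (algebraMap K v.C a) (algebraMap K v.C b) (algebraMap K v.C c)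
      (algebraMap K v.C d)) : Rep3 (a : K) b c d := by
  rw [rep3_iff a.ne_zero b.ne_zero c.ne_zero]
  refine Rp.hasse (a := -(b * c)) (b := -(a * c)) (d := -(a * b * c * d)) fun v => ?_
  by_cases hv : v = v₀
  · rw [hv]; exact Rpv.of_nsq h0
  · have := (rep3_iff (by simp) (by simp) (by simp) _).1 (h v hv)
    simpa [Rpv] using this

lemma rep3_unit {a b c : Kˣ} (d : K) (p : HeightOneSpectrum (𝓞 K)) (h2 : e2 p = 0) (ha : od p a = 0)
    (hb : od p b = 0) (hc : od p c = 0) : Rep3 (algebraMap K (Pl.fin p).C a)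
      (algebraMap K (Pl.fin p).C b) (algebraMap K (Pl.fin p).C c) (algebraMap K (Pl.fin p).C d) := by
  rw [rep3_iff (by simp) (by simp) (by simp)]
  have := Rpv.of_Nm (unit_mem_Nm p h2 (a := -(b * c)) (b := -(a * c)) (by rw [od_neg, od_mul, hb, hc]; rfl)
    (by rw [od_neg, od_mul, ha, hc]; rfl)) (-(a * b * c * d) : K)
  simpa [Rpv] using this
end HM

namespace HM
open NumberField IsDedekindDomain Matrix

section field
variable {F : Type*} [Field F] {ι κ μ : Type*} [Fintype ι] [Fintype κ] [Fintype μ]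
  [DecidableEq ι] [DecidableEq κ] [DecidableEq μ]

/-- congruence of matrices -/
def Cg (M : Matrix ι ι F) (N : Matrix κ κ F) : Prop := ∃ P : Matrix ι κ F, Pᵀ * M * P = N

lemma Cg.trans {M : Matrix ι ι F} {N : Matrix κ κ F} {R : Matrix μ μ F} (h : Cg M N) (h' : Cg N R) :
    Cg M R := by
  obtain ⟨P, rfl⟩ := h
  obtain ⟨Q, rfl⟩ := h'
  exact ⟨P * Q, by rw [transpose_mul]; simp only [Matrix.mul_assoc]⟩

lemma Cg.map {F' : Type*} [Field F'] (f : F →+* F') {M : Matrix ι ι F} {N : Matrix κ κ F} (h : Cg M N) :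
    Cg (M.map f) (N.map f) := by
  obtain ⟨P, rfl⟩ := h
  exact ⟨P.map f, by rw [← Matrix.transpose_map, Matrix.map_mul, Matrix.map_mul]⟩

lemma Cg.symm {M : Matrix ι ι F} {N : Matrix κ κ F} (hc : Fintype.card ι = Fintype.card κ)
    (hN : N.det ≠ 0) (h : Cg M N) : Cg N M := by
  obtain ⟨P, hP⟩ := h
  have h1 : N⁻¹ * Pᵀ * M * P = 1 := by
    rw [Matrix.mul_assoc, Matrix.mul_assoc, ← Matrix.mul_assoc Pᵀ, hP, nonsing_inv_mul _ hN.isUnit]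
  have h2 : P * (N⁻¹ * Pᵀ * M) = 1 := (Matrix.mul_eq_one_comm_of_card_eq _ _ _ hc).2 h1
  refine ⟨N⁻¹ * Pᵀ * M, ?_⟩
  generalize N⁻¹ * Pᵀ * M = Q at h2
  rw [← hP]
  calc Qᵀ * (Pᵀ * M * P) * Q = (P * Q)ᵀ * M * (P * Q) := by
        rw [transpose_mul]; simp only [Matrix.mul_assoc]
    _ = M := by rw [h2]; simp

lemma Cg.rep {M : Matrix ι ι F} {N : Matrix κ κ F} {c : F} (h : Cg M N) (hc : ∃ x, x ⬝ᵥ N *ᵥ x = c) :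
    ∃ x, x ⬝ᵥ M *ᵥ x = c := by
  obtain ⟨P, rfl⟩ := h
  obtain ⟨x, rfl⟩ := hc
  exact ⟨P *ᵥ x, by
    rw [← mulVec_mulVec, ← mulVec_mulVec, dotProduct_mulVec x, ← mulVec_transpose, transpose_transpose]⟩

lemma Cg.det {M N : Matrix ι ι F} (h : Cg M N) : ∃ p, N.det = M.det * p ^ 2 := by
  obtain ⟨P, rfl⟩ := h
  exact ⟨P.det, by rw [det_mul, det_mul, det_transpose]; ring⟩

lemma Cg.submatrix (M : Matrix ι ι F) (e : κ ≃ ι) : Cg M (M.submatrix e e) :=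
  ⟨(1 : Matrix ι ι F).submatrix id e, by
    rw [transpose_submatrix, transpose_one]
    ext i j; simp [Matrix.mul_apply, Matrix.one_apply]⟩

/-- orthogonal sum with a rank one form -/
def ds (c : F) (N : Matrix κ κ F) : Matrix (Unit ⊕ κ) (Unit ⊕ κ) F := fromBlocks (c • 1) 0 0 N

lemma det_ds (c : F) (N : Matrix κ κ F) : (ds c N).det = c * N.det := by
  rw [ds, det_fromBlocks_zero₂₁]; simp

lemma ds_map {F' : Type*} [Field F'] (f : F →+* F') (c : F) (N : Matrix κ κ F) :
    (ds c N).map f = ds (f c) (N.map f) := by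
  ext (i | i) (j | j) <;> simp [ds]

lemma Cg.ds {M : Matrix ι ι F} {N : Matrix κ κ F} (c : F) (h : Cg M N) : Cg (ds c M) (HM.ds c N) := by
  obtain ⟨P, rfl⟩ := h
  exact ⟨fromBlocks 1 0 0 P, by
    rw [fromBlocks_transpose, HM.ds, HM.ds, fromBlocks_multiply, fromBlocks_multiply]; simp⟩

lemma ds_rep (c : F) (N : Matrix κ κ F) (a d : F) (h : ∃ x, x ⬝ᵥ N *ᵥ x = d) :
    ∃ x, x ⬝ᵥ ds c N *ᵥ x = c * a ^ 2 + d := by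
  obtain ⟨x, rfl⟩ := h
  refine ⟨Sum.elim (fun _ => a) x, ?_⟩
  rw [ds, fromBlocks_mulVec]
  simp [dotProduct, smul_mulVec]; ring

lemma rep_ds {c : F} {N : Matrix κ κ F} {d : F} (h : ∃ x, x ⬝ᵥ ds c N *ᵥ x = d) :
    ∃ a y, c * a ^ 2 + y ⬝ᵥ N *ᵥ y = d := by
  obtain ⟨x, rfl⟩ := h
  refine ⟨x (.inl ()), fun i => x (.inr i), ?_⟩
  rw [ds, ← Sum.elim_comp_inl_inr x, fromBlocks_mulVec]
  simp [dotProduct, Function.comp_def, smul_mulVec]; ring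

lemma Cg.cancel {c : F} (hc : c ≠ 0) [NeZero (2 : F)] {N : Matrix ι ι F} {N' : Matrix κ κ F}
    (h : Cg (HM.ds c N) (HM.ds c N')) : Cg N N' := by
  obtain ⟨P, h⟩ := h
  rw [← fromBlocks_toBlocks P] at h
  generalize P.toBlocks₁₁ = p, P.toBlocks₁₂ = r, P.toBlocks₂₁ = s, P.toBlocks₂₂ = T at h
  obtain ⟨t, rfl⟩ : ∃ t : F, p = t • 1 := ⟨p () (), by ext; simp⟩
  rw [fromBlocks_transpose, HM.ds, HM.ds, fromBlocks_multiply, fromBlocks_multiply, fromBlocks_inj] at h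
  obtain ⟨h1, h2, h3, h4⟩ := h
  simp only [transpose_smul, transpose_one, Matrix.mul_zero, Matrix.smul_mul, Matrix.one_mul, zero_add,
    add_zero, Matrix.mul_smul, Matrix.mul_one] at h1 h2 h3 h4
  obtain ⟨k, hk⟩ : ∃ k : F, -1 + 2 * k * t + k ^ 2 * (1 - t ^ 2) = 0 := by
    by_cases ht : t + 1 = 0
    · have : t = -1 := by linear_combination ht
      have h2 : (2 : F) ≠ 0 := NeZero.ne _
      exact ⟨-1 / 2, by rw [this]; field_simp; ring⟩
    · exact ⟨1 / (t + 1), by field_simp; ring⟩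
  refine ⟨T - k • (s * r), ?_⟩
  have e1 : sᵀ * N * s = (c - c * t ^ 2) • 1 := by
    rw [sub_smul, ← h1]; ext; simp; ring
  have e2 : sᵀ * N * T = -((c * t) • r) := by
    rw [eq_neg_iff_add_eq_zero, ← h2, add_comm]; congr 1; simp [smul_smul, mul_comm]
  have e3 : Tᵀ * N * s = -((c * t) • rᵀ) := by
    rw [eq_neg_iff_add_eq_zero, ← h3, add_comm]; congr 1; simp [smul_smul, mul_comm]
  have e4 : Tᵀ * N * T = N' - c • (rᵀ * r) := by rw [← h4]; simp
  calc _ = Tᵀ * N * T - k • (Tᵀ * N * s * r) - k • (rᵀ * (sᵀ * N * T)) +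
        k ^ 2 • (rᵀ * (sᵀ * N * s) * r) := by
        simp only [transpose_sub, transpose_smul, transpose_mul, Matrix.sub_mul, Matrix.mul_sub,
          Matrix.smul_mul, Matrix.mul_smul, Matrix.mul_assoc, smul_sub, smul_smul, sq]
        abel
    _ = N' + (c * (-1 + 2 * k * t + k ^ 2 * (1 - t ^ 2))) • (rᵀ * r) := by
        rw [e1, e2, e3, e4]
        simp only [Matrix.mul_smul, Matrix.smul_mul, Matrix.mul_one, Matrix.neg_mul, Matrix.mul_neg,
          smul_neg, smul_smul]
        module
    _ = N' := by rw [hk]; simp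

lemma exists_rep [NeZero (2 : F)] [Nonempty ι] {M : Matrix ι ι F} (hs : M.IsSymm) (hd : M.det ≠ 0) :
    ∃ c ≠ 0, ∃ x, x ⬝ᵥ M *ᵥ x = c := by
  by_contra hc
  push Not at hc
  have h1 : ∀ x, x ⬝ᵥ M *ᵥ x = 0 := fun x => by
    by_contra h; exact hc _ h x rfl
  have h2 : M = 0 := by
    ext i j
    have e : ∀ k, M k k = 0 := fun k => by simpa using h1 (Pi.single k 1)
    have := h1 (Pi.single i 1 + Pi.single j 1)
    simp only [mulVec_add, add_dotProduct, dotProduct_add, single_one_dotProduct, mulVec_single_one,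
      col_apply, e] at this
    rw [hs.apply j i] at this
    have h3 : (2 : F) * M j i = 0 := by linear_combination this
    rw [hs.apply j i]
    simpa [NeZero.ne (2 : F)] using h3
  rw [h2, Matrix.det_zero] at hd
  exact hd rfl

lemma Cg.isSymm {M : Matrix ι ι F} {N : Matrix κ κ F} (h : Cg M N) (hM : M.IsSymm) : N.IsSymm := by
  obtain ⟨P, rfl⟩ := h
  rw [IsSymm, transpose_mul, transpose_mul, transpose_transpose, hM.eq, Matrix.mul_assoc]

/-- splitting off a represented value -/
lemma split_rep {n : ℕ} {M : Matrix ι ι F} (hs : M.IsSymm) (hd : M.det ≠ 0) (hn : Fintype.card ι = n + 1)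
    {c : F} (hc : c ≠ 0) (h : ∃ x, x ⬝ᵥ M *ᵥ x = c) :
    ∃ N : Matrix (Fin n) (Fin n) F, N.IsSymm ∧ N.det ≠ 0 ∧ Cg M (ds c N) ∧ Cg (ds c N) M := by
  obtain ⟨x, hx⟩ := h
  obtain ⟨i, hi⟩ : ∃ i, x i ≠ 0 := by
    by_contra! h
    exact hc (by rw [← hx, show x = 0 from funext h]; simp)
  obtain ⟨e, he⟩ : ∃ e : Unit ⊕ Fin n ≃ ι, e (.inl ()) = i := by
    have e0 : Unit ⊕ Fin n ≃ ι := Fintype.equivOfCardEq (by simp [hn, add_comm])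
    exact ⟨e0.trans (Equiv.swap (e0 (.inl ())) i), by simp⟩
  have hdd : ∀ {N : Matrix (Unit ⊕ Fin n) (Unit ⊕ Fin n) F}, Cg N M → Cg M N → N.det ≠ 0 := by
    intro N ⟨P, hP⟩ _ h0
    have h1 : M.submatrix e e = (P.submatrix id e)ᵀ * N * P.submatrix id e := by
      rw [← hP, transpose_submatrix]; ext i j; simp [Matrix.mul_apply]
    have := congrArg Matrix.det h1
    rw [det_submatrix_equiv_self, det_mul, det_mul, h0] at this
    exact hd (by simpa using this)
  -- first column x
  let A : Matrix (Unit ⊕ Fin n) (Unit ⊕ Fin n) F :=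
    fromBlocks (x i • 1) 0 (of fun j _ => x (e (.inr j))) 1
  have hA : A.det = x i := by simp [A, det_fromBlocks_zero₁₂]
  set M2 := Aᵀ * M.submatrix e e * A with hM2
  have hc1 : Cg M M2 := (Cg.submatrix M e).trans ⟨A, rfl⟩
  have hd2 : M2.det ≠ 0 := by
    rw [hM2, det_mul, det_mul, det_transpose, hA, det_submatrix_equiv_self]
    exact mul_ne_zero (mul_ne_zero hi hd) hi
  have hs2 := hc1.isSymm hs
  have hcc : Fintype.card ι = Fintype.card (Unit ⊕ Fin n) := by simp [hn, add_comm]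
  have h11 : M2.toBlocks₁₁ = c • 1 := by
    have hcol : A *ᵥ Pi.single (.inl ()) 1 = x ∘ e := by
      rw [mulVec_single_one]
      ext (j | j)
      · simp [A, he]
      · simp [A]
    ext a b
    have : M2 (.inl ()) (.inl ()) = c := by
      have h1 : Pi.single (.inl ()) (1 : F) ⬝ᵥ M2 *ᵥ Pi.single (.inl ()) 1 = M2 (.inl ()) (.inl ()) := by simp
      rw [← h1, hM2, ← mulVec_mulVec, ← mulVec_mulVec, dotProduct_mulVec, ← mulVec_transpose,
        transpose_transpose, hcol, ← hx, submatrix_mulVec_equiv]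
      rw [show (x ∘ e) ∘ e.symm = x by ext; simp]
      exact Equiv.sum_comp e (fun j => x j * (M *ᵥ x) j)
    simpa [toBlocks₁₁] using this
  have h21 : M2.toBlocks₂₁ = M2.toBlocks₁₂ᵀ := by
    ext a b; exact (hs2.apply (.inr a) (.inl b)).symm
  let C : Matrix Unit Unit F := c • 1
  letI : Invertible C := ⟨c⁻¹ • 1, by simp [C, hc], by simp [C, hc]⟩
  have hM2' : M2 = fromBlocks C M2.toBlocks₁₂ M2.toBlocks₁₂ᵀ M2.toBlocks₂₂ := by
    rw [← h21, show C = M2.toBlocks₁₁ from h11.symm, fromBlocks_toBlocks]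
  have key := fromBlocks_eq_of_invertible₁₁ C M2.toBlocks₁₂ M2.toBlocks₁₂ᵀ M2.toBlocks₂₂
  rw [← hM2'] at key
  set N := M2.toBlocks₂₂ - M2.toBlocks₁₂ᵀ * ⅟C * M2.toBlocks₁₂
  have hc2 : Cg (ds c N) M2 := by
    refine ⟨fromBlocks 1 (⅟C * M2.toBlocks₁₂) 0 1, ?_⟩
    refine Eq.trans ?_ key.symm
    have hT : (⅟C)ᵀ = ⅟C := by
      change (c⁻¹ • (1 : Matrix Unit Unit F))ᵀ = c⁻¹ • 1
      simp
    rw [fromBlocks_transpose, transpose_mul, hT, transpose_one, transpose_one, transpose_zero, ds]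
  have hc3 : Cg (ds c N) M := hc2.trans (hc1.symm hcc hd2)
  have hc4 : Cg M (ds c N) := hc3.symm hcc.symm hd
  have hdN := hdd hc3 hc4
  have hsN := hc4.isSymm hs
  rw [det_ds] at hdN
  refine ⟨N, ?_, fun h => hdN (by rw [h, mul_zero]), hc4, hc3⟩
  ext a b
  exact hsN.apply (.inr a) (.inr b)
end field
end HM

namespace HM
open NumberField IsDedekindDomain Matrix
variable {K : Type*} [Field K] [NumberField K]

/-- localization of a matrix -/
noncomputable abbrev lm {ι κ : Type*} (v : Pl K) (M : Matrix ι κ K) : Matrix ι κ v.C := M.map (algebraMap K v.C)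

lemma det_lm {ι : Type*} [Fintype ι] [DecidableEq ι] (v : Pl K) (M : Matrix ι ι K) :
    (lm v M).det = algebraMap K v.C M.det := ((algebraMap K v.C).map_det M).symm

lemma rep_map {ι F F' : Type*} [Fintype ι] [Field F] [Field F'] (f : F →+* F') (M : Matrix ι ι F) (x : ι → F) :
    (f ∘ x) ⬝ᵥ (M.map f) *ᵥ (f ∘ x) = f (x ⬝ᵥ M *ᵥ x) := by
  simp [dotProduct, mulVec, map_sum]

lemma lm_rep {ι : Type*} [Fintype ι] (v : Pl K) {M : Matrix ι ι K} {c : K} (h : ∃ x, x ⬝ᵥ M *ᵥ x = c) :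
    ∃ x, x ⬝ᵥ (lm v M) *ᵥ x = algebraMap K v.C c := by
  obtain ⟨x, rfl⟩ := h
  exact ⟨_, rep_map _ _ _⟩

lemma approx_rep {ι : Type*} [Fintype ι] {M : Matrix ι ι K} {S : Finset (Pl K)} (hS : S.Nonempty) {a : Kˣ}
    (h : ∀ v ∈ S, ∃ x, x ⬝ᵥ (lm v M) *ᵥ x = algebraMap K v.C a) :
    ∃ b : Kˣ, (∃ x, x ⬝ᵥ M *ᵥ x = b) ∧ ∀ v ∈ S, b / a ∈ Sq v := by
  classical
  have h' : ∀ v : Pl K, ∃ x, v ∈ S → x ⬝ᵥ (lm v M) *ᵥ x = algebraMap K v.C a := fun v => by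
    by_cases hv : v ∈ S
    · obtain ⟨x, hx⟩ := h v hv; exact ⟨x, fun _ => hx⟩
    · exact ⟨0, fun h => absurd h hv⟩
  choose z hz using h'
  choose δ h0 hδ using sq_of_close (K := K)
  have hc : ∀ v ∈ S, ∃ ε > 0, ∀ x : ι → v.C, (∀ i, ‖x i - z v i‖ < ε) →
      ‖x ⬝ᵥ (lm v M) *ᵥ x - algebraMap K v.C a‖ < min (δ v) 1 * v.abs (a : K) := by
    intro v hv
    have hp : 0 < min (δ v) 1 * v.abs (a : K) :=
      mul_pos (lt_min (h0 v) one_pos) (v.abs.pos a.ne_zero)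
    have hcont : Continuous fun x : ι → v.C => x ⬝ᵥ (lm v M) *ᵥ x := by
      simp only [dotProduct, mulVec]; fun_prop
    obtain ⟨ε, hε, H⟩ := Metric.continuousAt_iff.1 (hcont.continuousAt (x := z v)) _ hp
    refine ⟨ε, hε, fun x hx => ?_⟩
    have := H ((dist_pi_lt_iff hε).2 fun i => by rw [dist_eq_norm]; exact hx i)
    rwa [dist_eq_norm, hz v hv] at this
  choose! ε hε H using hc
  have hm : 0 < S.inf' hS ε := by rw [Finset.lt_inf'_iff]; exact hε
  have hx : ∀ i, ∃ x : K, ∀ v ∈ S, ‖algebraMap K v.C x - z v i‖ < S.inf' hS ε :=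
    fun i => weak_approxC S (fun v => z v i) hm
  choose x hx using hx
  have key : ∀ v ∈ S, v.abs (x ⬝ᵥ M *ᵥ x - a) < min (δ v) 1 * v.abs (a : K) := fun v hv => by
    have := H v hv (algebraMap K v.C ∘ x) fun i => (hx i v hv).trans_le (Finset.inf'_le _ hv)
    rw [lm, rep_map] at this
    rwa [← map_sub, norm_alg] at this
  have hb : x ⬝ᵥ M *ᵥ x ≠ 0 := fun h => by
    obtain ⟨v, hv⟩ := hS
    have := key v hv
    rw [h, zero_sub, map_neg_eq_map] at this
    have h1 : min (δ v) 1 * v.abs (a : K) ≤ 1 * v.abs (a : K) :=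
      mul_le_mul_of_nonneg_right (min_le_right _ _) (apply_nonneg _ _)
    linarith
  refine ⟨Units.mk0 _ hb, ⟨x, rfl⟩, fun v hv => hδ v _ ?_⟩
  have h2 := key v hv
  have h3 : v.abs ((Units.mk0 _ hb / a : Kˣ) - 1) * v.abs (a : K) = v.abs (x ⬝ᵥ M *ᵥ x - a) := by
    rw [← map_mul]; congr 1
    rw [Units.val_div_eq_div_val, Units.val_mk0]; field_simp
  rw [← h3] at h2
  exact (lt_of_mul_lt_mul_right h2 (apply_nonneg _ _)).trans_le (min_le_left _ _)

lemma three {F : Type*} [Field F] [NeZero (2 : F)] {n : ℕ} {M : Matrix (Fin (n + 3)) (Fin (n + 3)) F} (hs : M.IsSymm) (hd : M.det ≠ 0)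
    {a : Fˣ} (h : ∃ x, x ⬝ᵥ M *ᵥ x = (a : F)) :
    ∃ b c : Fˣ, ∀ d, Rep3 (a : F) b c d → ∃ x, x ⬝ᵥ M *ᵥ x = d := by
  obtain ⟨N, hN, hNd, hM, -⟩ := split_rep (n := n + 2) hs hd (by simp) a.ne_zero h
  obtain ⟨b, hb, hbN⟩ := exists_rep hN hNd
  obtain ⟨N2, hN2, hNd2, hM2, -⟩ := split_rep (n := n + 1) hN hNd (by simp) hb hbN
  obtain ⟨c, hc, x, hx⟩ := exists_rep hN2 hNd2
  refine ⟨Units.mk0 b hb, Units.mk0 c hc, fun d ⟨r, s, t, hd⟩ => hM.rep ?_⟩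
  have := ds_rep (a : F) N r _ (hM2.rep (ds_rep b N2 s _ ⟨t • x, rfl⟩))
  convert this using 3
  rw [← hd, mulVec_smul, dotProduct_smul, smul_dotProduct, hx]
  simp; ring

lemma rep3_of_sq {v : Pl K} {a b c d : Kˣ} (h : d / a ∈ Sq v) : Rep3 (algebraMap K v.C a)
    (algebraMap K v.C b) (algebraMap K v.C c) (algebraMap K v.C d) := by
  obtain ⟨r, hr⟩ := h
  refine ⟨r, 0, 0, ?_⟩
  rw [pow_two, ← hr, ← map_mul, ← Units.val_mul, mul_div_cancel]; simp

lemma common3 (p₀ : HeightOneSpectrum (𝓞 K)) {n : ℕ} {M N : Matrix (Fin (n + 3)) (Fin (n + 3)) K} (hM : M.IsSymm) (hN : N.IsSymm)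
    (hMd : M.det ≠ 0) (hNd : N.det ≠ 0) (h : ∀ v, v ≠ .fin p₀ → Cg (lm v M) (lm v N)) :
    ∃ c ≠ 0, (∃ x, x ⬝ᵥ M *ᵥ x = c) ∧ (∃ x, x ⬝ᵥ N *ᵥ x = c) := by
  classical
  obtain ⟨a0, ha0, haM⟩ := exists_rep hM hMd
  obtain ⟨a, rfl⟩ : ∃ a : Kˣ, (a : K) = a0 := ⟨Units.mk0 a0 ha0, rfl⟩
  obtain ⟨a2, a3, hA⟩ := three hM hMd haM
  obtain ⟨S', GA1⟩ := exists_good a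
  obtain ⟨T2, GA2⟩ := exists_good a2
  obtain ⟨T3, GA3⟩ := exists_good a3
  set S := S' ∪ T2 ∪ T3 with hS
  obtain ⟨w⟩ : Nonempty (InfinitePlace K) := inferInstance
  have hwS : Pl.inf w ∈ S.erase (.fin p₀) := by
    have := GA1.inf w
    simp [hS, this]
  obtain ⟨b, hbN, hb⟩ := approx_rep (M := N) ⟨_, hwS⟩ (a := a) fun v hv =>
    ((h v (Finset.ne_of_mem_erase hv)).symm rfl (by rw [det_lm]; simpa using hNd)).rep (lm_rep v haM)
  obtain ⟨b2, b3, hB⟩ := three hN hNd hbN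
  obtain ⟨R1, GB1⟩ := exists_good b
  obtain ⟨R2, GB2⟩ := exists_good b2
  obtain ⟨R3, GB3⟩ := exists_good b3
  set S2 := S ∪ R1 ∪ R2 ∪ R3 ∪ {.fin p₀} with hS2
  obtain ⟨c0, hc1, hc2⟩ := exists_two_ns p₀ (-(a * a2 * a3)) (-(b * b2 * b3))
  obtain ⟨c, hc, -⟩ := approxS S2 fun v => if v = .fin p₀ then c0 else if v ∈ S then a else b
  have hc0 : c / c0 ∈ Sq (.fin p₀) := by simpa using hc (.fin p₀) (by simp [hS2])
  have hns : ∀ D : Kˣ, c0 * -D ∉ Sq (.fin p₀) → -(D * c) ∉ Sq (.fin p₀) := fun D hD h => hD <| by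
    have := div_mem h hc0
    convert this using 1
    rw [div_div_eq_mul_div, eq_div_iff_mul_eq']
    ext; push_cast; ring
  refine ⟨c, c.ne_zero, hA _ (rep3_hasse (.fin p₀) (hns _ hc1) fun v hv => ?_),
    hB _ (rep3_hasse (.fin p₀) (hns _ hc2) fun v hv => ?_)⟩
  · by_cases hvS : v ∈ S
    · have := hc v (by simp [hS2, hvS])
      rw [if_neg hv, if_pos hvS] at this
      exact rep3_of_sq this
    · cases v with
      | inf v => exact absurd (by simp [hS, GA1.inf v]) hvS
      | fin p =>
        simp only [hS, Finset.mem_union, not_or] at hvS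
        exact rep3_unit _ p (GA1.two p hvS.1.1) (GA1.od p hvS.1.1) (GA2.od p hvS.1.2) (GA3.od p hvS.2)
  · by_cases hvS : v ∈ S2
    · have := hc v hvS
      rw [if_neg hv] at this
      split_ifs at this with h1
      · have h2 := hb v (Finset.mem_erase.2 ⟨hv, h1⟩)
        exact rep3_of_sq (by simpa using div_mem this h2)
      · exact rep3_of_sq this
    · cases v with
      | inf v => exact absurd (by simp [hS2, hS, GA1.inf v]) hvS
      | fin p =>
        simp only [hS2, Finset.mem_union, not_or] at hvS
        exact rep3_unit _ p (GB1.two p hvS.1.1.1.2) (GB1.od p hvS.1.1.1.2) (GB2.od p hvS.1.1.2)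
          (GB3.od p hvS.1.2)

lemma common1 (p₀ : HeightOneSpectrum (𝓞 K)) {M N : Matrix (Fin 1) (Fin 1) K}
    (hMd : M.det ≠ 0) (hNd : N.det ≠ 0) (h : ∀ v, v ≠ .fin p₀ → Cg (lm v M) (lm v N)) :
    ∃ c ≠ 0, (∃ x, x ⬝ᵥ M *ᵥ x = c) ∧ (∃ x, x ⬝ᵥ N *ᵥ x = c) := by
  by_cases hs : IsSquare ((Units.mk0 _ hNd / Units.mk0 _ hMd : Kˣ) : K)
  · obtain ⟨r, hr⟩ := hs
    have hr' : N.det = M.det * (r * r) := by rw [← hr, Units.val_div_eq_div_val, Units.val_mk0, Units.val_mk0]; field_simp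
    rw [det_fin_one] at hNd; rw [det_fin_one, det_fin_one] at hr'
    refine ⟨N 0 0, hNd, ⟨fun _ => r, ?_⟩, ⟨fun _ => 1, ?_⟩⟩
    · simp [dotProduct, mulVec, hr']; ring
    · simp [dotProduct, mulVec]
  · obtain ⟨p, hp, hn⟩ := exists_ns hs {.fin p₀}
    obtain ⟨q, hq⟩ := (h (.fin p) (by simpa using hp)).det
    refine absurd ⟨q, ?_⟩ hn
    rw [det_lm, det_lm] at hq
    rw [Units.val_div_eq_div_val, map_div₀, Units.val_mk0, Units.val_mk0, hq]
    have : algebraMap K (Pl.fin p).C M.det ≠ 0 := by simpa using hMd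
    field_simp

lemma common2 (p₀ : HeightOneSpectrum (𝓞 K)) {M N : Matrix (Fin 2) (Fin 2) K} (hM : M.IsSymm) (hN : N.IsSymm)
    (hMd : M.det ≠ 0) (hNd : N.det ≠ 0) (h : ∀ v, v ≠ .fin p₀ → Cg (lm v M) (lm v N)) :
    ∃ c ≠ 0, (∃ x, x ⬝ᵥ M *ᵥ x = c) ∧ (∃ x, x ⬝ᵥ N *ᵥ x = c) := by
  obtain ⟨a0, ha0, haM⟩ := exists_rep hM hMd
  obtain ⟨a, rfl⟩ : ∃ a : Kˣ, (a : K) = a0 := ⟨Units.mk0 a0 ha0, rfl⟩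
  obtain ⟨M', -, hMd', h1, h2⟩ := split_rep (n := 1) hM hMd (by simp) a.ne_zero haM
  rw [det_fin_one] at hMd'
  obtain ⟨b0, hb0, hbN⟩ := exists_rep hN hNd
  obtain ⟨b, rfl⟩ : ∃ a : Kˣ, (a : K) = b0 := ⟨Units.mk0 b0 hb0, rfl⟩
  obtain ⟨d, hd⟩ : ∃ d : Kˣ, (d : K) = M' 0 0 := ⟨Units.mk0 _ hMd', rfl⟩
  refine ⟨b, b.ne_zero, ?_, hbN⟩
  have key : b / a ∈ NF ((-d / a : Kˣ) : K) := norm_one (.fin p₀) fun v hv => by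
    have h3 := (h2.map (algebraMap K v.C)).rep ((h v hv).rep (lm_rep v hbN))
    rw [ds_map] at h3
    obtain ⟨x, y, hxy⟩ := rep_ds h3
    refine ⟨x, y 0, ?_⟩
    have ha : algebraMap K v.C a ≠ 0 := by simp
    simp only [dotProduct, mulVec, Finset.univ_unique, Fin.default_eq_zero, Finset.sum_singleton, map_apply, ← hd] at hxy
    change _ = algebraMap K v.C ((b / a : Kˣ) : K)
    simp only [Units.val_div_eq_div_val, map_div₀, Units.val_neg, map_neg, ← hxy]
    field_simp; ring
  obtain ⟨x, y, hxy⟩ := key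
  refine h1.rep ?_
  convert ds_rep (a : K) M' x _ ⟨fun _ => y, rfl⟩ using 3
  simp only [dotProduct, mulVec, Finset.univ_unique, Fin.default_eq_zero, Finset.sum_singleton, ← hd]
  have : (b : K) = a * ((b / a : Kˣ) : K) := by simp; field_simp
  rw [this, ← hxy]; simp; field_simp; ring

theorem hm (p₀ : HeightOneSpectrum (𝓞 K)) : ∀ {n : ℕ} {M N : Matrix (Fin n) (Fin n) K}, M.IsSymm → N.IsSymm →
    M.det ≠ 0 → N.det ≠ 0 → (∀ v, v ≠ .fin p₀ → Cg (lm v M) (lm v N)) → Cg M N := by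
  intro n
  induction n with
  | zero => intro M N _ _ _ _ _; exact ⟨1, Subsingleton.elim _ _⟩
  | succ n ih =>
    intro M N hM hN hMd hNd h
    obtain ⟨c, hc, h1, h2⟩ : ∃ c ≠ 0, (∃ x, x ⬝ᵥ M *ᵥ x = c) ∧ (∃ x, x ⬝ᵥ N *ᵥ x = c) := by
      match n, M, N, hM, hN, hMd, hNd, h with
      | 0, M, N, hM, hN, hMd, hNd, h => exact common1 p₀ hMd hNd h
      | 1, M, N, hM, hN, hMd, hNd, h => exact common2 p₀ hM hN hMd hNd h
      | n + 2, M, N, hM, hN, hMd, hNd, h => exact common3 p₀ hM hN hMd hNd h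
    obtain ⟨M', hM', hMd', e1, e1'⟩ := split_rep (n := n) hM hMd (by simp) hc h1
    obtain ⟨N', hN', hNd', e2, e2'⟩ := split_rep (n := n) hN hNd (by simp) hc h2
    refine e1.trans (Cg.trans (Cg.ds c (ih hM' hN' hMd' hNd' fun v hv => ?_)) e2')
    have := (e1'.map (algebraMap K v.C)).trans ((h v hv).trans (e2.map (algebraMap K v.C)))
    rw [ds_map, ds_map] at this
    exact Cg.cancel (by simpa using hc) this
end HM

namespace HM
open NumberField IsDedekindDomain Matrix
variable {K : Type*} [Field K] [NumberField K]

/-- symmetric matrices near a nondegenerate one are congruent to it -/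
lemma near_cg {n : ℕ} (v : Pl K) {M : Matrix (Fin n) (Fin n) v.C} (hs : M.IsSymm) (hd : M.det ≠ 0) :
    ∃ ε > 0, ∀ N : Matrix (Fin n) (Fin n) v.C, N.IsSymm → (∀ i j, ‖N i j - M i j‖ < ε) → Cg M N ∧ N.det ≠ 0 := by
  letI : NormedRing (Matrix (Fin n) (Fin n) v.C) := Matrix.linftyOpNormedRing
  have hcs : @CompleteSpace (Matrix (Fin n) (Fin n) v.C) PseudoMetricSpace.toUniformSpace :=
    (inferInstance : CompleteSpace (Fin n → Fin n → v.C))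
  let W : AddSubgroup (Matrix (Fin n) (Fin n) v.C) :=
    { carrier := {Y | M * Y = Yᵀ * M}
      zero_mem' := by simp
      add_mem' := fun {a b} ha hb => by
        simp only [Set.mem_ofPred_eq] at *; rw [mul_add, ha, hb, transpose_add, add_mul]
      neg_mem' := fun {a} ha => by
        simp only [Set.mem_ofPred_eq] at *; rw [mul_neg, ha, transpose_neg, neg_mul] }
  have hmem : ∀ Y, Y ∈ W ↔ M * Y = Yᵀ * M := fun Y => Iff.rfl
  have htr : Continuous fun Y : Matrix (Fin n) (Fin n) v.C => Yᵀ :=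
    (continuous_id (X := Matrix (Fin n) (Fin n) v.C)).matrix_transpose
  have hW : IsClosed (W : Set (Matrix (Fin n) (Fin n) v.C)) :=
    isClosed_eq (continuous_const.mul continuous_id) (htr.mul continuous_const)
  have h2 : (2 : v.C) ≠ 0 := two_ne_zero
  obtain ⟨δ, h0, H⟩ := exists_sqrt W hW ((2⁻¹ : v.C) • 1)
    (by rw [mul_smul_comm, mul_one, show (2 : Matrix (Fin n) (Fin n) v.C) = (2 : v.C) • 1 by
        rw [← one_add_one_eq_two, ← one_add_one_eq_two, add_smul, one_smul], smul_smul, inv_mul_cancel₀ h2, one_smul])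
    (fun y hy => by
      rw [hmem] at *
      rw [smul_mul_assoc, one_mul, mul_smul_comm, hy, transpose_smul, smul_mul_assoc])
    (fun y hy => by
      rw [hmem] at *
      rw [← mul_assoc, hy, mul_assoc, hy, transpose_mul, mul_assoc])
  have hu : IsUnit M.det := hd.isUnit
  have hpos : 0 < ‖M⁻¹‖ * n + 1 := by positivity
  refine ⟨δ / (‖M⁻¹‖ * n + 1), by positivity, fun N hN hc => ?_⟩
  have hn : ‖N - M‖ ≤ n * (δ / (‖M⁻¹‖ * n + 1)) := by
    rw [Matrix.linfty_opNorm_def]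
    obtain ⟨e0, he0⟩ : ∃ e0 : NNReal, (e0 : ℝ) = δ / (‖M⁻¹‖ * n + 1) := ⟨⟨_, by positivity⟩, rfl⟩
    rw [← he0] at hc ⊢
    have : ∀ i ∈ Finset.univ, (∑ j, ‖(N - M) i j‖₊) ≤ (n * e0 : NNReal) := fun i _ => by
      refine (Finset.sum_le_card_nsmul _ _ e0 (fun j _ => ?_)).trans ?_
      · exact NNReal.coe_le_coe.1 (hc i j).le
      · rw [Finset.card_univ, Fintype.card_fin, nsmul_eq_mul]
    exact_mod_cast (Finset.sup_le this)
  have hT : ‖M⁻¹ * (N - M)‖ < δ := by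
    refine (norm_mul_le _ _).trans_lt ?_
    calc _ ≤ ‖M⁻¹‖ * (n * (δ / (‖M⁻¹‖ * n + 1))) := by gcongr
      _ = δ * ((‖M⁻¹‖ * n) / (‖M⁻¹‖ * n + 1)) := by ring
      _ < δ * 1 := by gcongr; rw [div_lt_one hpos]; linarith
      _ = δ := mul_one δ
  have hMM : M * M⁻¹ = 1 := mul_nonsing_inv _ hu
  have hMM' : M⁻¹ * M = 1 := nonsing_inv_mul _ hu
  obtain ⟨Y, hY, hY1, hYT⟩ := H (M⁻¹ * (N - M)) ((hmem _).2 (by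
    rw [← mul_assoc, hMM, one_mul, transpose_mul, transpose_nonsing_inv, hs.eq, mul_assoc, hMM', mul_one,
      transpose_sub, hN.eq, hs.eq])) hT
  rw [hmem] at hY
  have e1 : (1 + Y)ᵀ * M * (1 + Y) = N := by
    have : (1 + Y)ᵀ * M = M * (1 + Y) := by rw [transpose_add, transpose_one, add_mul, mul_add, hY, one_mul, mul_one]
    rw [this, mul_assoc, hYT, mul_add, ← mul_assoc, hMM]; simp
  have hlt : ‖-Y‖ < 1 := by
    rw [norm_neg]
    refine hY1.trans_lt ?_
    have := norm_nonneg ((2⁻¹ : v.C) • (1 : Matrix (Fin n) (Fin n) v.C))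
    rw [div_lt_one (by positivity)]; linarith
  have hunit : IsUnit (1 + Y) := by simpa using isUnit_one_sub_of_norm_lt_one hlt
  refine ⟨⟨_, e1⟩, ?_⟩
  rw [← e1, det_mul, det_mul, det_transpose]
  have := ((Matrix.isUnit_iff_isUnit_det _).1 hunit).ne_zero
  exact mul_ne_zero (mul_ne_zero this hd) this

/-- version over the base field -/
lemma near_cgK {n : ℕ} (v : Pl K) {M : Matrix (Fin n) (Fin n) K} (hs : M.IsSymm) (hd : M.det ≠ 0) :
    ∃ ε > 0, ∀ N : Matrix (Fin n) (Fin n) K, N.IsSymm → (∀ i j, v.abs (N i j - M i j) < ε) →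
      Cg (lm v M) (lm v N) ∧ N.det ≠ 0 := by
  obtain ⟨ε, h0, h⟩ := near_cg v (M := lm v M) (by rw [IsSymm, ← transpose_map, hs.eq]) (by rw [det_lm]; simpa using hd)
  refine ⟨ε, h0, fun N hN hc => ?_⟩
  have := h (lm v N) (by rw [IsSymm, ← transpose_map, hN.eq]) fun i j => by
    change ‖algebraMap K v.C (N i j) - algebraMap K v.C (M i j)‖ < ε
    rw [← map_sub, norm_alg]; exact hc i j
  refine ⟨this.1, fun h0 => this.2 ?_⟩
  rw [det_lm, h0, map_zero]
end HM

namespace HM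
open NumberField IsDedekindDomain
variable {K : Type*} [Field K] [NumberField K] {F : Type*} [Field F] [NumberField F] [Algebra K F]

lemma fin_lower {ι : Type*} {s : Set ι} (hs : s.Finite) (f : ι → ℝ) (hf : ∀ i ∈ s, 0 < f i) :
    ∃ η > 0, ∀ i ∈ s, η ≤ f i := by
  induction s, hs using Set.Finite.induction_on with
  | empty => exact ⟨1, one_pos, fun i hi => hi.elim⟩
  | insert _ _ ih =>
    obtain ⟨η, h0, h⟩ := ih fun i hi => hf i (Set.mem_insert_of_mem _ hi)
    refine ⟨min η (f _), lt_min h0 (hf _ (Set.mem_insert _ _)), fun i hi => ?_⟩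
    rcases hi with rfl | hi
    · exact min_le_right _ _
    · exact (min_le_left _ _).trans (h i hi)

lemma trace_int (p : HeightOneSpectrum (𝓞 K)) (z : F)
    (hz : ∀ w, Ov (algebraMap K F) w (.fin p) → w.abs z ≤ 1) : (Pl.fin p).abs (Algebra.trace K F z) ≤ 1 := by
  obtain ⟨⟨r, ⟨s, hs⟩⟩, hrs⟩ := IsLocalization.surj (Algebra.algebraMapSubmonoid (𝓞 F) (nonZeroDivisors (𝓞 K))) z
  obtain ⟨s, hs', rfl⟩ := hs
  have hs0 : (s : K) ≠ 0 := by simpa using nonZeroDivisors.ne_zero hs'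
  obtain ⟨x, hx, hx'⟩ := exists_pow_gen p
  set s' : Kˣ := Units.mk0 (s : K) hs0
  have hsn : ∀ q, 0 ≤ od q s' := fun q => (od_nonneg_iff q s').2 (fin_int q s)
  have hc : (1 : ℤ) ≤ classNumber K := by exact_mod_cast (Fintype.card_pos (α := ClassGroup (𝓞 K)))
  set a : Kˣ := s' ^ classNumber K / x ^ (od p s')
  have hap : od p a = 0 := by rw [od_div, od_pow, od_zpow, hx]; ring
  have haq : ∀ q, q ≠ p → od q s' ≤ od q a := fun q hq => by
    rw [od_div, od_pow, od_zpow, hx' q hq]; nlinarith [hsn q]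
  have key : ∀ q : HeightOneSpectrum (𝓞 F), (Pl.fin q).abs (algebraMap K F a * z) ≤ 1 := fun q => by
    obtain ⟨p', hp'⟩ := ov_fin_exists (algebraMap K F) q
    by_cases hpp : p' = p
    · subst hpp
      obtain ⟨e, he, h⟩ := id hp'
      rw [map_mul, h, (od_eq_zero_iff p' a).1 hap, Real.one_rpow, one_mul]
      exact hz _ hp'
    · obtain ⟨e, he, h⟩ := id hp'
      have h1 : (Pl.fin q).abs (algebraMap K F a) ≤ (Pl.fin q).abs (algebraMap K F (s : K)) := by
        rw [h, h]
        exact Real.rpow_le_rpow ((Pl.fin p').abs.nonneg _) ((od_le_iff p' a s').2 (haq p' hpp)) he.le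
      rw [map_mul]
      refine (mul_le_mul_of_nonneg_right h1 ((Pl.fin q).abs.nonneg _)).trans ?_
      rw [← map_mul, mul_comm]
      have : z * algebraMap K F (s : K) = (r : F) := hrs
      rw [this]; exact fin_int q r
  obtain ⟨y, hy⟩ := HeightOneSpectrum.mem_integers_of_valuation_le_one F (algebraMap K F a * z) (fun q => by
    have := (fin_le q (x := algebraMap K F a * z) (y := 1)).1 (by rw [map_one]; exact key q)
    simpa using this)
  have hi : IsIntegral ℤ (Algebra.trace K F (algebraMap K F a * z)) := by
    rw [← hy]; exact Algebra.isIntegral_trace (NumberField.RingOfIntegers.isIntegral_coe y)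
  have := fin_int p ⟨_, hi⟩
  change (Pl.fin p).abs (Algebra.trace K F (algebraMap K F a * z)) ≤ 1 at this
  rwa [← Algebra.smul_def, map_smul, smul_eq_mul, map_mul, (od_eq_zero_iff p a).1 hap, one_mul] at this

lemma trace_close1 (v : Pl K) {ε : ℝ} (hε : 0 < ε) :
    ∃ η > 0, ∀ z : F, (∀ w, Ov (algebraMap K F) w v → w.abs z < η) → v.abs (Algebra.trace K F z) < ε := by
  cases v with
  | fin p =>
    obtain ⟨π, hπ⟩ := exists_od_one p
    have hlt : (Pl.fin p).abs (π : K) < 1 := lt_of_le_of_ne ((od_nonneg_iff p π).1 (by omega))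
      (fun h => by rw [← od_eq_zero_iff] at h; omega)
    obtain ⟨N, hN⟩ := exists_pow_lt_of_lt_one hε hlt
    have hπ0 : algebraMap K F (π ^ N : K) ≠ 0 := by simp
    obtain ⟨η, h0, h⟩ := fin_lower (ov_finite (algebraMap K F) (.fin p)) (fun w => w.abs (algebraMap K F (π ^ N : K)))
      fun w _ => w.abs.pos hπ0
    refine ⟨η, h0, fun z hz => ?_⟩
    have := trace_int p (z / algebraMap K F (π ^ N : K)) fun w hw => by
      rw [map_div₀, div_le_one (w.abs.pos hπ0)]
      exact ((hz w hw).trans_le (h w hw)).le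
    rw [div_eq_mul_inv, mul_comm, ← map_inv₀, ← Algebra.smul_def, map_smul, smul_eq_mul, map_mul, map_inv₀] at this
    have hp : 0 < (Pl.fin p).abs (π ^ N : K) := (Pl.fin p).abs.pos (by simp)
    rw [inv_mul_le_one₀ hp] at this
    rw [map_pow] at this
    exact this.trans_lt hN
  | inf v =>
    letI := v.embedding.toAlgebra
    refine ⟨ε / (Fintype.card (F →ₐ[K] ℂ) + 1), by positivity, fun z hz => ?_⟩
    have h1 : (Pl.inf v).abs (Algebra.trace K F z) = ‖algebraMap K ℂ (Algebra.trace K F z)‖ :=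
      (InfinitePlace.norm_embedding_eq v _).symm
    rw [h1, trace_eq_sum_embeddings ℂ]
    calc _ ≤ ∑ s : F →ₐ[K] ℂ, ε / (Fintype.card (F →ₐ[K] ℂ) + 1) := by
          refine norm_sum_le_of_le _ fun s _ => ?_
          have := hz (.inf (InfinitePlace.mk s.toRingHom)) (by
            have := ov_inf (algebraMap K F) (InfinitePlace.mk s.toRingHom)
            rw [InfinitePlace.comap_mk] at this
            have e : s.toRingHom.comp (algebraMap K F) = v.embedding := by
              ext x; exact s.commutes x
            rwa [e, InfinitePlace.mk_embedding] at this)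
          exact this.le
      _ = Fintype.card (F →ₐ[K] ℂ) / (Fintype.card (F →ₐ[K] ℂ) + 1) * ε := by
          rw [Finset.sum_const, Finset.card_univ, nsmul_eq_mul]; ring
      _ < 1 * ε := by gcongr; rw [div_lt_one (by positivity)]; linarith
      _ = ε := one_mul ε

lemma trace_close (v : Pl K) (C : Finset F) {ε : ℝ} (hε : 0 < ε) :
    ∃ η > 0, ∀ z : F, (∀ w, Ov (algebraMap K F) w v → w.abs z < η) →
      ∀ c ∈ C, v.abs (Algebra.trace K F (z * c)) < ε := by
  obtain ⟨η, h0, h⟩ := trace_close1 (F := F) v hε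
  obtain ⟨η', h0', h'⟩ := fin_lower ((ov_finite (algebraMap K F) v).prod C.finite_toSet)
    (fun x => η / (x.1.abs x.2 + 1)) (fun x _ => by positivity)
  refine ⟨η', h0', fun z hz c hc => h _ fun w hw => ?_⟩
  have h1 := (hz w hw).trans_le (h' (w, c) ⟨hw, hc⟩)
  have h2 := w.abs.nonneg c
  rw [lt_div_iff₀ (by positivity)] at h1
  rw [map_mul]
  nlinarith [w.abs.nonneg z]
end HM

namespace HM
open NumberField IsDedekindDomain Matrix

section
variable {F : Type*} [Field F] {κ : Type*} [Fintype κ] [DecidableEq κ]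

lemma ds_swap {a b x y : F} (N : Matrix κ κ F) (h : a * x ^ 2 + b * y ^ 2 = 1) :
    Cg (ds a (ds b N)) (ds (a * b) (ds 1 N)) := by
  refine ⟨fromBlocks ((-b * y) • 1) (of fun _ j => Sum.elim (fun _ => x) (fun _ => 0) j)
    (of fun i _ => Sum.elim (fun _ => a * x) (fun _ => 0) i)
    (fromBlocks (y • 1) 0 0 1), ?_⟩
  ext (i | i | i) (j | j | j)
  all_goals
    simp [ds, mul_apply, Fintype.sum_sum_type, one_apply, Finset.sum_ite_eq, Finset.mul_sum]
  · linear_combination (a * b) * h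
  · ring
  · ring
  · linear_combination h

lemma ds_scale (c : F) {q : F} (N : Matrix κ κ F) : Cg (ds c N) (ds (c * q ^ 2) N) :=
  ⟨fromBlocks (q • 1) 0 0 1, by
    rw [ds, ds, fromBlocks_transpose, fromBlocks_multiply, fromBlocks_multiply]
    simp [smul_smul]; ring⟩

lemma ds_one : ds (1 : F) (1 : Matrix κ κ F) = 1 := by rw [ds, one_smul, fromBlocks_one]
end

variable {K : Type*} [Field K] [NumberField K]

lemma unit_nf : ∀ {n : ℕ} {M : Matrix (Fin (n + 1)) (Fin (n + 1)) K}, M.IsSymm → M.det ≠ 0 →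
    ∃ R : Finset (Pl K), (∀ v, .inf v ∈ R) ∧ ∀ v, v ∉ R →
      Cg (lm v M) (ds (algebraMap K v.C M.det) (1 : Matrix (Fin n) (Fin n) v.C)) := by
  classical
  intro n
  induction n with
  | zero =>
    intro M hM hd
    refine ⟨Finset.univ.image Pl.inf, fun v => Finset.mem_image_of_mem _ (Finset.mem_univ _), fun v _ => ?_⟩
    have := Cg.submatrix (lm v M) (Equiv.sumEmpty Unit (Fin 0) |>.trans (Equiv.ofUnique Unit (Fin 1)))
    convert this using 1
    ext (i | i) (j | j)
    · simp only [ds, fromBlocks_apply₁₁, Matrix.smul_apply, submatrix_apply, map_apply, det_unique]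
      simp
    all_goals first | exact i.elim0 | exact j.elim0
  | succ n ih =>
    intro M hM hd
    obtain ⟨a, ha, hrep⟩ := exists_rep hM hd
    obtain ⟨N, hN, hNd, e1, e1'⟩ := split_rep (n := n + 1) hM hd (by simp) ha hrep
    obtain ⟨R, hR, h⟩ := ih hN hNd
    obtain ⟨q, hq⟩ : ∃ q, M.det = a * N.det * q ^ 2 := by
      have h1 := e1'.trans (Cg.submatrix M (Fintype.equivOfCardEq (by simp; omega) : Unit ⊕ Fin (n + 1) ≃ Fin (n + 2)))
      obtain ⟨q, hq⟩ := h1.det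
      rw [det_submatrix_equiv_self, det_ds] at hq
      exact ⟨q, hq⟩
    refine ⟨R ∪ (od_finite (Units.mk0 a ha)).toFinset.image Pl.fin ∪ (od_finite (Units.mk0 _ hNd)).toFinset.image Pl.fin
      ∪ (od_finite (Units.mk0 (2 : K) two_ne_zero)).toFinset.image Pl.fin, fun v => by simp [hR v], fun v hv => ?_⟩
    cases v with
    | inf v => exact absurd (by simp [hR v]) hv
    | fin p =>
      simp only [Finset.mem_union, Finset.mem_image, not_or, Set.Finite.mem_toFinset, Set.mem_ofPred_eq,
        Pl.fin.injEq, exists_eq_right, not_not] at hv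
      obtain ⟨⟨⟨h1, h2⟩, h3⟩, h4⟩ := hv
      refine (e1.map (algebraMap K (Pl.fin p).C)).trans ?_
      rw [ds_map]
      refine (Cg.ds _ (h _ h1)).trans ?_
      obtain ⟨x, y, hxy⟩ := mem_Nm.1 (unit_mem_Nm p h4 (a := -(Units.mk0 _ hNd / Units.mk0 a ha))
        (b := (Units.mk0 a ha)⁻¹) (by rw [od_neg, od_div, h2, h3, sub_zero]) (by rw [od_inv, h2, neg_zero]))
      simp only [Units.val_neg, Units.val_div_eq_div_val, Units.val_mk0, map_neg, map_div₀, Units.val_inv_eq_inv_val, map_inv₀] at hxy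
      have ha' : algebraMap K (Pl.fin p).C a ≠ 0 := by simpa using ha
      field_simp at hxy
      refine (ds_swap (x := x) (y := y) _ (by linear_combination hxy)).trans ?_
      rw [ds_one, hq, map_mul, map_mul, map_pow]
      refine (ds_scale _ _).trans (Cg.ds _ ?_)
      have := Cg.submatrix (1 : Matrix (Unit ⊕ Fin n) (Unit ⊕ Fin n) (Pl.fin p).C)
        (Fintype.equivOfCardEq (by simp; omega) : Fin (n + 1) ≃ Unit ⊕ Fin n)
      rwa [submatrix_one_equiv] at this

lemma unit_cg : ∀ {n : ℕ} {M N : Matrix (Fin n) (Fin n) K}, M.IsSymm → N.IsSymm → M.det ≠ 0 → N.det ≠ 0 →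
    (∃ q, N.det = M.det * q ^ 2) → ∃ R : Finset (Pl K), (∀ v, .inf v ∈ R) ∧ ∀ v, v ∉ R → Cg (lm v M) (lm v N) := by
  classical
  intro n M N hM hN hMd hNd ⟨q, hq⟩
  cases n with
  | zero => exact ⟨Finset.univ.image Pl.inf, fun v => Finset.mem_image_of_mem _ (Finset.mem_univ _),
      fun v _ => ⟨1, Subsingleton.elim _ _⟩⟩
  | succ n =>
    obtain ⟨R, h0, h⟩ := unit_nf hM hMd
    obtain ⟨R', h0', h'⟩ := unit_nf hN hNd
    refine ⟨R ∪ R', fun v => Finset.mem_union_left _ (h0 v), fun v hv => ?_⟩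
    rw [Finset.mem_union, not_or] at hv
    have e := (h' v hv.2).symm (by simp; omega) (by rw [det_ds]; simpa using hNd)
    refine (h v hv.1).trans (Cg.trans ?_ e)
    rw [hq, map_mul, map_pow]
    exact ds_scale _ _
end HM

namespace HM
open NumberField IsDedekindDomain Matrix TensorProduct

lemma cyclic {k : Type u} {A : Type u} [Field k] [CommRing A] [Algebra k A] [Algebra.FormallyEtale k A]
    [Module.Finite k A] {V : Type*} [AddCommGroup V] [Module k V]
    (ι : A →ₐ[k] Module.End k V) (hi : Function.Injective ι) : ∃ u, ∀ a, ι a u = 0 → a = 0 := by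
  classical
  obtain ⟨J, _, L, _, _, e, _⟩ := (Algebra.FormallyEtale.iff_exists_algEquiv_prod k A).1 inferInstance
  have := Fintype.ofFinite J
  let E (j : J) : A := e.symm (Pi.single j 1)
  have hE : ∀ j, ∃ x, ι (E j) x ≠ 0 := fun j => by
    by_contra! h
    have h1 : ι (E j) = 0 := LinearMap.ext h
    have h2 : E j = 0 := hi (h1.trans (map_zero ι).symm)
    have h3 : e (E j) j = 0 := by rw [h2, map_zero]; rfl
    simp [E] at h3
  choose x hx using hE
  refine ⟨∑ j, ι (E j) (x j), fun a ha => ?_⟩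
  apply e.injective
  rw [map_zero]
  funext j
  by_contra hj
  apply hx j
  have h4 : ∀ i, (e.symm (Pi.single j ((e a) j)⁻¹) * a) * E i = if i = j then E j else 0 := fun i => by
    apply e.injective
    rw [map_mul, map_mul, e.apply_symm_apply, e.apply_symm_apply]
    funext l
    by_cases hl : l = j
    · subst hl
      by_cases hil : i = l
      · subst hil
        have : (e a i)⁻¹ * e a i = 1 := inv_mul_cancel₀ hj
        simp [E, this]
      · simp [hil, Pi.single_apply, Ne.symm hil]
    · split_ifs <;> simp [hl, E]
  have h5 := congrArg (ι (e.symm (Pi.single j ((e a) j)⁻¹))) ha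
  rw [← Module.End.mul_apply, ← map_mul, map_sum, map_zero] at h5
  rw [Finset.sum_eq_single j, ← Module.End.mul_apply, ← map_mul, h4, if_pos rfl] at h5
  · exact h5
  · intro i _ hij
    rw [← Module.End.mul_apply, ← map_mul, h4, if_neg hij]; simp
  · simp

/-- trace form matrix -/
noncomputable def tm {K E : Type*} [Field K] [CommRing E] [Algebra K E] (ℓ : E →ₗ[K] K) (σ : E →ₐ[K] E) {n : ℕ}
    (b : Module.Basis (Fin n) K E) (a : E) : Matrix (Fin n) (Fin n) K := of fun i j => ℓ (a * b i * σ (b j))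

section
variable {K E : Type*} [Field K] [CommRing E] [Algebra K E] {ℓ : E →ₗ[K] K} {σ : E →ₐ[K] E} {n : ℕ}
  {b : Module.Basis (Fin n) K E}
lemma tm_transpose (hσ : ∀ x, σ (σ x) = x) (hℓ : ∀ x, ℓ (σ x) = ℓ x) (a : E) : (tm ℓ σ b a)ᵀ = tm ℓ σ b (σ a) := by
  ext i j
  change ℓ (a * b j * σ (b i)) = ℓ (σ a * b i * σ (b j))
  rw [← hℓ (a * b j * σ (b i)), map_mul σ, map_mul σ, hσ]; congr 1; ring
end

lemma local_lam {K E Kv : Type u} [Field K] [NumberField K] [CommRing E] [Algebra K E] [FiniteDimensional K E]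
    [Algebra.Etale K E] {n : ℕ} (v : Pl K) {σ : E →ₐ[K] E} (hσ : ∀ x, σ (σ x) = x) {ℓ : E →ₗ[K] K}
    (hℓ : ∀ x, ℓ (σ x) = ℓ x) (b : Module.Basis (Fin n) K E) (hB : (of fun i j => ℓ (b i * b j)).det ≠ 0)
    {M : Matrix (Fin n) (Fin n) K} (hM : M.IsSymm) (hd : M.det ≠ 0) [NormedField Kv] [Algebra K Kv]
    (hn : ∀ x, ‖algebraMap K Kv x‖ = v.abs x) (hden : DenseRange (algebraMap K Kv))
    (h : CompatibleLocalEmbedding K E σ n M Kv) :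
    ∃ a : E, σ a = a ∧ (tm ℓ σ b a).det ≠ 0 ∧ Cg (lm v M) (lm v (tm ℓ σ b a)) := by
  classical
  obtain ⟨ι, hi, hf⟩ := h
  haveI : Algebra.FormallyEtale Kv (Kv ⊗[K] E) := inferInstance
  obtain ⟨u, hu⟩ := cyclic ι hi
  set f := algebraMap K Kv with hfdef
  set M' := M.map f with hM'
  let P : Matrix (Fin n) (Fin n) Kv := of fun i j => ι (1 ⊗ₜ b j) u i
  have hPd : P.det ≠ 0 := by
    intro h0
    obtain ⟨c, hc0, hc⟩ := exists_mulVec_eq_zero_iff.2 h0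
    apply hc0
    have h1 : ι (∑ j, c j ⊗ₜ b j) u = 0 := by
      rw [← hc]
      funext i
      rw [map_sum, LinearMap.sum_apply, Finset.sum_apply]
      refine Finset.sum_congr rfl fun j _ => ?_
      have : c j ⊗ₜ[K] b j = c j • ((1 : Kv) ⊗ₜ[K] b j) := by rw [smul_tmul', smul_eq_mul, mul_one]
      rw [this, map_smul, LinearMap.smul_apply, Pi.smul_apply, smul_eq_mul, mul_comm]; rfl
    have h2 := hu _ h1
    have hb := (b.baseChange Kv).linearIndependent
    rw [Fintype.linearIndependent_iff] at hb
    funext j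
    refine hb c ?_ j
    rw [← h2]
    refine Finset.sum_congr rfl fun j _ => ?_
    rw [Module.Basis.baseChange_apply, smul_tmul', smul_eq_mul, mul_one]
  let g : E → Kv := fun a => ι (1 ⊗ₜ a) u ⬝ᵥ M' *ᵥ u
  have hg : Pᵀ * M' * P = of fun i j => g (b i * σ (b j)) := by
    ext i j
    have h1 : (Pᵀ * M' * P) i j = ι (1 ⊗ₜ b i) u ⬝ᵥ M' *ᵥ (ι (1 ⊗ₜ b j) u) := by
      rw [Matrix.mul_assoc]
      simp only [mul_apply, transpose_apply, dotProduct, mulVec, P, of_apply]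
    have h2 := hf (1 ⊗ₜ σ (b j)) (ι (1 ⊗ₜ b i) u) u
    rw [Algebra.TensorProduct.map_tmul, hσ] at h2
    rw [h1]
    change _ = ι (1 ⊗ₜ (b i * σ (b j))) u ⬝ᵥ M' *ᵥ u
    have h3 : (1 : Kv) ⊗ₜ[K] (b i * σ (b j)) = (1 ⊗ₜ σ (b j)) * (1 ⊗ₜ b i) := by
      rw [Algebra.TensorProduct.tmul_mul_tmul, one_mul, mul_comm]
    rw [h3, map_mul]; exact h2.symm
  set B : Matrix (Fin n) (Fin n) Kv := (of fun i j => ℓ (b i * b j)).map f with hBdef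
  have hBd : IsUnit B.det := by
    rw [hBdef, show (map (of fun i j => ℓ (b i * b j)) ⇑f).det = f _ from (RingHom.map_det f _).symm]
    simpa using hB
  set c : Fin n → Kv := B⁻¹ *ᵥ (fun k => g (b k)) with hcdef
  have hc : ∀ a : E, g a = ∑ k, c k * f (ℓ (b k * a)) := by
    have hk : ∀ j, g (b j) = ∑ k, c k * f (ℓ (b k * b j)) := fun j => by
      have : B *ᵥ c = fun k => g (b k) := by rw [hcdef, mulVec_mulVec, mul_nonsing_inv _ hBd, one_mulVec]
      rw [← congrFun this j]
      change ∑ k, B j k * c k = _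
      refine Finset.sum_congr rfl fun k _ => ?_
      rw [mul_comm, hBdef]; simp [mul_comm (b j)]
    intro a
    have hlin : g a = ∑ j, f (b.repr a j) * g (b j) := by
      conv_lhs => rw [← b.sum_repr a]
      change ι ((1 : Kv) ⊗ₜ[K] ∑ j, b.repr a j • b j) u ⬝ᵥ M' *ᵥ u = _
      rw [TensorProduct.tmul_sum, map_sum, LinearMap.sum_apply, sum_dotProduct]
      refine Finset.sum_congr rfl fun j _ => ?_
      have : (1 : Kv) ⊗ₜ[K] (b.repr a j • b j) = f (b.repr a j) • (1 ⊗ₜ[K] b j) := by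
        rw [tmul_smul, hfdef, algebraMap_smul]
      rw [this, map_smul, LinearMap.smul_apply, smul_dotProduct, smul_eq_mul]
    rw [hlin]
    simp_rw [hk, Finset.mul_sum]
    rw [Finset.sum_comm]
    refine Finset.sum_congr rfl fun k _ => ?_
    conv_rhs => rw [← b.sum_repr a]
    rw [Finset.mul_sum, map_sum, map_sum, Finset.mul_sum]
    refine Finset.sum_congr rfl fun j _ => ?_
    rw [mul_smul_comm, map_smul, smul_eq_mul, map_mul f]; ring
  -- symmetrised pencil
  have h2K : (2 : K) ≠ 0 := two_ne_zero
  let s (k : Fin n) : E := (2⁻¹ : K) • (b k + σ (b k))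
  have hs : ∀ k, σ (s k) = s k := fun k => by simp only [s]; rw [map_smul, map_add, hσ, add_comm]
  have hsT : ∀ k, tm ℓ σ b (s k) = (2⁻¹ : K) • (tm ℓ σ b (b k) + (tm ℓ σ b (b k))ᵀ) := fun k => by
    rw [tm_transpose hσ hℓ]
    ext i j
    simp only [tm, s, of_apply, Matrix.smul_apply, Matrix.add_apply, smul_eq_mul]
    rw [smul_mul_assoc, smul_mul_assoc, map_smul, smul_eq_mul, add_mul, add_mul, map_add]
  have hPT : Pᵀ * M' * P = ∑ k, c k • (tm ℓ σ b (s k)).map f := by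
    have h1 : Pᵀ * M' * P = ∑ k, c k • (tm ℓ σ b (b k)).map f := by
      rw [hg]
      ext i j
      rw [of_apply, hc]
      simp [Matrix.sum_apply, tm, mul_assoc]
    have h2 : (Pᵀ * M' * P)ᵀ = Pᵀ * M' * P := by
      rw [transpose_mul, transpose_mul, transpose_transpose, hM', ← transpose_map, hM.eq, Matrix.mul_assoc]
    have h3 : Pᵀ * M' * P = (2⁻¹ : Kv) • (Pᵀ * M' * P + (Pᵀ * M' * P)ᵀ) := by
      have : (2 : Kv) ≠ 0 := by
        have := (map_ne_zero f).2 h2K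
        rwa [map_ofNat] at this
      rw [h2, ← two_smul Kv, smul_smul, inv_mul_cancel₀ this, one_smul]
    rw [h3, h1, transpose_sum, ← Finset.sum_add_distrib, Finset.smul_sum]
    refine Finset.sum_congr rfl fun k _ => ?_
    rw [hsT]
    ext i j
    simp; rw [map_ofNat f 2]; ring
  obtain ⟨ε, hε, hnear⟩ := near_cgK v hM hd
  -- approximation
  let Φ : (Matrix (Fin n) (Fin n) Kv) × (Fin n → Kv) → Matrix (Fin n) (Fin n) Kv := fun x =>
    x.1ᵀ * (∑ k, x.2 k • (tm ℓ σ b (s k)).map f) * x.1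
  have hΦ : Continuous Φ := by
    refine Continuous.matrix_mul (Continuous.matrix_mul continuous_fst.matrix_transpose ?_) continuous_fst
    refine continuous_finset_sum _ fun k _ => ?_
    exact Continuous.smul ((continuous_apply k).comp continuous_snd) continuous_const
  have hΦ0 : Φ (P⁻¹, c) = M' := by
    have hu : IsUnit P.det := hPd.isUnit
    change (P⁻¹)ᵀ * (∑ k, c k • (tm ℓ σ b (s k)).map f) * P⁻¹ = M'
    rw [← hPT, Matrix.mul_assoc, Matrix.mul_assoc, mul_nonsing_inv _ hu, mul_one, ← Matrix.mul_assoc,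
      ← transpose_mul, mul_nonsing_inv _ hu, transpose_one, one_mul]
  let U : Set ((Matrix (Fin n) (Fin n) Kv) × (Fin n → Kv)) := {x | ∀ i j, ‖Φ x i j - M' i j‖ < ε}
  have hU : IsOpen U := by
    simp only [U, Set.setOf_forall]
    refine isOpen_iInter_of_finite fun i => isOpen_iInter_of_finite fun j => ?_
    exact isOpen_lt ((((continuous_apply j).comp (continuous_apply i)).comp hΦ).sub continuous_const).norm continuous_const
  have hdense : DenseRange (fun x : (Matrix (Fin n) (Fin n) K) × (Fin n → K) => (x.1.map f, f ∘ x.2)) := by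
    have h1 : DenseRange (fun x : Fin n → K => f ∘ x) := DenseRange.piMap fun _ => hden
    have h2 : DenseRange (fun x : Matrix (Fin n) (Fin n) K => (x.map f : Matrix (Fin n) (Fin n) Kv)) :=
      DenseRange.piMap (f := fun _ : Fin n => fun x : Fin n → K => f ∘ x) fun _ => h1
    exact h2.prodMap h1
  obtain ⟨⟨Q, d⟩, hQ⟩ := hdense.exists_mem_open hU ⟨(P⁻¹, c), fun i j => by rw [hΦ0, sub_self, norm_zero]; exact hε⟩
  set a : E := ∑ k, d k • s k
  have ha : σ a = a := by simp only [a]; rw [map_sum]; simp_rw [map_smul, hs]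
  have hTa : tm ℓ σ b a = ∑ k, d k • tm ℓ σ b (s k) := by
    ext i j
    simp only [tm, a, of_apply, Matrix.sum_apply, Matrix.smul_apply, smul_eq_mul]
    rw [Finset.sum_mul, Finset.sum_mul, map_sum]
    refine Finset.sum_congr rfl fun k _ => ?_
    rw [smul_mul_assoc, smul_mul_assoc, map_smul, smul_eq_mul]
  have hΦK : Φ (Q.map f, f ∘ d) = (Qᵀ * tm ℓ σ b a * Q).map f := by
    rw [Matrix.map_mul, Matrix.map_mul, hTa]
    simp only [Φ]
    congr 2
    ext i j
    simp [Matrix.sum_apply]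
  have hTs : (tm ℓ σ b a).IsSymm := by rw [IsSymm, tm_transpose hσ hℓ, ha]
  obtain ⟨h1, h2⟩ := hnear (Qᵀ * tm ℓ σ b a * Q) (Cg.isSymm ⟨Q, rfl⟩ hTs) fun i j => by
    have := hQ i j
    rw [hΦK] at this
    rw [← hn, map_sub]; exact this
  have h3 : Cg (tm ℓ σ b a) (Qᵀ * tm ℓ σ b a * Q) := ⟨Q, rfl⟩
  refine ⟨a, ha, ?_, h1.trans ((h3.symm rfl h2).map _)⟩
  intro h0
  apply h2
  rw [det_mul, det_mul, h0, mul_zero, zero_mul]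
end HM

namespace HM
open NumberField IsDedekindDomain Matrix TensorProduct
lemma local_all {K E : Type u} [Field K] [NumberField K] [CommRing E] [Algebra K E] [FiniteDimensional K E]
    [Algebra.Etale K E] {n : ℕ} {σ : E →ₐ[K] E} (hσ : ∀ x, σ (σ x) = x) {ℓ : E →ₗ[K] K}
    (hℓ : ∀ x, ℓ (σ x) = ℓ x) (b : Module.Basis (Fin n) K E) (hB : (of fun i j => ℓ (b i * b j)).det ≠ 0)
    {M : Matrix (Fin n) (Fin n) K} (hM : M.IsSymm) (hd : M.det ≠ 0)
    (hfin : ∀ v : IsDedekindDomain.HeightOneSpectrum (NumberField.RingOfIntegers K),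
      CompatibleLocalEmbedding K E σ n M (v.adicCompletion K))
    (hinf : ∀ v : NumberField.InfinitePlace K,
      CompatibleLocalEmbedding K E σ n M v.Completion) (v : Pl K) :
    ∃ a : E, σ a = a ∧ (tm ℓ σ b a).det ≠ 0 ∧ Cg (lm v M) (lm v (tm ℓ σ b a)) := by
  cases v with
  | fin v => 
    exact local_lam (.fin v) hσ hℓ b hB hM hd (Kv := v.adicCompletion K) 
      (fun x => FinitePlace.norm_embedding v x) (HeightOneSpectrum.denseRange_algebraMap K v) (hfin v)
  | inf v => 
    refine local_lam (.inf v) hσ hℓ b hB hM hd (Kv := v.Completion) 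
      (fun x => InfinitePlace.Completion.norm_coe v (WithAbs.toAbs v.1 x)) ?_ (hinf v)
    intro x
    refine closure_mono ?_ (InfinitePlace.Completion.denseRange_coe v x)
    rintro _ ⟨y, rfl⟩
    exact ⟨WithAbs.ofAbs y, rfl⟩
end HM

namespace HM
open NumberField IsDedekindDomain

/-- approximation up to norms -/
def NearP {K L : Type*} [Field K] [NumberField K] [Field L] [Algebra K L] (τ : L → L) (v : Pl K) (a b : L) : Prop :=
  ∀ (C : Finset L) (ε : ℝ), 0 < ε → ∃ y : L, ∀ c ∈ C, v.abs (Algebra.trace K L ((a * y * τ y - b) * c)) < ε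

variable {K : Type*} [Field K] [NumberField K] {F : Type*} [Field F] [NumberField F] [Algebra K F]
  {L : Type*} [Field L] [Algebra K L] [Algebra F L] [IsScalarTower K F L] [FiniteDimensional F L]

lemma near_q (τ : L →ₐ[K] L) (hτ : ∀ x : F, τ (algebraMap F L x) = algebraMap F L x) {s : L} (hs : τ s = -s)
    {δ : Fˣ} (hδ : s ^ 2 = algebraMap F L δ) {v : Pl K} {a b : Fˣ}
    (h : ∀ w, Ov (algebraMap K F) w v → b / a ∈ Nm δ w) : NearP τ v (algebraMap F L a) (algebraMap F L b) := by
  classical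
  intro C ε hε
  obtain ⟨η, hη, H⟩ := trace_close (F := F) v (C.image (Algebra.trace F L)) hε
  have h1 : ∀ w : Pl F, ∃ x z : w.C, Ov (algebraMap K F) w v → algebraMap F w.C a * (x ^ 2 - algebraMap F w.C δ * z ^ 2)
      = algebraMap F w.C b := fun w => by
    by_cases hw : Ov (algebraMap K F) w v
    · obtain ⟨x, z, hxz⟩ := mem_Nm.1 (h w hw)
      refine ⟨x, z, fun _ => ?_⟩
      rw [hxz, ← map_mul, Units.val_div_eq_div_val, mul_div_cancel₀ _ a.ne_zero]
    · exact ⟨0, 0, fun h => absurd h hw⟩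
  choose x z hxz using h1
  have h2 : ∀ w : Pl F, ∃ ρ > 0, Ov (algebraMap K F) w v → ∀ x' z' : w.C, ‖x' - x w‖ < ρ → ‖z' - z w‖ < ρ →
      ‖algebraMap F w.C a * (x' ^ 2 - algebraMap F w.C δ * z' ^ 2) - algebraMap F w.C b‖ < η := fun w => by
    by_cases hw : Ov (algebraMap K F) w v
    · have hc : Continuous fun p : w.C × w.C =>
          algebraMap F w.C a * (p.1 ^ 2 - algebraMap F w.C δ * p.2 ^ 2) - algebraMap F w.C b := by fun_prop
      obtain ⟨ρ, h0, h⟩ := Metric.continuous_iff.1 hc (x w, z w) η hη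
      refine ⟨ρ, h0, fun _ x' z' hx hz => ?_⟩
      have := h (x', z') (by rw [Prod.dist_eq, max_lt_iff, dist_eq_norm, dist_eq_norm]; exact ⟨hx, hz⟩)
      rwa [dist_eq_norm, hxz w hw, sub_self, sub_zero] at this
    · exact ⟨1, one_pos, fun h => absurd h hw⟩
  choose ρ hρ hρ' using h2
  obtain ⟨r, hr, hr'⟩ := fin_lower (ov_finite (algebraMap K F) v) ρ fun w _ => hρ w
  obtain ⟨X, hX⟩ := weak_approxC (ov_finite (algebraMap K F) v).toFinset x hr
  obtain ⟨Z, hZ⟩ := weak_approxC (ov_finite (algebraMap K F) v).toFinset z hr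
  refine ⟨algebraMap F L X + algebraMap F L Z * s, fun c hc => ?_⟩
  have e1 : (algebraMap F L a * (algebraMap F L X + algebraMap F L Z * s) * τ (algebraMap F L X + algebraMap F L Z * s)
      - algebraMap F L b) = algebraMap F L (a * (X ^ 2 - δ * Z ^ 2) - b) := by
    rw [map_add τ, map_mul τ, hτ, hτ, hs]
    simp only [map_sub, map_mul, map_pow, ← hδ]; ring
  rw [e1, ← Algebra.smul_def, ← Algebra.trace_trace (S := F), map_smul, smul_eq_mul]
  refine H _ (fun w hw => ?_) _ (Finset.mem_image_of_mem _ hc)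
  have hw' : w ∈ (ov_finite (algebraMap K F) v).toFinset := (Set.Finite.mem_toFinset _).2 hw
  rw [← norm_alg]
  simp only [map_sub, map_mul, map_pow]
  exact hρ' w hw _ _ ((hX w hw').trans_le (hr' w hw)) ((hZ w hw').trans_le (hr' w hw))

/-- choice of the global element at a nontrivial index -/
lemma exists_mu (τ : L →ₐ[K] L) (hτ : ∀ x : F, τ (algebraMap F L x) = algebraMap F L x) {s : L} (hs : τ s = -s)
    {δ : Fˣ} (hδ : s ^ 2 = algebraMap F L δ) {p₀ : HeightOneSpectrum (𝓞 K)} {w₀ : HeightOneSpectrum (𝓞 F)}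
    (hw₀ : Ov (algebraMap K F) (.fin w₀) (.fin p₀)) (hns : δ ∉ Sq (.fin w₀)) (R : Finset (Pl K)) (hR : .fin p₀ ∉ R)
    (x : Pl K → Fˣ) (hx : ∀ v ∉ R, x v = 1) :
    ∃ μ : Fˣ, ∀ v, v ≠ .fin p₀ → NearP τ v (algebraMap F L (x v)) (algebraMap F L μ) := by
  classical
  choose u hu using fun w : Pl F => ov_exists (algebraMap K F) w
  have hfin : {w : Pl F | u w ∈ R}.Finite := by
    refine Set.Finite.subset (Set.Finite.biUnion R.finite_toSet fun v _ => ov_finite (algebraMap K F) v) ?_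
    intro w hw
    simp only [Set.mem_iUnion]
    exact ⟨u w, hw, hu w⟩
  obtain ⟨μ, h1, h2⟩ := exists_symbol hns hfin.toFinset (by
    rw [Set.Finite.mem_toFinset]; intro h; exact hR ((hu _).uniq hw₀ ▸ h)) (fun w => x (u w))
  refine ⟨μ, fun v hv => near_q τ hτ hs hδ fun w hw => ?_⟩
  have huw : u w = v := (hu w).uniq hw
  by_cases hvR : v ∈ R
  · have := h1 w (by rw [Set.Finite.mem_toFinset]; change u w ∈ R; rwa [huw])
    rwa [huw] at this
  · rw [hx v hvR, div_one]
    refine h2 w (by rw [Set.Finite.mem_toFinset]; change u w ∉ R; rwa [huw]) ?_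
    rintro rfl
    exact hv (hw.uniq hw₀)
end HM

namespace HM
open NumberField IsDedekindDomain IntermediateField
lemma exists_p0 {K : Type u} [Field K] [NumberField K] {I : Type*} [Finite I] (F : I → Type u) [∀ i, Field (F i)]
    [∀ i, NumberField (F i)] [∀ i, Algebra K (F i)] (δ : ∀ i, (F i)ˣ) (φ : K →+* ℝ) (ψ : ∀ i, F i →+* ℝ)
    (hψ : ∀ i, (ψ i).comp (algebraMap K (F i)) = φ) (hδ : ∀ i, ψ i (δ i) < 0) (R0 : Finset (Pl K)) :
    ∃ p₀ : HeightOneSpectrum (𝓞 K), .fin p₀ ∉ R0 ∧ ∀ i, ∃ w : HeightOneSpectrum (𝓞 (F i)),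
      Ov (algebraMap K (F i)) (.fin w) (.fin p₀) ∧ δ i ∉ Sq (.fin w) := by
  let A : I → IntermediateField ℚ ℝ := fun i => (ψ i).toRatAlgHom.fieldRange ⊔ ℚ⟮Real.sqrt (-ψ i (δ i))⟯
  let R : IntermediateField ℚ ℝ := φ.toRatAlgHom.fieldRange ⊔ ⨆ i, A i
  have halg : ∀ i (x : F i), IsIntegral ℚ (ψ i x) := fun i x =>
    (Algebra.IsIntegral.isIntegral (R := ℚ) x).map (ψ i).toRatAlgHom
  have hA : ∀ i, FiniteDimensional ℚ (A i) := fun i => by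
    have : FiniteDimensional ℚ ℚ⟮Real.sqrt (-ψ i (δ i))⟯ := IntermediateField.adjoin.finiteDimensional (by
      refine IsIntegral.of_pow (n := 2) two_pos ?_
      rw [Real.sq_sqrt (by linarith [hδ i])]
      exact (halg i _).neg)
    have : FiniteDimensional ℚ (ψ i).toRatAlgHom.fieldRange :=
      (ψ i).toRatAlgHom.toLinearMap.finiteDimensional_range
    infer_instance
  have h1 : FiniteDimensional ℚ φ.toRatAlgHom.fieldRange := φ.toRatAlgHom.toLinearMap.finiteDimensional_range
  have hR : FiniteDimensional ℚ R := by
    have := IntermediateField.finiteDimensional_iSup_of_finite (t := A)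
    infer_instance
  have : NumberField R := { to_charZero := inferInstance, to_finiteDimensional := hR }
  let κ : K →+* R := φ.codRestrict R.toSubfield fun x =>
    (le_sup_left : _ ≤ R) (show φ x ∈ φ.toRatAlgHom.fieldRange from ⟨x, rfl⟩)
  have hAR : ∀ i, A i ≤ R := fun i => (le_iSup A i).trans le_sup_right
  let ρ : ∀ i, F i →+* R := fun i => (ψ i).codRestrict R.toSubfield fun x =>
    hAR i ((le_sup_left : _ ≤ A i) (show ψ i x ∈ (ψ i).toRatAlgHom.fieldRange from ⟨x, rfl⟩))
  let r : I → R := fun i => ⟨Real.sqrt (-ψ i (δ i)), hAR i ((le_sup_right : _ ≤ A i)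
    (IntermediateField.mem_adjoin_simple_self ℚ _))⟩
  have hr : ∀ i, ρ i (δ i) = - r i ^ 2 := fun i => Subtype.ext (by
    change ψ i (δ i) = - (Real.sqrt (-ψ i (δ i))) ^ 2
    rw [Real.sq_sqrt (by linarith [hδ i]), neg_neg])
  have hκ : ∀ i, (ρ i).comp (algebraMap K (F i)) = κ := fun i => RingHom.ext fun x => Subtype.ext
    (RingHom.congr_fun (hψ i) x)
  have hm1 : ¬ IsSquare (((-1 : Rˣ) : R)) := by
    rintro ⟨x, hx⟩
    have : (-1 : ℝ) = (x : ℝ) * x := by simpa using congrArg (Subtype.val) hx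
    nlinarith [mul_self_nonneg (x : ℝ)]
  have hfin : {w : Pl R | ∃ v ∈ R0, Ov κ w v}.Finite := by
    refine Set.Finite.subset (Set.Finite.biUnion R0.finite_toSet fun v _ => ov_finite κ v) ?_
    rintro w ⟨v, hv, hw⟩
    simp only [Set.mem_iUnion]
    exact ⟨v, hv, hw⟩
  obtain ⟨P, hP, hns⟩ := exists_ns hm1 hfin.toFinset
  obtain ⟨p₀, hp⟩ := ov_fin_exists κ P
  refine ⟨p₀, fun h => hP ((Set.Finite.mem_toFinset _).2 ⟨_, h, hp⟩), fun i => ?_⟩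
  obtain ⟨w, hw⟩ := ov_fin_exists (ρ i) P
  obtain ⟨p, hwp⟩ := ov_fin_exists (algebraMap K (F i)) w
  have h2 := hwp.trans hw
  rw [hκ] at h2
  rw [h2.uniq hp] at hwp
  refine ⟨w, hwp, fun h => hns ?_⟩
  have h3 := hw.Sq h
  have hr0 : r i ≠ 0 := by
    intro h0
    have := hr i
    rw [h0] at this
    simp at this
  have h4 : (-1 : Rˣ) = Units.map (ρ i : F i →* R) (δ i) / (Units.mk0 _ hr0) ^ 2 := by
    rw [eq_div_iff_mul_eq']
    refine Units.ext ?_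
    have := hr i
    simp [this]
  rw [h4]
  exact div_mem h3 (sq_mem_Sq _ _)
end HM

namespace HM
open NumberField IsDedekindDomain

lemma spec_char {K E : Type*} [Field K] [CommRing E] [Algebra K E] {σ : E →ₐ[K] E} {n : ℕ} {φ : K →+* ℝ}
    (h : IsAnisotropicRealFiber K E σ n φ) {x : E} (hx : x ≠ 0) :
    ∃ χ : E →+* ℂ, (∀ k, χ (algebraMap K E k) = φ k) ∧ (∀ a, χ (σ a) = starRingEnd ℂ (χ a)) ∧ χ x ≠ 0 := by
  letI := φ.toAlgebra
  obtain ⟨e, he⟩ := h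
  let g : E →ₐ[K] TensorProduct K ℝ E := Algebra.TensorProduct.includeRight
  have hg : Function.Injective g := Algebra.TensorProduct.includeRight_injective (algebraMap K ℝ).injective
  have hgσ : ∀ a, g (σ a) = Algebra.TensorProduct.map (AlgHom.id K ℝ) σ (g a) := fun a => by
    simp [g]
  have hgk : ∀ k, g (algebraMap K E k) = algebraMap ℝ _ (φ k) := fun k => by
    rw [g.commutes]; rfl
  have hek : ∀ k, e (g (algebraMap K E k)) = algebraMap ℝ _ (φ k) := fun k => by rw [hgk, e.commutes]
  have h0 : e (g x) ≠ 0 := by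
    rw [ne_eq, EmbeddingLike.map_eq_zero_iff]
    exact fun h => hx (hg (h.trans (map_zero g).symm))
  by_cases h1 : (e (g x)).1 = 0
  · have h2 : (e (g x)).2 ≠ 0 := fun h2 => h0 (Prod.ext h1 h2)
    obtain ⟨j, hj⟩ := Function.ne_iff.1 h2
    refine ⟨Complex.ofRealHom.comp ((Pi.evalRingHom (fun _ => ℝ) j).comp ((RingHom.snd _ _).comp
      (e.toRingEquiv.toRingHom.comp g.toRingHom))), fun k => ?_, fun a => ?_, ?_⟩
    · exact congrArg (fun z => ((z.2 j : ℝ) : ℂ)) (hek k)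
    · simp [hgσ, he]
    · simpa using hj
  · obtain ⟨j, hj⟩ := Function.ne_iff.1 h1
    refine ⟨(Pi.evalRingHom (fun _ => ℂ) j).comp ((RingHom.fst _ _).comp
      (e.toRingEquiv.toRingHom.comp g.toRingHom)), fun k => ?_, fun a => ?_, ?_⟩
    · exact congrArg (fun z => z.1 j) (hek k)
    · simp [hgσ, he]
    · simpa using hj

section
variable {K E : Type*} [Field K] [CommRing E] [Algebra K E] {σ : E →ₐ[K] E} (hσ : ∀ x, σ (σ x) = x) {φ : K →+* ℝ}
  (hχ : ∀ x : E, x ≠ 0 → ∃ χ : E →+* ℂ, (∀ k, χ (algebraMap K E k) = φ k) ∧ (∀ a, χ (σ a) = starRingEnd ℂ (χ a)) ∧ χ x ≠ 0)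
  {I : Type*} [DecidableEq I] {L : I → Type*} [∀ i, Field (L i)] [∀ i, Algebra K (L i)] (e : E ≃ₐ[K] Π i, L i)

lemma sig_idem (hχ : ∀ x : E, x ≠ 0 → ∃ χ : E →+* ℂ, (∀ k, χ (algebraMap K E k) = φ k) ∧
    (∀ a, χ (σ a) = starRingEnd ℂ (χ a)) ∧ χ x ≠ 0) {ε : E} (h : ε * ε = ε) : σ ε = ε := by
  by_contra hn
  obtain ⟨χ, -, h2, h3⟩ := hχ _ (sub_ne_zero.2 hn)
  have h4 : χ ε * χ ε = χ ε := by rw [← map_mul, h]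
  apply h3
  rw [map_sub, h2]
  rcases IsIdempotentElem.iff_eq_zero_or_one.1 h4 with h | h <;> simp [h]

lemma exists_tau (hσ : ∀ x, σ (σ x) = x) (hχ : ∀ x : E, x ≠ 0 → ∃ χ : E →+* ℂ, (∀ k, χ (algebraMap K E k) = φ k) ∧
    (∀ a, χ (σ a) = starRingEnd ℂ (χ a)) ∧ χ x ≠ 0) : ∃ τ : ∀ i, L i ≃ₐ[K] L i, (∀ a i, e (σ a) i = τ i (e a i)) ∧
      (∀ i x, τ i (τ i x) = x) ∧
      ∀ i, ∃ θ : L i →+* ℂ, (∀ k, θ (algebraMap K (L i) k) = φ k) ∧ ∀ a, θ (τ i a) = starRingEnd ℂ (θ a) := by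
  have hε : ∀ i, σ (e.symm (Pi.single i 1)) = e.symm (Pi.single i 1) := fun i => sig_idem hχ (by
    rw [← map_mul, ← Pi.single_mul, one_mul])
  have key : ∀ a i, e (σ a) i = e (σ (e.symm (Pi.single i (e a i)))) i := fun a i => by
    have h1 : e.symm (Pi.single i (e a i)) = a * e.symm (Pi.single i 1) := e.injective (by
      rw [map_mul, e.apply_symm_apply, e.apply_symm_apply]
      ext j
      by_cases h : j = i
      · subst h; simp
      · simp [h])
    rw [h1, map_mul σ, hε, map_mul e, e.apply_symm_apply]
    simp
  let t : ∀ i, L i →ₐ[K] L i := fun i =>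
    { toFun := fun x => e (σ (e.symm (Pi.single i x))) i
      map_one' := by rw [hε]; simp
      map_zero' := by simp
      map_mul' := fun x y => by rw [Pi.single_mul, map_mul, map_mul, map_mul]; rfl
      map_add' := fun x y => by rw [Pi.single_add, map_add, map_add, map_add]; rfl
      commutes' := fun k => by
        have := key (algebraMap K E k) i
        rw [σ.commutes, e.commutes] at this
        exact this.symm }
  have ht : ∀ a i, e (σ a) i = t i (e a i) := key
  have htt : ∀ i x, t i (t i x) = x := fun i x => by
    have h := ht (σ (e.symm (Pi.single i x))) i
    rw [hσ, ht, e.apply_symm_apply, Pi.single_eq_same] at h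
    exact h.symm
  refine ⟨fun i => AlgEquiv.ofAlgHom (t i) (t i) (AlgHom.ext (htt i)) (AlgHom.ext (htt i)), ht, htt, fun i => ?_⟩
  obtain ⟨χ, h1, h2, h3⟩ := hχ (e.symm (Pi.single i 1)) (by simp)
  have h4 : χ (e.symm (Pi.single i 1)) = 1 := by
    have : χ (e.symm (Pi.single i 1)) * χ (e.symm (Pi.single i 1)) = χ (e.symm (Pi.single i 1)) := by
      rw [← map_mul, ← map_mul, ← Pi.single_mul, one_mul]
    exact (IsIdempotentElem.iff_eq_zero_or_one.1 this).resolve_left h3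
  let θ : L i →+* ℂ :=
    { toFun := fun x => χ (e.symm (Pi.single i x))
      map_one' := h4
      map_zero' := by simp
      map_mul' := fun x y => by rw [Pi.single_mul, map_mul, map_mul]
      map_add' := fun x y => by rw [Pi.single_add, map_add, map_add] }
  have hθ : ∀ a : E, θ (e a i) = χ a := fun a => by
    change χ _ = _
    have h5 : e.symm (Pi.single i (e a i)) = a * e.symm (Pi.single i 1) := e.injective (by
      rw [map_mul, e.apply_symm_apply, e.apply_symm_apply]
      ext j
      by_cases h : j = i
      · subst h; simp
      · simp [h])
    rw [h5, map_mul, h4, mul_one]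
  refine ⟨θ, fun k => ?_, fun a => ?_⟩
  · rw [← h1, ← hθ, e.commutes]; rfl
  · have := ht (e.symm (Pi.single i a)) i
    rw [e.apply_symm_apply, Pi.single_eq_same] at this
    change θ (t i a) = _
    rw [← this, hθ, h2, ← hθ, e.apply_symm_apply, Pi.single_eq_same]

/-- trivial indices -/
lemma triv_idx [FiniteDimensional K E] [CharZero K] [Fintype I] (hσ : ∀ x, σ (σ x) = x) {n : ℕ} (hdim : Module.finrank K E = n)
    (hfix : Module.finrank K (LinearMap.ker (σ.toLinearMap - LinearMap.id)) = (n + 1) / 2)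
    (τ : ∀ i, L i ≃ₐ[K] L i) (hτ : ∀ a i, e (σ a) i = τ i (e a i)) (hττ : ∀ i x, τ i (τ i x) = x)
    {i : I} (hi : τ i = 1) : (∀ j, τ j = 1 → j = i) ∧ ∀ x : L i, ∃ k : K, x = algebraMap K (L i) k := by
  classical
  have hs : ∀ j, ∃ s : L j, (τ j ≠ 1 → s ≠ 0) ∧ (τ j = 1 → s = 0) ∧ τ j s = - s := fun j => by
    by_cases h : τ j = 1
    · exact ⟨0, fun h' => absurd h h', fun _ => rfl, by simp⟩
    · obtain ⟨y, hy⟩ : ∃ y, τ j y ≠ y := by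
        by_contra! h'
        exact h (AlgEquiv.ext h')
      exact ⟨τ j y - y, fun _ => sub_ne_zero.2 hy, fun h' => absurd h' h, by rw [map_sub, hττ]; ring⟩
  choose s hs0 hs1 hs2 using hs
  let W : Submodule K E :=
    { carrier := {x | ∀ j, τ j ≠ 1 → e x j = 0}
      zero_mem' := fun j _ => by simp
      add_mem' := fun hx hy j h => by rw [map_add, Pi.add_apply, hx j h, hy j h, add_zero]
      smul_mem' := fun c x hx j h => by rw [map_smul, Pi.smul_apply, hx j h, smul_zero] }
  let B := LinearMap.range (σ.toLinearMap - LinearMap.id)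
  have hBt : ∀ x ∈ B, ∀ j, τ j = 1 → e x j = 0 := by
    rintro _ ⟨y, rfl⟩ j h
    change e (σ y - y) j = 0
    rw [map_sub, Pi.sub_apply, hτ, h]; simp
  have hBa : ∀ x ∈ B, σ x = -x := by
    rintro _ ⟨y, rfl⟩
    change σ (σ y - y) = - (σ y - y)
    rw [map_sub, hσ]; ring
  let g : (B × W) →ₗ[K] LinearMap.ker (σ.toLinearMap - LinearMap.id) :=
    (((LinearMap.mul K E (e.symm s)).comp B.subtype).coprod W.subtype).codRestrict _ (by
      rintro ⟨⟨x, hx⟩, ⟨w, hw⟩⟩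
      rw [LinearMap.mem_ker]
      change σ (e.symm s * x + w) - (e.symm s * x + w) = 0
      rw [sub_eq_zero, map_add σ, map_mul σ, hBa x hx]
      refine e.injective (funext fun j => ?_)
      simp only [map_add, map_mul, Pi.add_apply, Pi.mul_apply, map_neg, Pi.neg_apply, hτ, e.apply_symm_apply, hs2]
      by_cases h : τ j = 1
      · simp [h]
      · simp [hw j h])
  have hg : Function.Injective g := by
    rw [injective_iff_map_eq_zero]
    rintro ⟨⟨x, hx⟩, ⟨w, hw⟩⟩ h
    have h : e.symm s * x + w = 0 := congrArg Subtype.val h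
    have h' : ∀ j, s j * e x j + e w j = 0 := fun j => by
      have := congrFun (congrArg e h) j
      simpa using this
    have hx0 : x = 0 := e.injective (funext fun j => by
      rw [map_zero, Pi.zero_apply]
      by_cases hj : τ j = 1
      · exact hBt x hx j hj
      · have := h' j
        rw [hw j hj, add_zero] at this
        exact (mul_eq_zero.1 this).resolve_left (hs0 j hj))
    have hw0 : w = 0 := by simpa [hx0] using h
    simp only [hx0, hw0]; rfl
  have hd := LinearMap.finrank_le_finrank_of_injective hg
  have hrn := LinearMap.finrank_range_add_finrank_ker (σ.toLinearMap - LinearMap.id)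
  rw [Module.finrank_prod] at hd
  have hW : Module.finrank K W ≤ 1 := by
    change Module.finrank K B + _ = _ at hrn
    omega
  obtain ⟨w, hw⟩ := finrank_le_one_iff.1 hW
  have hmem : ∀ j, τ j = 1 → ∀ x, e.symm (Pi.single j x) ∈ W := fun j hj x k hk => by
    rw [e.apply_symm_apply, Pi.single_eq_of_ne]
    rintro rfl; exact hk hj
  have hw' : ∀ j, τ j = 1 → ∀ x, ∃ c : K, c • e w = Pi.single j x := fun j hj x => by
    obtain ⟨c, hc⟩ := hw ⟨_, hmem j hj x⟩
    refine ⟨c, ?_⟩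
    rw [← map_smul, ← e.apply_symm_apply (Pi.single j x)]
    exact congrArg e (congrArg Subtype.val hc)
  obtain ⟨c, hc⟩ := hw' i hi 1
  have hci := congrFun hc i
  rw [Pi.smul_apply, Pi.single_eq_same, Algebra.smul_def] at hci
  constructor
  · intro j hj
    by_contra hji
    obtain ⟨d, hd⟩ := hw' j hj 1
    have h1 := congrFun hd i
    have h2 := congrFun hd j
    rw [Pi.smul_apply, Pi.single_eq_of_ne (Ne.symm hji), Algebra.smul_def, mul_eq_zero] at h1
    have hd0 : d = 0 := by
      rcases h1 with h1 | h1
      · simpa using h1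
      · rw [h1, mul_zero] at hci; exact absurd hci (by simp)
    rw [hd0] at h2
    simp at h2
  · intro x
    obtain ⟨d, hd⟩ := hw' i hi x
    have h1 := congrFun hd i
    rw [Pi.smul_apply, Pi.single_eq_same, Algebra.smul_def] at h1
    refine ⟨d / c, ?_⟩
    have hc0 : algebraMap K (L i) c ≠ 0 := left_ne_zero_of_mul (hci.trans_ne one_ne_zero)
    rw [map_div₀, eq_div_iff hc0, ← h1]
    linear_combination algebraMap K (L i) d * hci
end

/-- nontrivial indices -/
lemma nontriv_idx {K L : Type*} [Field K] [NumberField K] [Field L] [Algebra K L] [FiniteDimensional K L] {φ : K →+* ℝ}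
    {τ : L ≃ₐ[K] L} (hττ : ∀ x, τ (τ x) = x) (hτ : τ ≠ 1) (hθ : ∃ θ : L →+* ℂ, (∀ k, θ (algebraMap K L k) = φ k) ∧
      ∀ a, θ (τ a) = starRingEnd ℂ (θ a)) : ∃ F : IntermediateField K L, (∀ x, x ∈ F ↔ τ x = x) ∧
      (∀ x : F, IsSquare (Algebra.norm K (x : L))) ∧ ∃ (s : L) (δ : Fˣ) (ψ : F →+* ℝ), τ s = -s ∧ s ^ 2 = algebraMap F L δ ∧
        ψ.comp (algebraMap K F) = φ ∧ ψ δ < 0 := by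
  obtain ⟨θ, h1, h2⟩ := hθ
  let F : IntermediateField K L := IntermediateField.fixedField (Subgroup.zpowers τ)
  have hF : ∀ x, x ∈ F ↔ τ x = x := fun x => by
    constructor
    · intro h
      exact h ⟨τ, Subgroup.mem_zpowers τ⟩
    · rintro h ⟨m, hm⟩
      have : Subgroup.zpowers τ ≤ MulAction.stabilizer (L ≃ₐ[K] L) x := Subgroup.zpowers_le.2 h
      exact this hm
  have h2' : Module.finrank F L = 2 := by
    rw [IntermediateField.finrank_fixedField_eq_card, Nat.card_zpowers]
    exact orderOf_eq_prime (AlgEquiv.ext fun x => by rw [sq]; exact hττ x) hτ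
  obtain ⟨y, hy⟩ : ∃ y, τ y ≠ y := by
    by_contra! h'
    exact hτ (AlgEquiv.ext h')
  have hs0 : τ y - y ≠ 0 := sub_ne_zero.2 hy
  have hsa : τ (τ y - y) = - (τ y - y) := by rw [map_sub, hττ]; ring
  generalize τ y - y = s at hs0 hsa
  have hsF : s ^ 2 ∈ F := (hF _).2 (by rw [map_pow, hsa]; ring)
  let θ' : F →+* ℂ := θ.comp (algebraMap F L)
  have hre : ∀ x : F, ((θ' x).re : ℂ) = θ' x := fun x => by
    have := h2 x
    rw [(hF _).1 x.2] at this
    exact Complex.conj_eq_iff_re.1 this.symm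
  let ψ : F →+* ℝ :=
    { toFun := fun x => (θ' x).re
      map_one' := by simp
      map_zero' := by simp
      map_mul' := fun x y => by
        apply Complex.ofReal_injective
        rw [Complex.ofReal_mul, hre, hre, hre, map_mul]
      map_add' := fun x y => by simp }
  have hδ0 : (⟨s ^ 2, hsF⟩ : F) ≠ 0 := fun h => hs0 (by simpa using congrArg Subtype.val h)
  refine ⟨F, hF, fun x => ⟨Algebra.norm K x, ?_⟩, s, Units.mk0 _ hδ0, ψ, hsa, rfl, RingHom.ext fun k => ?_, ?_⟩
  · rw [← Algebra.norm_norm (S := F)]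
    change Algebra.norm K (Algebra.norm F (algebraMap F L x)) = _
    rw [Algebra.norm_algebraMap, h2', map_pow, sq]
  · apply Complex.ofReal_injective
    change ((θ' _).re : ℂ) = _
    rw [hre, ← h1]; rfl
  · change (θ (s ^ 2)).re < 0
    have h3 := h2 s
    rw [hsa, map_neg] at h3
    have h4 : (θ s).re = 0 := by
      have := congrArg Complex.re h3
      simp at this; linarith
    have h5 : (θ s).im ≠ 0 := fun h => hs0 ((map_eq_zero θ).1 (Complex.ext h4 h))
    rw [map_pow, sq, Complex.mul_re, h4]
    have := mul_self_pos.2 h5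
    linarith
end HM

namespace HM
open NumberField IsDedekindDomain Matrix

lemma norm_pi {K I : Type*} [Field K] [Fintype I] [DecidableEq I] {L : I → Type*} [∀ i, Field (L i)] [∀ i, Algebra K (L i)]
    [∀ i, FiniteDimensional K (L i)] (x : ∀ i, L i) : Algebra.norm K x = ∏ i, Algebra.norm K (x i) := by
  let b := fun i => Module.finBasis K (L i)
  have h1 : ∀ (p q : Σ i, Fin (Module.finrank K (L i))), Algebra.leftMulMatrix (Pi.basis b) x p q =
      (b p.1).repr ((x * Pi.basis b q) p.1) p.2 := fun p q => by
    rw [Algebra.leftMulMatrix_eq_repr_mul, Pi.basis_repr]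
  rw [Algebra.norm_eq_matrix_det (Pi.basis b)]
  have ht : (Algebra.leftMulMatrix (Pi.basis b) x).BlockTriangular fun p => Fintype.equivFin I p.1 := by
    rintro ⟨i, k⟩ ⟨j, l⟩ h
    have hij : i ≠ j := by rintro rfl; exact lt_irrefl _ h
    rw [h1]
    simp [Pi.basis_apply, hij]
  rw [ht.det_fintype, ← (Fintype.equivFin I).prod_comp]
  refine Finset.prod_congr rfl fun i _ => ?_
  rw [Algebra.norm_eq_matrix_det (b i)]
  let g : Fin (Module.finrank K (L i)) ≃ {p : Σ i, Fin (Module.finrank K (L i)) // Fintype.equivFin I p.1 = Fintype.equivFin I i} :=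
    { toFun := fun k => ⟨⟨i, k⟩, rfl⟩
      invFun := fun p => ((Fintype.equivFin I).injective p.2) ▸ p.1.2
      left_inv := fun k => rfl
      right_inv := by
        rintro ⟨⟨j, k⟩, h⟩
        obtain rfl : j = i := (Fintype.equivFin I).injective h
        rfl }
  rw [← det_submatrix_equiv_self g]
  congr 1
  ext k l
  rw [submatrix_apply, toSquareBlock_def, of_apply, h1, Algebra.leftMulMatrix_eq_repr_mul]
  simp [g, Pi.basis_apply]

section
variable {K E : Type*} [Field K] [CommRing E] [Algebra K E] {ℓ : E →ₗ[K] K} {σ : E →ₐ[K] E} {n : ℕ}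
  {b : Module.Basis (Fin n) K E}

lemma tm_det {ℓ : E →ₗ[K] K} (hℓ : ∀ x, (∀ y, ℓ (x * y) = 0) → x = 0) (hσ : Function.Injective σ) (b : Module.Basis (Fin n) K E)
    {a : E} (ha : ∀ y, a * y = 0 → y = 0) : (tm ℓ σ b a).det ≠ 0 := by
  intro h
  obtain ⟨v, hv, h⟩ := Matrix.exists_mulVec_eq_zero_iff.2 h
  apply hv
  have h1 : ∀ y, ℓ (a * σ (b.equivFun.symm v) * y) = 0 := by
    intro y
    have : (ℓ.comp (LinearMap.mul K E (a * σ (b.equivFun.symm v)))) = 0 := b.ext fun i => by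
      have h2 := congrFun h i
      simp only [mulVec, dotProduct, tm, of_apply, Pi.zero_apply] at h2
      rw [LinearMap.zero_apply]
      refine Eq.trans ?_ h2
      change ℓ (a * σ (b.equivFun.symm v) * b i) = _
      rw [Module.Basis.equivFun_symm_apply, map_sum σ]
      simp only [Finset.mul_sum, Finset.sum_mul, map_sum]
      refine Finset.sum_congr rfl fun j _ => ?_
      rw [map_smul σ, mul_smul_comm, smul_mul_assoc, map_smul, smul_eq_mul, mul_comm, mul_right_comm]
    exact LinearMap.congr_fun this y
  have h3 := ha _ (hℓ _ h1)
  exact (map_eq_zero_iff _ b.equivFun.symm.injective).1 ((map_eq_zero_iff σ hσ).1 h3)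

lemma lmm_mul (y : E) (j : Fin n) : y * b j = ∑ i, Algebra.leftMulMatrix b y i j • b i := by
  conv_lhs => rw [← b.sum_repr (y * b j)]
  simp only [Algebra.leftMulMatrix_eq_repr_mul]

lemma tm_conj (a y z : E) : (Algebra.leftMulMatrix b y)ᵀ * tm ℓ σ b a * Algebra.leftMulMatrix b z = tm ℓ σ b (a * y * σ z) := by
  ext i j
  have : a * y * σ z * b i * σ (b j) = a * (y * b i) * σ (z * b j) := by rw [map_mul σ]; ring
  rw [lmm_mul y i, lmm_mul z j] at this
  simp only [tm, of_apply, this, mul_apply, transpose_apply, map_sum, Finset.mul_sum, Finset.sum_mul, map_smul, mul_smul_comm,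
    smul_mul_assoc, smul_eq_mul]
  refine Finset.sum_congr rfl fun k _ => Finset.sum_congr rfl fun l _ => ?_
  ring

lemma tm_det_norm (a : E) : (tm ℓ σ b a).det = Algebra.norm K a * (tm ℓ σ b 1).det := by
  have := congrArg det (tm_conj (ℓ := ℓ) (σ := σ) (b := b) 1 a 1)
  rw [map_one (Algebra.leftMulMatrix b), Matrix.mul_one, det_mul, det_transpose, ← Algebra.norm_eq_matrix_det, map_one σ, one_mul, mul_one] at this
  exact this.symm

/-- from a congruence to an embedding -/
lemma final_emb (hσ : ∀ x, σ (σ x) = x) {M : Matrix (Fin n) (Fin n) K} (hM : M.det ≠ 0) {a : E} (ha : (tm ℓ σ b a).det ≠ 0) (h : Cg M (tm ℓ σ b a)) :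
    ∃ ι : E →ₐ[K] Module.End K (Fin n → K), Function.Injective ι ∧ ∀ (a : E) (x y : Fin n → K),
      dotProduct (ι a x) (M.mulVec y) = dotProduct x (M.mulVec (ι (σ a) y)) := by
  obtain ⟨P, hP⟩ := h
  have hPd : IsUnit P.det := by
    rw [isUnit_iff_ne_zero]; intro h0
    rw [← hP, det_mul, h0, mul_zero] at ha; exact ha rfl
  have h1 : P * P⁻¹ = 1 := mul_nonsing_inv _ hPd
  have h2 : P⁻¹ * P = 1 := nonsing_inv_mul _ hPd
  have h3 : P⁻¹ᵀ * Pᵀ = 1 := by rw [← transpose_mul, h1, transpose_one]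
  let ι : E →ₐ[K] Matrix (Fin n) (Fin n) K := AlgHom.ofLinearMap
    { toFun := fun x => P * Algebra.leftMulMatrix b x * P⁻¹
      map_add' := fun x y => by rw [map_add, mul_add, add_mul]
      map_smul' := fun c x => by rw [map_smul, mul_smul_comm, smul_mul_assoc]; rfl }
    (by change P * Algebra.leftMulMatrix b 1 * P⁻¹ = 1; rw [map_one, mul_one, h1])
    (fun x y => by
      change P * Algebra.leftMulMatrix b (x * y) * P⁻¹ = P * Algebra.leftMulMatrix b x * P⁻¹ * (P * Algebra.leftMulMatrix b y * P⁻¹)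
      rw [map_mul]; simp only [Matrix.mul_assoc]; rw [← Matrix.mul_assoc P⁻¹ P, h2, Matrix.one_mul])
  have hι : ∀ x, ι x = P * Algebra.leftMulMatrix b x * P⁻¹ := fun x => rfl
  have hMP : M = P⁻¹ᵀ * tm ℓ σ b a * P⁻¹ := by
    rw [← hP]; simp only [Matrix.mul_assoc]
    rw [h1, Matrix.mul_one, ← Matrix.mul_assoc, h3, Matrix.one_mul]
  refine ⟨(Matrix.toLinAlgEquiv' : _ ≃ₐ[K] _).toAlgHom.comp ι, fun x y hxy => ?_, fun c x y => ?_⟩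
  · have hxy : ι x = ι y := Matrix.toLinAlgEquiv'.injective hxy
    rw [hι, hι] at hxy
    apply Algebra.leftMulMatrix_injective b
    have := congrArg (fun Z => P⁻¹ * Z * P) hxy
    simp only [Matrix.mul_assoc, h2, Matrix.mul_one] at this
    simpa only [← Matrix.mul_assoc, h2, Matrix.one_mul] using this
  · change dotProduct (ι c *ᵥ x) (M *ᵥ y) = dotProduct x (M *ᵥ (ι (σ c) *ᵥ y))
    have key : (ι c)ᵀ * M = M * ι (σ c) := by
      rw [hι, hι, hMP, transpose_mul, transpose_mul]
      have e1 := tm_conj (ℓ := ℓ) (σ := σ) (b := b) a c 1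
      have e2 := tm_conj (ℓ := ℓ) (σ := σ) (b := b) a 1 (σ c)
      rw [map_one (Algebra.leftMulMatrix b), Matrix.mul_one, map_one σ, mul_one] at e1
      rw [map_one (Algebra.leftMulMatrix b), transpose_one, Matrix.one_mul, mul_one, hσ, ← e1] at e2
      calc _ = P⁻¹ᵀ * ((Algebra.leftMulMatrix b c)ᵀ * (Pᵀ * P⁻¹ᵀ) * tm ℓ σ b a) * P⁻¹ := by simp only [Matrix.mul_assoc]
        _ = P⁻¹ᵀ * (tm ℓ σ b a * (P⁻¹ * P) * Algebra.leftMulMatrix b (σ c)) * P⁻¹ := by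
            rw [← transpose_mul P⁻¹ P, h2, transpose_one, Matrix.mul_one, Matrix.mul_one, e2]
        _ = _ := by simp only [Matrix.mul_assoc]
    rw [mulVec_mulVec, ← key, ← mulVec_mulVec, dotProduct_mulVec, dotProduct_mulVec, dotProduct_mulVec, vecMul_transpose]
end

section
variable {K E : Type*} [Field K] [CommRing E] [Algebra K E] 
  {I : Type*} [Fintype I] [DecidableEq I] {L : I → Type*} [∀ i, Field (L i)] [∀ i, Algebra K (L i)] (e : E ≃ₐ[K] Π i, L i)

/-- the trace -/
noncomputable def trE : E →ₗ[K] K := ∑ i, (Algebra.trace K (L i)).comp ((LinearMap.proj i).comp e.toLinearMap)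

lemma trE_apply (x : E) : trE e x = ∑ i, Algebra.trace K (L i) (e x i) := by
  simp [trE]

lemma trE_nondeg [CharZero K] [∀ i, FiniteDimensional K (L i)] (x : E) (h : ∀ y, trE e (x * y) = 0) : x = 0 := by
  refine e.injective (funext fun i => ?_)
  rw [map_zero, Pi.zero_apply]
  refine (traceForm_nondegenerate K (L i)).1 _ fun c => ?_
  have := h (e.symm (Pi.single i c))
  rw [trE_apply, Finset.sum_eq_single i] at this
  · simpa using this
  · intro j _ hj; simp [hj]
  · simp

lemma trE_sig {σ : E →ₐ[K] E} (τ : ∀ i, L i ≃ₐ[K] L i) (hτ : ∀ a i, e (σ a) i = τ i (e a i)) (x : E) : trE e (σ x) = trE e x := by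
  simp only [trE_apply, hτ, Algebra.trace_eq_of_algEquiv]
end
end HM

namespace HM
open NumberField IsDedekindDomain Matrix

lemma near_refl {K L : Type*} [Field K] [NumberField K] [Field L] [Algebra K L] (τ : L ≃ₐ[K] L) (v : Pl K) (a : L) : NearP τ v a a :=
  fun C ε hε => ⟨1, fun c _ => by simpa using hε⟩

lemma near_triv {K L : Type*} [Field K] [NumberField K] [Field L] [Algebra K L] {τ : L ≃ₐ[K] L} {v : Pl K} {k d : K}
    {z : v.C} (h : algebraMap K v.C d = algebraMap K v.C k * z ^ 2) : NearP τ v (algebraMap K L k) (algebraMap K L d) := by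
  intro C ε hε
  set B := ∑ c ∈ C, v.abs (Algebra.trace K L c)
  have hB : ∀ c ∈ C, v.abs (Algebra.trace K L c) ≤ B := fun c hc =>
    Finset.single_le_sum (f := fun c => v.abs (Algebra.trace K L c)) (fun c _ => v.abs.nonneg _) hc
  have hB0 : 0 ≤ B := Finset.sum_nonneg fun c _ => v.abs.nonneg _
  have hc : Continuous fun y : v.C => algebraMap K v.C k * y ^ 2 - algebraMap K v.C d := by fun_prop
  obtain ⟨ρ, h0, hρ⟩ := Metric.continuous_iff.1 hc z (ε / (B + 1)) (by positivity)
  obtain ⟨y, hy⟩ := Metric.denseRange_iff.1 (dense_alg v) z ρ h0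
  have h1 := hρ (algebraMap K v.C y) (by rwa [dist_comm])
  rw [dist_eq_norm, h, sub_self, sub_zero, ← h, ← map_pow, ← map_mul, ← map_sub, norm_alg] at h1
  refine ⟨algebraMap K L y, fun c hc => ?_⟩
  rw [τ.commutes, ← map_mul, ← map_mul, ← map_sub, ← Algebra.smul_def, map_smul, smul_eq_mul, map_mul]
  rw [lt_div_iff₀ (by positivity)] at h1
  have e : k * y * y - d = k * y ^ 2 - d := by ring
  rw [e]
  nlinarith [hB c hc, v.abs.nonneg (k * y ^ 2 - d)]

section
variable {K E : Type*} [Field K] [NumberField K] [CommRing E] [Algebra K E] {σ : E →ₐ[K] E}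
  {I : Type*} [Fintype I] [DecidableEq I] {L : I → Type*} [∀ i, Field (L i)] [∀ i, Algebra K (L i)]

lemma tm_isSymm {n : ℕ} {b : Module.Basis (Fin n) K E} {ℓ : E →ₗ[K] K} (hσ : ∀ x, σ (σ x) = x) (hℓ : ∀ x, ℓ (σ x) = ℓ x)
    {a : E} (ha : σ a = a) : (tm ℓ σ b a).IsSymm := by rw [IsSymm, tm_transpose hσ hℓ, ha]

lemma near_tm (hσ : ∀ x, σ (σ x) = x) (e : E ≃ₐ[K] Π i, L i) (τ : ∀ i, L i ≃ₐ[K] L i) (hτ : ∀ a i, e (σ a) i = τ i (e a i))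
    {n : ℕ} {b : Module.Basis (Fin n) K E} {v : Pl K} {l m : E} (hl : σ l = l) (hm : σ m = m)
    (hd : (tm (trE e) σ b m).det ≠ 0) (hN : ∀ i, NearP (τ i) v (e l i) (e m i)) :
    Cg (lm v (tm (trE e) σ b l)) (lm v (tm (trE e) σ b m)) := by
  classical
  have hℓ := trE_sig e τ hτ
  obtain ⟨ε, h0, H⟩ := near_cgK v (tm_isSymm hσ hℓ hm) hd
  choose y hy using fun i => hN i (Finset.univ.image fun p : Fin n × Fin n => e (b p.1 * σ (b p.2)) i) (ε / (Fintype.card I + 1)) (by positivity)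
  have hs : σ (l * e.symm y * σ (e.symm y)) = l * e.symm y * σ (e.symm y) := by
    rw [map_mul σ, map_mul σ, hl, hσ]; ring
  obtain ⟨h1, h2⟩ := H (tm (trE e) σ b (l * e.symm y * σ (e.symm y))) (tm_isSymm hσ hℓ hs) fun p q => by
    have h3 : tm (trE e) σ b (l * e.symm y * σ (e.symm y)) p q - tm (trE e) σ b m p q =
        ∑ i, Algebra.trace K (L i) ((e l i * y i * τ i (y i) - e m i) * e (b p * σ (b q)) i) := by
      simp only [tm, of_apply]
      rw [← map_sub, trE_apply]
      refine Finset.sum_congr rfl fun i _ => congrArg _ ?_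
      simp only [map_sub, map_mul, Pi.sub_apply, Pi.mul_apply, hτ, e.apply_symm_apply]; ring
    rw [h3]
    calc _ ≤ ∑ i, v.abs (Algebra.trace K (L i) ((e l i * y i * τ i (y i) - e m i) * e (b p * σ (b q)) i)) := v.abs.sum_le _ _
      _ ≤ ∑ i : I, ε / (Fintype.card I + 1) := Finset.sum_le_sum fun i _ =>
          (hy i _ (Finset.mem_image_of_mem (fun p : Fin n × Fin n => e (b p.1 * σ (b p.2)) i) (Finset.mem_univ (p, q)))).le
      _ < ε := by
          rw [Finset.sum_const, Finset.card_univ, nsmul_eq_mul, mul_div_assoc', div_lt_iff₀ (by positivity)]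
          nlinarith
  refine Cg.trans ?_ (h1.symm rfl (by rw [det_lm]; simpa using h2))
  exact Cg.map _ ⟨Algebra.leftMulMatrix b (e.symm y), tm_conj l _ _⟩
end

theorem core {K E : Type u} [Field K] [NumberField K] [CommRing E] [Algebra K E] [FiniteDimensional K E] [Algebra.Etale K E]
    {n : ℕ} (hdim : Module.finrank K E = n) {σ : E →ₐ[K] E} (hσ : ∀ x, σ (σ x) = x)
    {M : Matrix (Fin n) (Fin n) K} (hMs : M.IsSymm) (hMd : M.det ≠ 0)
    (hfin : ∀ v : IsDedekindDomain.HeightOneSpectrum (NumberField.RingOfIntegers K),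
      CompatibleLocalEmbedding K E σ n M (v.adicCompletion K))
    (hinf : ∀ v : NumberField.InfinitePlace K, CompatibleLocalEmbedding K E σ n M v.Completion)
    {I : Type u} [Fintype I] [DecidableEq I] {L : I → Type u} [∀ i, Field (L i)] [∀ i, Algebra K (L i)]
    [∀ i, FiniteDimensional K (L i)] (e : E ≃ₐ[K] Π i, L i) (τ : ∀ i, L i ≃ₐ[K] L i) (hτ : ∀ a i, e (σ a) i = τ i (e a i))
    (hττ : ∀ i x, τ i (τ i x) = x) {φ : K →+* ℝ}
    (hθ : ∀ i, ∃ θ : L i →+* ℂ, (∀ k, θ (algebraMap K (L i) k) = φ k) ∧ ∀ a, θ (τ i a) = starRingEnd ℂ (θ a))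
    (htriv : ∀ i, τ i = 1 → (∀ j, τ j = 1 → j = i) ∧ ∀ x : L i, ∃ k : K, x = algebraMap K (L i) k) :
    ∃ ι : E →ₐ[K] Module.End K (Fin n → K), Function.Injective ι ∧ ∀ (a : E) (x y : Fin n → K),
      dotProduct (ι a x) (M.mulVec y) = dotProduct x (M.mulVec (ι (σ a) y)) := by
  classical
  let b : Module.Basis (Fin n) K E := Module.finBasisOfFinrankEq K E hdim
  have hℓ := trE_sig e τ hτ
  have hnd := trE_nondeg e
  have hσi : Function.Injective σ := fun x y h => by rw [← hσ x, h, hσ]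
  have hB : (of fun i j => trE e (b i * b j)).det ≠ 0 := by
    have := tm_det (σ := AlgHom.id K E) hnd Function.injective_id b (a := 1) fun y h => by simpa using h
    simpa [tm] using this
  have hdet : ∀ a : E, (∀ i, e a i ≠ 0) → (tm (trE e) σ b a).det ≠ 0 := fun a ha =>
    tm_det hnd hσi b fun y h => e.injective (funext fun i => by
      have := congrFun (congrArg e h) i
      rw [map_mul, map_zero, Pi.mul_apply, Pi.zero_apply, mul_eq_zero] at this
      rw [map_zero, Pi.zero_apply]
      exact this.resolve_left (ha i))
  have hnorm : ∀ a : E, Algebra.norm K a = ∏ i, Algebra.norm K (e a i) := fun a => by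
    rw [← norm_pi, Algebra.norm_eq_of_algEquiv]
  have hne : ∀ a : E, (tm (trE e) σ b a).det ≠ 0 → ∀ i, e a i ≠ 0 := fun a ha i h0 => ha (by
    rw [tm_det_norm, hnorm, Finset.prod_eq_zero (Finset.mem_univ i) (by rw [h0, Algebra.norm_zero]), zero_mul])
  choose lam hlσ hld hlc using local_all hσ hℓ b hB hMs hMd hfin hinf
  choose F hF hsq s δ ψ hs hδ hψ hneg using fun j : {i // τ i ≠ 1} => nontriv_idx (hττ j.1) j.2 (hθ j.1)
  set T := (tm (trE e) σ b 1).det with hT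
  have hT0 : T ≠ 0 := hdet 1 fun i => by simp
  set D := M.det / T with hD
  have hD0 : D ≠ 0 := div_ne_zero hMd hT0
  let t : E → K := fun a => ∏ i, if τ i = 1 then Algebra.norm K (e a i) else 1
  have hnt : ∀ a, σ a = a → ∃ r, Algebra.norm K a = r ^ 2 * t a := fun a ha => by
    have : ∀ i, ∃ r : K, (if τ i = 1 then 1 else Algebra.norm K (e a i)) = r ^ 2 := fun i => by
      split_ifs with h
      · exact ⟨1, by simp⟩
      · obtain ⟨r, hr⟩ := hsq ⟨i, h⟩ ⟨e a i, (hF ⟨i, h⟩ _).2 (by rw [← hτ, ha])⟩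
        exact ⟨r, by rw [sq]; exact hr⟩
    choose r hr using this
    refine ⟨∏ i, r i, ?_⟩
    rw [hnorm, ← Finset.prod_pow, ← Finset.prod_mul_distrib]
    refine Finset.prod_congr rfl fun i _ => ?_
    rw [← hr]; split_ifs <;> simp
  have hDt : ∀ v : Pl K, ∃ z : v.C, algebraMap K v.C D = algebraMap K v.C (t (lam v)) * z ^ 2 := fun v => by
    obtain ⟨p, hp⟩ := (hlc v).det
    obtain ⟨r, hr⟩ := hnt _ (hlσ v)
    have h0 : (lm v (tm (trE e) σ b (lam v))).det ≠ 0 := by rw [det_lm]; simpa using hld v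
    have hp0 : p ≠ 0 := by rintro rfl; rw [hp] at h0; simp at h0
    have hMDT : M.det = D * T := by rw [hD, div_mul_cancel₀ _ hT0]
    rw [det_lm, det_lm, tm_det_norm, hr, ← hT, hMDT] at hp
    simp only [map_mul, map_pow] at hp
    have hT' : algebraMap K v.C T ≠ 0 := by simpa using hT0
    refine ⟨algebraMap K v.C r / p, ?_⟩
    rw [div_pow, mul_div_assoc', eq_div_iff (pow_ne_zero 2 hp0)]
    apply mul_right_cancel₀ hT'
    linear_combination -hp
  have hntriv : ∀ i, τ i = 1 → ∀ k, Algebra.norm K (algebraMap K (L i) k) = k := fun i hi k => by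
    rw [Algebra.norm_algebraMap, finrank_eq_one (1 : L i) one_ne_zero fun w => by
      obtain ⟨k, rfl⟩ := (htriv i hi).2 w
      exact ⟨k, by rw [Algebra.algebraMap_eq_smul_one]⟩, pow_one]
  let l1 : E := e.symm fun i => if τ i = 1 then algebraMap K (L i) D else 1
  have hl1σ : σ l1 = l1 := e.injective (funext fun i => by
    rw [hτ]; simp only [l1, e.apply_symm_apply]
    split_ifs <;> simp)
  have hl1d : (tm (trE e) σ b l1).det ≠ 0 := hdet _ fun i => by
    simp only [l1, e.apply_symm_apply]
    split_ifs <;> simp [hD0]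
  have ht1 : ∀ i, τ i = 1 → ∀ a, t a = Algebra.norm K (e a i) := fun i hi a => by
    change ∏ i, _ = _
    rw [Finset.prod_eq_single i, if_pos hi]
    · intro j _ hj; rw [if_neg fun h => hj ((htriv i hi).1 j h)]
    · simp
  obtain ⟨R, -, hR⟩ := unit_cg hMs (tm_isSymm hσ hℓ hl1σ) hMd hl1d (by
    by_cases h : ∃ i, τ i = 1
    · obtain ⟨i, hi⟩ := h
      obtain ⟨r, hr⟩ := hnt l1 hl1σ
      refine ⟨r, ?_⟩
      rw [tm_det_norm, hr, ht1 i hi]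
      simp only [l1, e.apply_symm_apply, if_pos hi]
      rw [hntriv i hi, ← hT, hD]; field_simp
    · push Not at h
      have hsqD : IsSquare ((Units.mk0 D hD0 : Kˣ) : K) := sq_of_local fun v => by
        obtain ⟨z, hz⟩ := hDt v
        refine mem_Sq.2 ⟨z, ?_⟩
        rw [Units.val_mk0, hz, ← sq]
        simp [t, h]
      obtain ⟨q, hq⟩ := hsqD
      obtain ⟨r, hr⟩ := hnt l1 hl1σ
      have hq' : D = q * q := hq
      have hq0 : q ≠ 0 := by rintro rfl; simp at hq'; exact hD0 hq'
      have ht : t l1 = 1 := by simp [t, h]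
      have hMDT : M.det = q * q * T := by rw [← hq', hD, div_mul_cancel₀ _ hT0]
      refine ⟨r / q, ?_⟩
      rw [tm_det_norm, hr, ht, ← hT, hMDT]; field_simp)
  haveI : ∀ j : {i // τ i ≠ 1}, NumberField (F j) := fun j => NumberField.of_module_finite K (F j)
  obtain ⟨p₀, hp₀, hw⟩ := exists_p0 (fun j : {i // τ i ≠ 1} => F j) δ φ ψ hψ hneg R
  choose w hw1 hw2 using hw
  have hlF : ∀ (j : {i // τ i ≠ 1}) v, e (lam v) j ∈ F j := fun j v => (hF j _).2 (by rw [← hτ, hlσ])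
  let x : ∀ j : {i // τ i ≠ 1}, Pl K → (F j)ˣ := fun j v => if v ∈ R then
    Units.mk0 ⟨e (lam v) j, hlF j v⟩ (fun h => hne _ (hld v) j (congrArg Subtype.val h)) else 1
  choose μ hμ using fun j : {i // τ i ≠ 1} => exists_mu (τ j.1 : L j →ₐ[K] L j) (fun y : F j => (hF j _).1 y.2) (hs j) (hδ j)
    (hw1 j) (hw2 j) R hp₀ (x j) (fun v hv => if_neg hv)
  let m : E := e.symm fun i => if h : τ i = 1 then algebraMap K (L i) D else algebraMap (F ⟨i, h⟩) (L i) (μ ⟨i, h⟩)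
  have hmσ : σ m = m := e.injective (funext fun i => by
    rw [hτ]; simp only [m, e.apply_symm_apply]
    split_ifs with h
    · simp
    · exact (hF ⟨i, h⟩ _).1 (μ ⟨i, h⟩ : F ⟨i, h⟩).2)
  have hmd : (tm (trE e) σ b m).det ≠ 0 := hdet _ fun i => by
    simp only [m, e.apply_symm_apply]
    split_ifs <;> simp [hD0]
  refine final_emb hσ hMd hmd (hm p₀ hMs (tm_isSymm hσ hℓ hmσ) hMd hmd fun v hv => ?_)
  by_cases hvR : v ∈ R
  · refine (hlc v).trans (near_tm hσ e τ hτ (hlσ v) hmσ hmd fun i => ?_)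
    by_cases h : τ i = 1
    · obtain ⟨k, hk⟩ := (htriv i h).2 (e (lam v) i)
      obtain ⟨z, hz⟩ := hDt v
      rw [ht1 i h, hk, hntriv i h] at hz
      simp only [m, e.apply_symm_apply, dif_pos h]
      rw [hk]
      exact near_triv hz
    · have := hμ ⟨i, h⟩ v hv
      simp only [m, e.apply_symm_apply, dif_neg h]
      simp only [x, if_pos hvR] at this
      exact this
  · refine (hR v hvR).trans (near_tm hσ e τ hτ hl1σ hmσ hmd fun i => ?_)
    by_cases h : τ i = 1
    · simp only [m, l1, e.apply_symm_apply, dif_pos h, if_pos h]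
      exact near_refl _ _ _
    · have := hμ ⟨i, h⟩ v hv
      simp only [m, l1, e.apply_symm_apply, dif_neg h, if_neg h]
      simp only [x, if_neg hvR] at this
      simpa using this

end HM

/-- Let `K` be a number field, `E` a finite étale commutative `K`-algebra of
dimension `n`, and `σ` a `K`-linear algebra involution of `E` with `dim_K E^σ = ⌊(n+1)/2⌋`.
Let `f` be a nondegenerate symmetric bilinear form on `K^n` with symmetric Gram matrix `M` of
nonzero determinant.  Assume (a) for every place `v` of `K` (finite or archimedean) there is an
injective `K_v`-algebra homomorphism `ι_v : E ⊗_K K_v → End_{K_v} (K_v^n)` compatible with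
`σ ⊗ id` and `f_v`; and (b) there is a real archimedean place `v` of `K` such that, identifying
`K_v` with `ℝ` via the associated real embedding, `(E ⊗_K K_v, σ ⊗ id)` is isomorphic to
`(ℂ, conj)^m` if `n = 2m` or `(ℂ, conj)^m × (ℝ, id)` if `n = 2m + 1`.  Then there is an
injective `K`-algebra homomorphism `ι : E → End_K (K^n)` with
`f (ι a x, y) = f (x, ι (σ a) y)` for all `a ∈ E` and `x, y ∈ K^n`. -/
theorem statement16 {K E : Type u} [Field K] [NumberField K]
    [CommRing E] [Algebra K E] [FiniteDimensional K E] [Algebra.Etale K E]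
    (n : ℕ) (hdim : Module.finrank K E = n)
    (σ : E →ₐ[K] E) (hσ : ∀ x, σ (σ x) = x)
    (hfix : Module.finrank K (LinearMap.ker (σ.toLinearMap - LinearMap.id)) = (n + 1) / 2)
    (M : Matrix (Fin n) (Fin n) K) (hMsym : M.IsSymm) (hMdet : M.det ≠ 0)
    (hfin : ∀ v : IsDedekindDomain.HeightOneSpectrum (NumberField.RingOfIntegers K),
      CompatibleLocalEmbedding K E σ n M (v.adicCompletion K))
    (hinf : ∀ v : NumberField.InfinitePlace K,
      CompatibleLocalEmbedding K E σ n M v.Completion)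
    (hspecial : ∃ (v : NumberField.InfinitePlace K) (hv : v.IsReal),
      IsAnisotropicRealFiber K E σ n (NumberField.InfinitePlace.embedding_of_isReal hv)) :
    ∃ ι : E →ₐ[K] Module.End K (Fin n → K),
      Function.Injective ι ∧
        ∀ (a : E) (x y : Fin n → K),
          dotProduct (ι a x) (M.mulVec y) =
            dotProduct x (M.mulVec (ι (σ a) y)) := by
  classical
  obtain ⟨v, hv, hsp⟩ := hspecial
  obtain ⟨I, hI, L, _, _, e, hL⟩ := (Algebra.Etale.iff_exists_algEquiv_prod K E).1 (inferInstance : Algebra.Etale K E)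
  haveI := Fintype.ofFinite I
  haveI : ∀ i, FiniteDimensional K (L i) := fun i => (hL i).1
  obtain ⟨τ, h1, h2, h3⟩ := HM.exists_tau e hσ fun x hx => HM.spec_char hsp hx
  exact HM.core hdim hσ hMsym hMdet hfin hinf e τ h1 h2 h3 fun i hi => HM.triv_idx e hσ hdim hfix τ h1 h2 hi
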